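/- Let n be 5 or 6 and let q be a prime power such that gcd(q, n) = 1. Then there exists an element α in F_{q^n}* such that both α and α^{-1} are simultaneously primitive and 1-normal over F_q, with the sole genuine exception (q, n) = (4, 5), for which no such α exists. -/

import Mathlib

open Polynomial

noncomputable section

/-- The action `h ∘ β = Σ_i a_i β^{q^i}` of a polynomial `h = Σ_i a_i x^i` over `F_q`
on an element `β` of an extension field. -/
def polyAct {Fq F : Type*} [Field Fq] [Field F] [Algebra Fq F]
    (q : ℕ) (h : Fq[X]) (β : F) : F :=
  h.sum fun i a => algebraMap Fq F a * β ^ q ^ i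

/-- `h` is the `F_q`-order of `β`: the monic divisor of `x^n - 1` of least degree
annihilating `β`. -/
def IsFqOrder {Fq F : Type*} [Field Fq] [Field F] [Algebra Fq F]
    (q n : ℕ) (h : Fq[X]) (β : F) : Prop :=
  h.Monic ∧ h ∣ (X ^ n - 1 : Fq[X]) ∧ polyAct q h β = 0 ∧
    ∀ h' : Fq[X], h'.Monic → h' ∣ (X ^ n - 1 : Fq[X]) → polyAct q h' β = 0 →
      h.natDegree ≤ h'.natDegree

/-- `α` is `k`-normal over `F_q`: its `F_q`-order has degree `n - k`. -/
def IsKNormal (Fq : Type*) {F : Type*} [Field Fq] [Field F] [Algebra Fq F]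
    (q n k : ℕ) (α : F) : Prop :=
  ∃ h : Fq[X], IsFqOrder q n h α ∧ h.natDegree = n - k

/-- A linear combination of nonzero polynomials of pairwise distinct degrees vanishes only if it is
trivial. -/
theorem sum_C_mul_ne_zero_of_natDegree_injective {K ι : Type*} [Field K] [Fintype ι]
    (p : ι → K[X]) (hp : ∀ i, p i ≠ 0) (hinj : Function.Injective fun i => (p i).natDegree)
    (c : ι → K) (hc : c ≠ 0) : ∑ i, C (c i) * p i ≠ 0 := by
  obtain ⟨i, hi⟩ := Function.ne_iff.1 hc
  have hne : C (c i) * p i ≠ 0 := mul_ne_zero (by simpa using hi) (hp i)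
  intro h
  have hdeg := degree_sum_eq_of_disjoint (fun i => C (c i) * p i) Finset.univ (by
    intro j hj l hl hjl
    have hj0 : c j ≠ 0 := fun h0 => hj.2 (by simp [h0])
    have hl0 : c l ≠ 0 := fun h0 => hl.2 (by simp [h0])
    simp only [Function.onFun, Function.comp, degree_C_mul hj0, degree_C_mul hl0,
      degree_eq_natDegree (hp j), degree_eq_natDegree (hp l)]
    exact fun h => hjl (hinj (by exact_mod_cast h)))
  rw [h, degree_zero] at hdeg
  have := Finset.le_sup (f := fun i => (C (c i) * p i).degree) (Finset.mem_univ i)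
  rw [← hdeg, le_bot_iff, degree_eq_bot] at this
  exact hne this

theorem exists_algHom_pow_card_pow (k E : Type*) [Field k] [Fintype k] [CommRing E] [Algebra k E]
    (μ : ℕ) : ∃ φ : E →ₐ[k] E, ∀ x, φ x = x ^ Fintype.card k ^ μ := by
  induction μ with
  | zero => exact ⟨AlgHom.id k E, by simp⟩
  | succ μ ih =>
    obtain ⟨φ, hφ⟩ := ih
    refine ⟨(FiniteField.frobeniusAlgHom k E).comp φ, fun x => ?_⟩
    simp [hφ, FiniteField.coe_frobeniusAlgHom, pow_succ, pow_mul]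

section Stepanov

variable {k E : Type*} [Field k] [Fintype k] [Field E] [Algebra k E]

/-- The polynomial `X ^ D * ∑ t < μ, (a X ^ (d Q ^ t) + b X ^ (-d Q ^ t))`, where
`D = d Q ^ (μ - 1)`. -/
def stepanovPoly (a b : E) (d Q μ : ℕ) : E[X] :=
  ∑ t ∈ Finset.range μ, (C a * X ^ (d * Q ^ (μ - 1) + d * Q ^ t) +
    C b * X ^ (d * Q ^ (μ - 1) - d * Q ^ t))

theorem eval_stepanovPoly (a b : E) (d Q μ : ℕ) (hQ : 1 ≤ Q) {z : E} (hz : z ≠ 0) :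
    (stepanovPoly a b d Q μ).eval z = z ^ (d * Q ^ (μ - 1)) *
      ∑ t ∈ Finset.range μ, (a * z ^ (d * Q ^ t) + b * (z⁻¹) ^ (d * Q ^ t)) := by
  rw [stepanovPoly, eval_finsetSum, Finset.mul_sum]
  refine Finset.sum_congr rfl fun t ht => ?_
  have : d * Q ^ t ≤ d * Q ^ (μ - 1) :=
    Nat.mul_le_mul_left _ (Nat.pow_le_pow_right hQ (by have := Finset.mem_range.1 ht; omega))
  simp only [eval_add, eval_mul, eval_C, eval_pow, eval_X, pow_sub₀ z hz this, pow_add, inv_pow]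
  ring

theorem natDegree_stepanovPoly {a : E} (b : E) (ha : a ≠ 0) {d Q μ : ℕ} (hd : 1 ≤ d) (hQ : 2 ≤ Q)
    (hμ : 1 ≤ μ) : (stepanovPoly a b d Q μ).natDegree = 2 * (d * Q ^ (μ - 1)) := by
  have hD : 1 ≤ d * Q ^ (μ - 1) := Nat.one_le_iff_ne_zero.2 (by positivity)
  apply natDegree_eq_of_le_of_coeff_ne_zero
  · refine natDegree_sum_le_of_forall_le _ _ fun t ht => ?_
    have : d * Q ^ t ≤ d * Q ^ (μ - 1) := Nat.mul_le_mul_left _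
      (Nat.pow_le_pow_right (by omega) (by have := Finset.mem_range.1 ht; omega))
    refine (natDegree_add_le _ _).trans (max_le ?_ ?_)
    · exact (natDegree_C_mul_X_pow_le _ _).trans (by omega)
    · exact (natDegree_C_mul_X_pow_le _ _).trans (by omega)
  · rw [stepanovPoly, finsetSum_coeff, Finset.sum_eq_single (μ - 1)]
    · simp only [coeff_add, coeff_C_mul, coeff_X_pow]
      rw [if_pos (by omega), if_neg (by omega)]
      simpa using ha
    · intro t ht htμ
      have hlt : d * Q ^ t < d * Q ^ (μ - 1) := Nat.mul_lt_mul_of_pos_left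
        (Nat.pow_lt_pow_right (by omega) (by have := Finset.mem_range.1 ht; omega)) (by omega)
      simp only [coeff_add, coeff_C_mul, coeff_X_pow]
      rw [if_neg (by omega), if_neg (by omega)]
      simp
    · intro h; exact absurd (Finset.mem_range.2 (by omega)) h

/-- Stepanov's method: a polynomial of degree about `B ^ 2 / Q` which vanishes at every `z` with
`∑ t < 2 μ, (a z ^ d + b z ^ (-d)) ^ (Q ^ t) = c`. -/
theorem card_filter_trace_eq_le [Fintype E] (a b : k) (ha : a ≠ 0) (d μ : ℕ) (hd : 1 ≤ d)
    (hμ : 1 ≤ μ)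
    (hdQ : d.Coprime (Fintype.card k)) (hE : Fintype.card E = (Fintype.card k ^ μ) ^ 2) (c : E)
    (Z : Finset E)
    (hZ : ∀ z ∈ Z, z ≠ 0 ∧ ∑ t ∈ Finset.range (2 * μ),
      (algebraMap k E a * z ^ d + algebraMap k E b * z⁻¹ ^ d) ^ (Fintype.card k ^ t) = c) :
    Z.card ≤ Fintype.card k ^ (2 * μ - 1) + 4 * d * Fintype.card k ^ μ := by
  classical
  have hQ : 2 ≤ Fintype.card k := Fintype.one_lt_card
  set Q := Fintype.card k with hQdef
  set R := Q ^ (μ - 1) with hR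
  have hR1 : 1 ≤ R := Nat.one_le_pow _ _ (by omega)
  set B := Q ^ μ with hB
  have hBR : B = Q * R := by rw [hB, hR, ← pow_succ', Nat.sub_add_cancel hμ]
  set a' := algebraMap k E a
  set b' := algebraMap k E b
  have ha' : a' ≠ 0 := by simpa [a'] using ha
  set D := d * R with hD
  set J := R + 2 * d with hJ
  set H := stepanovPoly a' b' d Q μ with hH
  have hHdeg : H.natDegree = 2 * D := natDegree_stepanovPoly b' ha' hd hQ hμ
  have hH0 : H ≠ 0 := by
    intro h
    have : D ≠ 0 := by positivity
    simp [h] at hHdeg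
    omega
  obtain ⟨φ, hφ⟩ : ∃ φ : E →ₐ[k] E, ∀ x, φ x = x ^ B := exists_algHom_pow_card_pow k E μ
  have hφφ : ∀ x : E, (x ^ B) ^ B = x := fun x => by
    rw [← pow_mul, ← sq, ← hE, FiniteField.pow_card]
  -- the half trace
  let hh : E → E := fun z => ∑ t ∈ Finset.range μ, (a' * z ^ (d * Q ^ t) + b' * z⁻¹ ^ (d * Q ^ t))
  have hterm : ∀ (t : ℕ) (z : E), (a' * z ^ d + b' * z⁻¹ ^ d) ^ Q ^ t =
      a' * z ^ (d * Q ^ t) + b' * z⁻¹ ^ (d * Q ^ t) := by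
    intro t z
    obtain ⟨σ, hσ⟩ := exists_algHom_pow_card_pow k E t
    rw [← hσ, map_add, map_mul, map_mul, σ.commutes, σ.commutes, hσ, hσ, pow_mul, pow_mul]
  have hhB : ∀ z ∈ Z, hh z ^ B = c - hh z := by
    intro z hz
    rw [eq_sub_iff_add_eq', ← (hZ z hz).2, two_mul, Finset.sum_range_add]
    congr 1
    · exact Finset.sum_congr rfl fun t _ => (hterm t z).symm
    · rw [← hφ, map_sum]
      refine Finset.sum_congr rfl fun t _ => ?_
      rw [← hterm, hφ, ← pow_mul, ← pow_add, add_comm μ t]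
  -- the auxiliary coefficients
  let ι := Fin R × Fin J × Fin Q
  let n₁ := B * R - B + J + 2 * D * (Q - 1)
  let G : ι → E[X] := fun i =>
    X ^ (B * (i.1 : ℕ) + i.2.1) * (C c * X ^ D - H) ^ (i.2.2 : ℕ) * X ^ (D * (Q - 1 - i.2.2))
  have hG : ∀ i, G i ∈ degreeLT E n₁ := by
    rintro ⟨u, j, i⟩
    rw [mem_degreeLT]
    refine lt_of_le_of_lt degree_le_natDegree ?_
    norm_cast
    have h1 : (C c * X ^ D - H).natDegree ≤ 2 * D := by
      refine (natDegree_sub_le _ _).trans (max_le ?_ hHdeg.le)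
      exact (natDegree_C_mul_X_pow_le _ _).trans (by omega)
    have h2 : (G ⟨u, j, i⟩).natDegree ≤ (B * u + j) + i * (2 * D) + D * (Q - 1 - i) := by
      refine natDegree_mul_le_of_le (natDegree_mul_le_of_le (natDegree_X_pow_le _) ?_)
        (natDegree_X_pow_le _)
      exact natDegree_pow_le_of_le _ h1
    have h3 : B * u + B ≤ B * R := by
      rw [← Nat.mul_succ]; exact Nat.mul_le_mul_left _ u.2
    have h4 : i * (2 * D) + D * (Q - 1 - i) ≤ 2 * D * (Q - 1) := by
      obtain ⟨e, he⟩ := Nat.exists_eq_add_of_le (show (i : ℕ) ≤ Q - 1 by have := i.2; omega)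
      rw [he, Nat.add_sub_cancel_left]
      nlinarith
    have := j.2
    simp only [n₁]
    omega
  have hdep : ∃ e : ι → E, e ≠ 0 ∧ ∑ i, C (e i) * G i = 0 := by
    have hcard : Module.finrank E (degreeLT E n₁) < Fintype.card ι := by
      have : Module.finrank E (degreeLT E n₁) = n₁ := by
        rw [(degreeLTEquiv E n₁).finrank_eq]; simp
      rw [this]
      simp only [ι, n₁, Fintype.card_prod, Fintype.card_fin]
      have e1 : B ≤ B * R := Nat.le_mul_of_pos_right _ hR1
      have e2 : R * (J * Q) = B * R + 2 * d * B := by rw [hJ, hBR]; ring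
      have e3 : 2 * D * (Q - 1) + 2 * D = 2 * d * B := by
        obtain ⟨Q', hQ'⟩ : ∃ Q', Q = Q' + 1 := ⟨Q - 1, by omega⟩
        rw [hD, hBR, hQ', Nat.add_sub_cancel]; ring
      have e4 : R < B := by rw [hBR]; nlinarith
      have e5 : d ≤ D := Nat.le_mul_of_pos_right _ hR1
      omega
    have hnli : ¬ LinearIndependent E (fun i => (⟨G i, hG i⟩ : degreeLT E n₁)) := by
      intro hli
      exact absurd hli.fintype_card_le_finrank (by omega)
    obtain ⟨e, he, i, hi⟩ := Fintype.not_linearIndependent_iff.1 hnli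
    refine ⟨e, fun h => hi (by simp [h]), ?_⟩
    have := congrArg Subtype.val he
    simpa [smul_eq_C_mul] using this
  obtain ⟨e, he0, he⟩ := hdep
  let p : ι → E[X] := fun i => X ^ ((i.1 : ℕ) + B * i.2.1) * H ^ (i.2.2 : ℕ) *
    X ^ (D * (Q - 1 - i.2.2))
  have hp0 : ∀ i, p i ≠ 0 := fun i => by simp [p, hH0]
  have hpdeg : ∀ i, (p i).natDegree = (i.1 + B * i.2.1) + D * (Q - 1) + D * i.2.2 := by
    rintro ⟨u, j, i⟩
    simp only [p]
    rw [natDegree_mul (by simp [hH0]) (by simp), natDegree_mul (by simp) (by simp [hH0]),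
      natDegree_X_pow, natDegree_X_pow, natDegree_pow, hHdeg]
    obtain ⟨e, he⟩ := Nat.exists_eq_add_of_le (show (i : ℕ) ≤ Q - 1 by have := i.2; omega)
    rw [he, Nat.add_sub_cancel_left]
    ring
  have hpinj : Function.Injective fun i => (p i).natDegree := by
    rintro ⟨u, j, i⟩ ⟨u', j', i'⟩ h
    simp only [hpdeg] at h
    have h1 : (u : ℕ) + R * (Q * j + d * i) = u' + R * (Q * j' + d * i') := by
      rw [hD, hBR] at h; linarith
    have hu : (u : ℕ) = u' := by
      have := congrArg (· % R) h1
      simpa [Nat.mod_eq_of_lt u.2, Nat.mod_eq_of_lt u'.2] using this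
    have h2 : Q * j + d * i = Q * j' + d * i' := by
      rw [hu] at h1
      exact Nat.eq_of_mul_eq_mul_left hR1 (Nat.add_left_cancel h1)
    have hi : (i : ℕ) = i' := by
      have h3 : d * i ≡ d * i' [MOD Q] := by
        have := congrArg (· % Q) h2
        simpa [Nat.ModEq] using this
      exact (h3.cancel_left_of_coprime (by
        simpa [Nat.coprime_iff_gcd_eq_one, Nat.gcd_comm] using hdQ)).eq_of_lt_of_lt
        i.2 i'.2
    have hj : (j : ℕ) = j' := by
      rw [hi] at h2
      exact Nat.eq_of_mul_eq_mul_left (by omega) (Nat.add_right_cancel h2)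
    exact Prod.ext (Fin.ext hu) (Prod.ext (Fin.ext hj) (Fin.ext hi))
  set Ψ := ∑ i, C (e i ^ B) * p i with hΨ
  have hΨ0 : Ψ ≠ 0 := by
    refine sum_C_mul_ne_zero_of_natDegree_injective p hp0 hpinj _ fun h => he0 ?_
    funext i
    have := congrFun h i
    exact (pow_eq_zero_iff (by positivity)).1 this
  have hΨroot : ∀ z ∈ Z, Ψ.eval z = 0 := by
    intro z hz
    have hz0 := (hZ z hz).1
    have hHz : H.eval z = z ^ D * hh z := eval_stepanovPoly a' b' d Q μ (by omega) hz0
    have hsum : ∑ i : ι, e i * (z ^ (B * (i.1 : ℕ) + i.2.1) * (c - hh z) ^ (i.2.2 : ℕ)) = 0 := by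
      have h := congrArg (eval z) he
      rw [eval_finsetSum, eval_zero] at h
      have h' : z ^ (D * (Q - 1)) *
          ∑ i : ι, e i * (z ^ (B * (i.1 : ℕ) + i.2.1) * (c - hh z) ^ (i.2.2 : ℕ)) = 0 := by
        rw [← h, Finset.mul_sum]
        refine Finset.sum_congr rfl fun i _ => ?_
        simp only [G, eval_mul, eval_C, eval_pow, eval_X, eval_sub, hHz]
        obtain ⟨f, hf⟩ := Nat.exists_eq_add_of_le
          (show (i.2.2 : ℕ) ≤ Q - 1 by have := i.2.2.2; omega)
        rw [hf, Nat.add_sub_cancel_left, mul_add, pow_add,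
          show c * z ^ D - z ^ D * hh z = z ^ D * (c - hh z) by ring, mul_pow, ← pow_mul z D]
        ring
      exact (mul_eq_zero.1 h').resolve_left (pow_ne_zero _ hz0)
    have hB0 : B ≠ 0 := by positivity
    rw [← pow_eq_zero_iff hB0, ← hφ, hΨ, eval_finsetSum, map_sum]
    rw [← mul_zero (z ^ (B * D * (Q - 1))), ← hsum, Finset.mul_sum]
    refine Finset.sum_congr rfl fun i _ => ?_
    simp only [p, eval_mul, eval_C, eval_pow, eval_X, hHz]
    rw [map_mul, map_mul, map_mul, hφ, hφφ, map_pow φ (z ^ D * hh z), map_mul, map_pow φ z D]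
    rw [hφ (hh z), hhB z hz, hφ, hφ, hφ]
    obtain ⟨f, hf⟩ := Nat.exists_eq_add_of_le
      (show (i.2.2 : ℕ) ≤ Q - 1 by have := i.2.2.2; omega)
    have hBj : (z ^ (B * (i.2.1 : ℕ))) ^ B = z ^ (i.2.1 : ℕ) := by
      rw [← pow_mul, mul_right_comm, pow_mul, pow_mul, hφφ]
    rw [hf, Nat.add_sub_cancel_left, pow_add z, mul_pow (z ^ _), hBj, mul_pow ((z ^ B) ^ D)]
    ring
  have hle : Z.card ≤ Ψ.natDegree := by
    refine (Finset.card_le_card fun z hz => ?_).trans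
      ((Multiset.toFinset_card_le _).trans (card_roots' Ψ))
    rw [Multiset.mem_toFinset, mem_roots hΨ0]
    exact hΨroot z hz
  refine hle.trans (natDegree_sum_le_of_forall_le _ _ fun i _ => ?_)
  refine (natDegree_C_mul_le _ _).trans ?_
  rw [hpdeg]
  obtain ⟨u, j, i⟩ := i
  have hu : (u : ℕ) + 1 ≤ R := u.2
  have hi : (i : ℕ) + 1 ≤ Q := i.2
  have hj : B * j + B ≤ B * J := by rw [← Nat.mul_succ]; exact Nat.mul_le_mul_left _ j.2
  have e1 : Q ^ (2 * μ - 1) = B * R := by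
    rw [hB, hR, ← pow_add]; congr 1; omega
  have e2 : B * J = B * R + 2 * d * B := by rw [hJ]; ring
  have e3 : D * (Q - 1) + D * i ≤ 2 * d * B := by
    rw [← mul_add]
    calc D * (Q - 1 + i) ≤ D * (2 * Q) := Nat.mul_le_mul_left _ (by omega)
      _ = 2 * d * B := by rw [hD, hBR]; ring
  have e4 : R ≤ B := by rw [hBR]; exact Nat.le_mul_of_pos_left _ (by omega)
  have e5 : 4 * d * B = 2 * d * B + 2 * d * B := by ring
  simp only at *
  omega

end Stepanov

section Monics

open Classical UniqueFactorizationMonoid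

theorem finite_setOf_monic_natDegree_eq (k : Type*) [Field k] [Finite k] (N : ℕ) :
    {f : k[X] | f.Monic ∧ f.natDegree = N}.Finite := by
  have : Finite (degreeLT k N) := (degreeLTEquiv k N).toEquiv.finite_iff.2 inferInstance
  have : Finite {f : k[X] // f.Monic ∧ f.natDegree = N} := (monicEquivDegreeLT N).finite_iff.2 this
  exact Set.finite_coe_iff.1 this

/-- The monic polynomials of degree `N` over a finite field. -/
def monicsOfDegree (k : Type*) [Field k] [Finite k] (N : ℕ) : Finset k[X] :=
  (finite_setOf_monic_natDegree_eq k N).toFinset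

variable {k : Type*} [Field k]

@[simp] theorem mem_monicsOfDegree [Finite k] {N : ℕ} {f : k[X]} :
    f ∈ monicsOfDegree k N ↔ f.Monic ∧ f.natDegree = N := by
  simp [monicsOfDegree]

/-- The monic irreducible polynomials of degree `N` over a finite field. -/
def irredsOfDegree (k : Type*) [Field k] [Finite k] (N : ℕ) : Finset k[X] :=
  (monicsOfDegree k N).filter Irreducible

@[simp] theorem mem_irredsOfDegree [Finite k] {N : ℕ} {f : k[X]} :
    f ∈ irredsOfDegree k N ↔ (f.Monic ∧ f.natDegree = N) ∧ Irreducible f := by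
  simp [irredsOfDegree]

theorem count_normalizedFactors_eq_card_filter {f P : k[X]} (hf : f ≠ 0) (hP : P.Monic)
    (hPi : Irreducible P) {N : ℕ} (hN : f.natDegree ≤ N) :
    (normalizedFactors f).count P = ((Finset.Icc 1 N).filter fun j => P ^ j ∣ f).card := by
  have key : ∀ j, P ^ j ∣ f ↔ j ≤ (normalizedFactors f).count P := fun j => by
    rw [pow_dvd_iff_le_emultiplicity,
      emultiplicity_eq_count_normalizedFactors hPi hf, hP.normalize_eq_self]
    exact_mod_cast Iff.rfl
  have hle : (normalizedFactors f).count P ≤ N := by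
    have h1 := natDegree_le_of_dvd ((key _).2 le_rfl) hf
    rw [hP.natDegree_pow] at h1
    have h2 := hPi.natDegree_pos
    nlinarith
  rw [show ((Finset.Icc 1 N).filter fun j => P ^ j ∣ f) =
    Finset.Icc 1 ((normalizedFactors f).count P) by
      ext j; simp only [Finset.mem_filter, Finset.mem_Icc, key]; omega]
  simp

theorem natDegree_eq_sum_irreds [Finite k] {f : k[X]} (hf : f.Monic) :
    f.natDegree = ∑ d ∈ Finset.Icc 1 f.natDegree, ∑ P ∈ irredsOfDegree k d,
      ∑ j ∈ Finset.Icc 1 f.natDegree, if P ^ j ∣ f then d else 0 := by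
  have hf0 := hf.ne_zero
  have hmem : ∀ P ∈ normalizedFactors f, P.Monic ∧ Irreducible P := fun P hP => by
    have hi := irreducible_of_normalized_factor P hP
    exact ⟨normalize_normalized_factor P hP ▸ monic_normalize hi.ne_zero, hi⟩
  have h1 : f.natDegree = ((normalizedFactors f).map natDegree).sum := by
    rw [← natDegree_multiset_prod_of_monic _ fun P hP => (hmem P hP).1,
      prod_normalizedFactors_eq hf0, hf.normalize_eq_self]
  have h2 : ∀ d, ∀ P ∈ irredsOfDegree k d,
      (∑ j ∈ Finset.Icc 1 f.natDegree, if P ^ j ∣ f then d else 0) =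
        (normalizedFactors f).count P • P.natDegree := fun d P hP => by
    rw [mem_irredsOfDegree] at hP
    rw [count_normalizedFactors_eq_card_filter hf0 hP.1.1 hP.2 le_rfl, ← Finset.sum_filter,
      Finset.sum_const, hP.1.2]
  rw [Finset.sum_congr rfl fun d _ => Finset.sum_congr rfl (h2 d)]
  conv_lhs => rw [h1, Finset.sum_multiset_map_count]
  rw [← Finset.sum_biUnion]
  · refine Finset.sum_subset (fun P hP => ?_) fun P _ hP => ?_
    · rw [Multiset.mem_toFinset] at hP
      obtain ⟨hm, hi⟩ := hmem P hP
      rw [Finset.mem_biUnion]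
      refine ⟨P.natDegree, Finset.mem_Icc.2 ⟨hi.natDegree_pos, ?_⟩, by simp [hm, hi]⟩
      exact natDegree_le_of_dvd (dvd_of_mem_normalizedFactors hP) hf0
    · rw [Multiset.mem_toFinset] at hP
      rw [Multiset.count_eq_zero_of_notMem hP, zero_smul]
  · intro d _ d' _ hdd'
    refine Finset.disjoint_left.2 fun P hP hP' => hdd' ?_
    rw [mem_irredsOfDegree] at hP hP'
    exact hP.1.2.symm.trans hP'.1.2

theorem sum_monicsOfDegree_dvd [Finite k] (lam : k[X] → ℂ)
    (hmul : ∀ f g : k[X], f.Monic → g.Monic → lam (f * g) = lam f * lam g) {N : ℕ} {P : k[X]}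
    (hP : P.Monic) (hPN : P.natDegree ≤ N) :
    ∑ f ∈ monicsOfDegree k N, (if P ∣ f then lam f else 0) =
      lam P * ∑ f ∈ monicsOfDegree k (N - P.natDegree), lam f := by
  rw [← Finset.sum_filter, Finset.mul_sum]
  symm
  refine Finset.sum_bij (fun f _ => P * f) ?_ ?_ ?_ ?_
  · intro f hf
    rw [mem_monicsOfDegree] at hf
    rw [Finset.mem_filter, mem_monicsOfDegree]
    exact ⟨⟨hP.mul hf.1, by rw [hP.natDegree_mul hf.1, hf.2]; omega⟩, dvd_mul_right _ _⟩
  · intro f _ g _ h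
    exact mul_left_cancel₀ hP.ne_zero h
  · intro f hf
    rw [Finset.mem_filter, mem_monicsOfDegree] at hf
    obtain ⟨⟨hfm, hfd⟩, g, rfl⟩ := hf
    have hg : g.Monic := hP.of_mul_monic_left hfm
    refine ⟨g, ?_, rfl⟩
    rw [hP.natDegree_mul hg] at hfd
    rw [mem_monicsOfDegree]
    exact ⟨hg, by omega⟩
  · intro f hf
    exact (hmul _ _ hP (mem_monicsOfDegree.1 hf).1).symm

/-- Newton's identities for the coefficients of the `L`-series of a completely multiplicative
function on monic polynomials. -/
theorem natCast_mul_sum_monicsOfDegree [Finite k] (lam : k[X] → ℂ) (hone : lam 1 = 1)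
    (hmul : ∀ f g : k[X], f.Monic → g.Monic → lam (f * g) = lam f * lam g) (N : ℕ) :
    (N : ℂ) * ∑ f ∈ monicsOfDegree k N, lam f =
      ∑ r ∈ Finset.Icc 1 N, (∑ d ∈ r.divisors, ∑ P ∈ irredsOfDegree k d,
        (d : ℂ) * lam P ^ (r / d)) * ∑ f ∈ monicsOfDegree k (N - r), lam f := by
  have hpow : ∀ P : k[X], P.Monic → ∀ j, lam (P ^ j) = lam P ^ j := fun P hP j => by
    induction j with
    | zero => simp [hone]
    | succ j ih => rw [pow_succ, hmul _ _ (hP.pow j) hP, ih, pow_succ]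
  have h1 : (N : ℂ) * ∑ f ∈ monicsOfDegree k N, lam f =
      ∑ d ∈ Finset.Icc 1 N, ∑ j ∈ Finset.Icc 1 N, ∑ P ∈ irredsOfDegree k d,
        ∑ f ∈ monicsOfDegree k N, (d : ℂ) * if P ^ j ∣ f then lam f else 0 := by
    rw [Finset.mul_sum]
    simp_rw [Finset.sum_comm (s := Finset.Icc 1 N) (t := irredsOfDegree k _)]
    simp_rw [Finset.sum_comm (t := monicsOfDegree k N)]
    refine Finset.sum_congr rfl fun f hf => ?_
    obtain ⟨hfm, rfl⟩ := mem_monicsOfDegree.1 hf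
    conv_lhs => rw [natDegree_eq_sum_irreds hfm]
    push_cast
    simp_rw [Finset.sum_mul]
    refine Finset.sum_congr rfl fun d _ => Finset.sum_congr rfl fun P _ =>
      Finset.sum_congr rfl fun j _ => ?_
    split_ifs <;> simp
  have h2 : ∀ d ∈ Finset.Icc 1 N, ∀ j ∈ Finset.Icc 1 N, ∑ P ∈ irredsOfDegree k d,
        ∑ f ∈ monicsOfDegree k N, ((d : ℂ) * if P ^ j ∣ f then lam f else 0) =
      ∑ r ∈ Finset.Icc 1 N, if j * d = r then (∑ P ∈ irredsOfDegree k d,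
        (d : ℂ) * lam P ^ j) * ∑ f ∈ monicsOfDegree k (N - r), lam f else 0 := by
    intro d hd j hj
    rw [Finset.mem_Icc] at hd hj
    have hjd : 1 ≤ j * d := Nat.mul_pos hj.1 hd.1
    rw [Finset.sum_ite_eq]
    split_ifs with h <;> rw [Finset.mem_Icc] at h
    · rw [Finset.sum_mul]
      refine Finset.sum_congr rfl fun P hP => ?_
      obtain ⟨⟨hPm, hPd⟩, hPi⟩ := mem_irredsOfDegree.1 hP
      have hdeg : (P ^ j).natDegree = j * d := by rw [hPm.natDegree_pow, hPd]
      rw [← Finset.mul_sum, sum_monicsOfDegree_dvd lam hmul (hPm.pow j) (by omega), hdeg,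
        hpow P hPm, mul_assoc]
    · refine Finset.sum_eq_zero fun P hP => Finset.sum_eq_zero fun f hf => ?_
      obtain ⟨⟨hPm, hPd⟩, hPi⟩ := mem_irredsOfDegree.1 hP
      have hdeg : (P ^ j).natDegree = j * d := by rw [hPm.natDegree_pow, hPd]
      obtain ⟨hfm, hfd⟩ := mem_monicsOfDegree.1 hf
      rw [if_neg, mul_zero]
      intro hdvd
      have := natDegree_le_of_dvd hdvd hfm.ne_zero
      omega
  rw [h1, Finset.sum_congr rfl fun d hd => Finset.sum_congr rfl (h2 d hd)]
  rw [Finset.sum_congr rfl fun d _ => Finset.sum_comm, Finset.sum_comm]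
  refine Finset.sum_congr rfl fun r hr => ?_
  rw [Finset.mem_Icc] at hr
  rw [Finset.sum_mul]
  symm
  refine Finset.sum_subset_zero_on_sdiff (fun d hd => ?_) (fun d hd => ?_) fun d hd => ?_
  · have h := Nat.pos_of_mem_divisors hd
    have h' := Nat.divisor_le hd
    rw [Finset.mem_Icc]; omega
  · rw [Finset.mem_sdiff, Nat.mem_divisors] at hd
    refine Finset.sum_eq_zero fun j _ => if_neg fun h => hd.2 ⟨⟨j, by rw [← h, mul_comm]⟩, by omega⟩
  · have hdr := (Nat.mem_divisors.1 hd).1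
    have hd0 := Nat.pos_of_mem_divisors hd
    have hrd : r / d * d = r := Nat.div_mul_cancel hdr
    rw [Finset.sum_eq_single (r / d), if_pos hrd]
    · intro j _ hj
      refine if_neg fun h => hj ?_
      rw [← h, Nat.mul_div_cancel _ hd0]
    · intro h
      refine absurd (Finset.mem_Icc.2 ⟨?_, ?_⟩) h
      · exact Nat.div_pos (Nat.le_of_dvd (by omega) hdr) hd0
      · exact (Nat.div_le_self _ _).trans hr.2

end Monics

section KloostermanLSeries

open Classical

variable {k : Type*} [Field k] [Finite k]

/-- The completely multiplicative function on monic polynomials attached to the sum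
`∑ χ(x) ψ(a x + b / x)`. -/
def klWeight (χ : MulChar k ℂ) (ψ : AddChar k ℂ) (a b : k) (f : k[X]) : ℂ :=
  χ ((-1) ^ f.natDegree * f.coeff 0) * ψ (-(a * f.nextCoeff) - b * (f.coeff 1 / f.coeff 0))

omit [Finite k] in
theorem klWeight_one (χ : MulChar k ℂ) (ψ : AddChar k ℂ) (a b : k) : klWeight χ ψ a b 1 = 1 := by
  simp [klWeight, nextCoeff, coeff_one]

omit [Finite k] in
theorem klWeight_mul (χ : MulChar k ℂ) (ψ : AddChar k ℂ) (a b : k) (f g : k[X]) (hf : f.Monic)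
    (hg : g.Monic) : klWeight χ ψ a b (f * g) = klWeight χ ψ a b f * klWeight χ ψ a b g := by
  by_cases h : f.coeff 0 = 0 ∨ g.coeff 0 = 0
  · rcases h with h | h <;> simp [klWeight, mul_coeff_zero, h, MulChar.map_zero]
  push Not at h
  obtain ⟨h1, h2⟩ := h
  have h3 : -(a * (f.nextCoeff + g.nextCoeff)) - b *
    ((f.coeff 0 * g.coeff 1 + f.coeff 1 * g.coeff 0) / (f.coeff 0 * g.coeff 0))
      = (-(a * f.nextCoeff) - b * (f.coeff 1 / f.coeff 0)) +
        (-(a * g.nextCoeff) - b * (g.coeff 1 / g.coeff 0)) := by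
    field_simp; ring
  rw [klWeight, klWeight, klWeight, hf.natDegree_mul hg, hf.nextCoeff_mul hg, mul_coeff_zero,
    mul_coeff_one, h3, AddChar.map_add_eq_mul, pow_add,
    show (-1 : k) ^ f.natDegree * (-1) ^ g.natDegree * (f.coeff 0 * g.coeff 0) =
      ((-1) ^ f.natDegree * f.coeff 0) * ((-1) ^ g.natDegree * g.coeff 0) by ring, map_mul]
  ring

theorem sum_monicsOfDegree_klWeight_eq_zero (χ : MulChar k ℂ) {ψ : AddChar k ℂ} (hψ : ψ ≠ 1)
    {a : k} (ha : a ≠ 0) (b : k) {N : ℕ} (hN : 3 ≤ N) :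
    ∑ f ∈ monicsOfDegree k N, klWeight χ ψ a b f = 0 := by
  obtain ⟨u, hu⟩ := AddChar.ne_one_iff.1 hψ
  set t := -(u / a) with ht
  have hat : -(a * t) = u := by rw [ht]; field_simp
  have hdeg : ∀ (s : k) (f : k[X]), f.Monic → f.natDegree = N →
      (C s * X ^ (N - 1) : k[X]).degree < f.degree := fun s f hf hfd => by
    rw [degree_eq_natDegree hf.ne_zero, hfd]
    exact (degree_C_mul_X_pow_le _ _).trans_lt (by exact_mod_cast (by omega : N - 1 < N))
  have hmem : ∀ (s : k) (f : k[X]), f ∈ monicsOfDegree k N →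
      f + C s * X ^ (N - 1) ∈ monicsOfDegree k N := fun s f hf => by
    rw [mem_monicsOfDegree] at hf ⊢
    refine ⟨hf.1.add_of_left (hdeg s f hf.1 hf.2), ?_⟩
    rw [natDegree_add_eq_left_of_degree_lt (hdeg s f hf.1 hf.2), hf.2]
  have hval : ∀ f ∈ monicsOfDegree k N, klWeight χ ψ a b (f + C t * X ^ (N - 1)) =
      ψ u * klWeight χ ψ a b f := fun f hf => by
    have hN' := (mem_monicsOfDegree.1 (hmem t f hf)).2
    have hf' := (mem_monicsOfDegree.1 hf).2
    have e : -(a * (f.coeff (N - 1) + t)) - b * (f.coeff 1 / f.coeff 0) =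
        u + (-(a * f.coeff (N - 1)) - b * (f.coeff 1 / f.coeff 0)) := by rw [← hat]; ring
    rw [klWeight, klWeight, nextCoeff_of_natDegree_pos (by omega),
      nextCoeff_of_natDegree_pos (by omega), hN', hf']
    simp only [coeff_add, coeff_C_mul, coeff_X_pow]
    rw [if_pos trivial, if_neg (show ¬ 0 = N - 1 by omega), if_neg (show ¬ 1 = N - 1 by omega)]
    simp only [mul_zero, add_zero, mul_one]
    rw [e, AddChar.map_add_eq_mul]
    ring
  have hsum : ∑ f ∈ monicsOfDegree k N, klWeight χ ψ a b f =
      ψ u * ∑ f ∈ monicsOfDegree k N, klWeight χ ψ a b f := by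
    rw [Finset.mul_sum, ← Finset.sum_congr rfl hval]
    symm
    refine Finset.sum_bij (fun f _ => f + C t * X ^ (N - 1)) (fun f hf => hmem t f hf)
      (fun f _ g _ h => add_right_cancel h) (fun f hf => ⟨f + C (-t) * X ^ (N - 1),
        hmem _ f hf, ?_⟩)
      (fun _ _ => rfl)
    simp
  have : (1 - ψ u) * ∑ f ∈ monicsOfDegree k N, klWeight χ ψ a b f = 0 := by
    rw [sub_mul, one_mul, ← hsum, sub_self]
  exact (mul_eq_zero.1 this).resolve_left (sub_ne_zero.2 hu.symm)

omit [Finite k] in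
theorem adjoin_simple_inv_eq {E : Type*} [Field E] [Algebra k E] (x : E) :
    IntermediateField.adjoin k {x⁻¹} = IntermediateField.adjoin k {x} := by
  apply le_antisymm <;> rw [IntermediateField.adjoin_simple_le_iff]
  · exact inv_mem (IntermediateField.mem_adjoin_simple_self k x)
  · simpa using inv_mem (IntermediateField.mem_adjoin_simple_self k x⁻¹)

omit [Finite k] in
theorem minpoly_inv_eq {E : Type*} [Field E] [Algebra k E] [FiniteDimensional k E] {x : E}
    (hx : x ≠ 0) : minpoly k x⁻¹ = C ((minpoly k x).coeff 0)⁻¹ * (minpoly k x).reverse := by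
  have hxint : IsIntegral k x := IsIntegral.of_finite k x
  have hxint' : IsIntegral k x⁻¹ := IsIntegral.of_finite k _
  have hc : (minpoly k x).coeff 0 ≠ 0 := minpoly.coeff_zero_ne_zero hxint hx
  have hdeg : (minpoly k x⁻¹).natDegree = (minpoly k x).natDegree := by
    rw [← IntermediateField.adjoin.finrank hxint, ← IntermediateField.adjoin.finrank hxint',
      adjoin_simple_inv_eq]
  have htr : (minpoly k x).reverse.natDegree = (minpoly k x).natDegree := by
    rw [reverse_natDegree, natTrailingDegree_eq_zero.2 (Or.inr hc), Nat.sub_zero]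
  symm
  apply minpoly.unique_of_degree_le_degree_minpoly
  · rw [Monic, leadingCoeff_mul, leadingCoeff_C, reverse_leadingCoeff, trailingCoeff,
      natTrailingDegree_eq_zero.2 (Or.inr hc), inv_mul_cancel₀ hc]
  · let _ := invertibleOfNonzero hx
    have h := (eval₂_reverse_eq_zero_iff (algebraMap k E) x (minpoly k x)).2 (minpoly.aeval k x)
    rw [invOf_eq_inv] at h
    rw [map_mul, aeval_def _ (minpoly k x).reverse, h, mul_zero]
  · rw [degree_eq_natDegree (minpoly.ne_zero hxint'), hdeg, degree_C_mul (inv_ne_zero hc), ← htr]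
    exact degree_le_natDegree

omit [Finite k] in
theorem nextCoeff_minpoly_inv {E : Type*} [Field E] [Algebra k E] [FiniteDimensional k E] {x : E}
    (hx : x ≠ 0) :
    (minpoly k x⁻¹).nextCoeff = (minpoly k x).coeff 1 / (minpoly k x).coeff 0 := by
  have hxint : IsIntegral k x := IsIntegral.of_finite k x
  have hxint' : IsIntegral k x⁻¹ := IsIntegral.of_finite k _
  have hc : (minpoly k x).coeff 0 ≠ 0 := minpoly.coeff_zero_ne_zero hxint hx
  have hpos := minpoly.natDegree_pos hxint
  have hdeg : (minpoly k x⁻¹).natDegree = (minpoly k x).natDegree := by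
    rw [← IntermediateField.adjoin.finrank hxint, ← IntermediateField.adjoin.finrank hxint',
      adjoin_simple_inv_eq]
  rw [nextCoeff_of_natDegree_pos (by omega), hdeg, minpoly_inv_eq hx, coeff_C_mul, coeff_reverse,
    revAt_le (by omega), Nat.sub_sub_self (by omega), div_eq_inv_mul]

omit [Finite k] in
theorem klWeight_minpoly {E : Type*} [Field E] [Algebra k E] [FiniteDimensional k E]
    (χ : MulChar k ℂ) (ψ : AddChar k ℂ) (a b : k) (x : E) :
    klWeight χ ψ a b (minpoly k x) ^ (Module.finrank k E / (minpoly k x).natDegree) =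
      χ (Algebra.norm k x) *
        ψ (Algebra.trace k E (algebraMap k E a * x + algebraMap k E b * x⁻¹)) := by
  have hxint : IsIntegral k x := IsIntegral.of_finite k x
  by_cases hx : x = 0
  · subst hx
    have : Module.finrank k E ≠ 0 := Module.finrank_pos.ne'
    simp [klWeight, minpoly.zero, Algebra.norm_zero, MulChar.map_zero, this]
  set e := Module.finrank (IntermediateField.adjoin k {x}) E with he
  have hfin : Module.finrank k E / (minpoly k x).natDegree = e := by
    rw [← Module.finrank_mul_finrank k (IntermediateField.adjoin k {x}) E,
      IntermediateField.adjoin.finrank hxint, Nat.mul_div_cancel_left _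
          (minpoly.natDegree_pos hxint)]
  have hnorm : Algebra.norm k x = ((-1) ^ (minpoly k x).natDegree * (minpoly k x).coeff 0) ^ e := by
    rw [Algebra.norm_eq_norm_adjoin]
    have := Algebra.PowerBasis.norm_gen_eq_coeff_zero_minpoly
      (IntermediateField.adjoin.powerBasis hxint)
    rw [IntermediateField.adjoin.powerBasis_gen, IntermediateField.minpoly_gen,
      IntermediateField.adjoin.powerBasis_dim] at this
    rw [this]
  have htrace : Algebra.trace k E (algebraMap k E a * x + algebraMap k E b * x⁻¹) =
      e • (-(a * (minpoly k x).nextCoeff) -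
        b * ((minpoly k x).coeff 1 / (minpoly k x).coeff 0)) := by
    rw [map_add, ← Algebra.smul_def, ← Algebra.smul_def, map_smul, map_smul,
      trace_eq_finrank_mul_minpoly_nextCoeff k x, trace_eq_finrank_mul_minpoly_nextCoeff k x⁻¹,
      nextCoeff_minpoly_inv hx, adjoin_simple_inv_eq, ← he, nsmul_eq_mul, smul_eq_mul, smul_eq_mul]
    ring
  rw [hfin, hnorm, htrace, AddChar.map_nsmul_eq_pow, map_pow, klWeight, mul_pow]

theorem sum_irredsOfDegree_klWeight {E : Type*} [Field E] [Fintype E] [Algebra k E]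
    (χ : MulChar k ℂ) (ψ : AddChar k ℂ) (a b : k) :
    ∑ d ∈ (Module.finrank k E).divisors, ∑ P ∈ irredsOfDegree k d,
        (d : ℂ) * klWeight χ ψ a b P ^ (Module.finrank k E / d) =
      ∑ x : E, χ (Algebra.norm k x) *
        ψ (Algebra.trace k E (algebraMap k E a * x + algebraMap k E b * x⁻¹)) := by
  have hfin : FiniteDimensional k E := inferInstance
  set r := Module.finrank k E with hr
  have hr0 : 0 < r := Module.finrank_pos
  have hcard : ∀ d ∈ r.divisors, ∀ P ∈ irredsOfDegree k d,
      (Finset.univ.filter fun x : E => minpoly k x = P).card = d := by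
    intro d hd P hP
    obtain ⟨⟨hPm, hPd⟩, hPi⟩ := mem_irredsOfDegree.1 hP
    let _ := Fintype.ofFinite k
    have hsplit : (P.map (algebraMap k E)).Splits := by
      have hdvd := hPi.natDegree_dvd_iff_dvd_X_pow_card_pow_sub_X.1
        (hPd ▸ Nat.dvd_of_mem_divisors hd)
      rw [hr, Nat.card_eq_fintype_card, ← Module.card_eq_pow_finrank (K := k) (V := E)] at hdvd
      have h := Polynomial.map_dvd (algebraMap k E) hdvd
      simp only [Polynomial.map_sub, Polynomial.map_pow, Polynomial.map_X] at h
      have h1 : (X ^ Fintype.card E - X : E[X]).Splits := by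
        rw [splits_iff_card_roots, FiniteField.roots_X_pow_card_sub_X,
          FiniteField.X_pow_card_sub_X_natDegree_eq _ Fintype.one_lt_card]
        rfl
      exact h1.of_dvd (FiniteField.X_pow_card_sub_X_ne_zero _ Fintype.one_lt_card) h
    rw [← hPd, ← card_rootSet_eq_natDegree (PerfectField.separable_of_irreducible hPi) hsplit,
      ← Set.toFinset_card]
    congr 1
    ext x
    rw [Finset.mem_filter, Set.mem_toFinset, mem_rootSet_of_ne hPm.ne_zero]
    refine ⟨fun h => h.2 ▸ minpoly.aeval k x, fun h => ⟨Finset.mem_univ _, ?_⟩⟩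
    exact (minpoly.eq_of_irreducible_of_monic hPi h hPm).symm
  rw [Finset.sum_congr rfl fun x _ => (klWeight_minpoly χ ψ a b x).symm]
  rw [← Finset.sum_fiberwise_of_maps_to (s := Finset.univ)
    (t := r.divisors.biUnion (irredsOfDegree k))
    (g := fun x : E => minpoly k x)]
  · rw [Finset.sum_biUnion]
    · refine Finset.sum_congr rfl fun d hd => Finset.sum_congr rfl fun P hP => ?_
      rw [Finset.sum_congr rfl (g := fun _ => klWeight χ ψ a b P ^ (r / d)), Finset.sum_const,
        hcard d hd P hP, nsmul_eq_mul]
      intro x hx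
      rw [(Finset.mem_filter.1 hx).2, (mem_irredsOfDegree.1 hP).1.2]
    · intro d _ d' _ hdd'
      refine Finset.disjoint_left.2 fun P hP hP' => hdd' ?_
      rw [mem_irredsOfDegree] at hP hP'
      exact hP.1.2.symm.trans hP'.1.2
  · intro x _
    have hxint : IsIntegral k x := IsIntegral.of_finite k x
    rw [Finset.mem_biUnion]
    exact ⟨(minpoly k x).natDegree, Nat.mem_divisors.2 ⟨minpoly.degree_dvd hxint, hr0.ne'⟩,
      mem_irredsOfDegree.2 ⟨⟨minpoly.monic hxint, rfl⟩, minpoly.irreducible hxint⟩⟩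

end KloostermanLSeries

/-- If the power sums of finitely many complex numbers are bounded, the numbers have norm at
most one. -/
theorem norm_le_one_of_bounded_power_sums {ι : Type*} [Fintype ι] (w : ι → ℂ) (C : ℝ)
    (h : ∀ n : ℕ, 1 ≤ n → ‖∑ i, w i ^ n‖ ≤ C) (i : ι) : ‖w i‖ ≤ 1 := by
  by_contra! hi
  let u : ι → Circle := fun j => Circle.exp (Complex.arg (w j))
  have hu : ∀ j, w j = ‖w j‖ * (u j : ℂ) := fun j => by
    simp only [u, Circle.coe_exp, Complex.norm_mul_exp_arg_mul_I]
  have hcl := mapClusterPt_one_atTop_pow u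
  have hopen : {v : ι → Circle | ∀ j, 1 / 2 < ((v j : ℂ)).re} ∈ nhds (1 : ι → Circle) := by
    refine IsOpen.mem_nhds ?_ (by intro j; simp; norm_num)
    rw [Set.ofPred_forall]
    refine isOpen_iInter_of_finite fun j => ?_
    exact isOpen_lt continuous_const (by fun_prop)
  have hfreq := hcl.frequently hopen
  have hlim : Filter.Tendsto (fun n : ℕ => ‖w i‖ ^ n) Filter.atTop Filter.atTop :=
    tendsto_pow_atTop_atTop_of_one_lt hi
  obtain ⟨n, hn, hn1, hnC⟩ := (hfreq.and_eventually
    ((Filter.eventually_ge_atTop 1).and (hlim.eventually_gt_atTop (2 * C)))).exists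
  have h1 : ∀ j, ((w j) ^ n).re = ‖w j‖ ^ n * ((u j : ℂ) ^ n).re := fun j => by
    conv_lhs => rw [hu j, mul_pow]
    rw [← Complex.ofReal_pow, Complex.re_ofReal_mul]
  have h2 : ‖w i‖ ^ n * (1 / 2) ≤ (∑ j, w j ^ n).re := by
    rw [Complex.re_sum]
    have h3 : ∀ j, ‖w j‖ ^ n * (1 / 2) ≤ ((w j) ^ n).re := fun j => by
      rw [h1]
      have := hn j
      simp only [Pi.pow_apply, Circle.coe_pow] at this
      gcongr
    refine (h3 i).trans (Finset.single_le_sum (f := fun j => ((w j) ^ n).re) (fun j _ => ?_)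
      (Finset.mem_univ i))
    exact le_trans (by positivity) (h3 j)
  have h4 := (Complex.re_le_norm _).trans (h n hn1)
  linarith

/-- Newton's identities for a quadratic `L`-series. -/
theorem exists_power_sums_of_newton (A S : ℕ → ℂ) (hA0 : A 0 = 1) (hA : ∀ N, 3 ≤ N → A N = 0)
    (hN : ∀ N : ℕ, (N : ℂ) * A N = ∑ r ∈ Finset.Icc 1 N, S r * A (N - r)) :
    ∃ w : Fin 2 → ℂ, ∀ r, 1 ≤ r → S r = -∑ i, w i ^ r := by
  obtain ⟨z, hz⟩ := IsAlgClosed.exists_root (C (A 2) + C (A 1) * X + X ^ 2 : ℂ[X])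
    (by
      have : (C (A 2) + C (A 1) * X + X ^ 2 : ℂ[X]).degree = 2 := by compute_degree!
      rw [this]; decide)
  have hz' : A 2 + A 1 * z + z ^ 2 = 0 := by simpa using hz
  refine ⟨![z, -A 1 - z], fun r hr => ?_⟩
  have hS1 : S 1 = A 1 := by have := hN 1; simp [hA0] at this; exact this.symm
  have hS2 : S 2 = 2 * A 2 - A 1 ^ 2 := by
    have := hN 2
    rw [Finset.sum_Icc_succ_top (by norm_num)] at this
    simp [hA0, hS1] at this
    rw [this]; ring
  induction r using Nat.strong_induction_on with
  | _ r ih =>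
    rcases r with _ | _ | _ | r
    · omega
    · simp [hS1]
    · simp [hS2, Fin.sum_univ_two]; linear_combination 2 * hz'
    · have h1 := ih (r + 2) (by omega) (by omega)
      have h2 := ih (r + 1) (by omega) (by omega)
      have h3 := hN (r + 3)
      rw [hA _ (by omega), mul_zero, Finset.sum_Icc_succ_top (by omega),
        Finset.sum_Icc_succ_top (by omega), Finset.sum_Icc_succ_top (by omega),
        Finset.sum_eq_zero] at h3
      · simp only [show r + 3 - (r + 1) = 2 by omega, show r + 3 - (r + 1 + 1) = 1 by omega,
          show r + 3 - (r + 2 + 1) = 0 by omega, hA0] at h3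
        simp [Fin.sum_univ_two] at h1 h2 ⊢
        have : S (r + 1 + 1 + 1) = - (S (r+1) * A 2 + S (r+2) * A 1) := by
          linear_combination -h3
        rw [this, h1, h2]
        obtain ⟨y, hy⟩ : ∃ y, y = -A 1 - z := ⟨_, rfl⟩
        have hy' : A 1 = -y - z := by rw [hy]; ring
        rw [← hy]
        rw [hy'] at hz' ⊢
        linear_combination (z ^ (r + 1) + y ^ (r + 1)) * hz'
      · intro j hj
        rw [Finset.mem_Icc] at hj
        rw [hA _ (by omega), mul_zero]

theorem MulChar.sum_apply_eq {k : Type*} [Field k] [Fintype k] [Fintype (MulChar k ℂ)]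
    [DecidableEq k] (y : k) :
    ∑ χ : MulChar k ℂ, χ y = if y = 1 then (Fintype.card k : ℂ) - 1 else 0 := by
  by_cases hy : y = 1
  · subst hy
    have h := MulChar.card_eq_card_units_of_hasEnoughRootsOfUnity k ℂ
    rw [Nat.card_eq_fintype_card, Nat.card_eq_fintype_card, Fintype.card_units] at h
    simp [h, Nat.cast_sub (Fintype.card_pos (α := k) : 1 ≤ _)]
  rw [if_neg hy]
  by_cases hy0 : y = 0
  · subst hy0
    exact Finset.sum_eq_zero fun χ _ => χ.map_nonunit (by simp)
  obtain ⟨χ₀, hχ₀⟩ := MulChar.exists_apply_ne_one_of_hasEnoughRootsOfUnity k ℂ hy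
  have h : χ₀ y * ∑ χ : MulChar k ℂ, χ y = ∑ χ : MulChar k ℂ, χ y := by
    rw [Finset.mul_sum]
    refine Fintype.sum_equiv (Equiv.mulLeft χ₀) _ _ fun χ => by simp
  have : (χ₀ y - 1) * ∑ χ : MulChar k ℂ, χ y = 0 := by rw [sub_mul, h]; ring
  exact (mul_eq_zero.mp this).resolve_left (sub_ne_zero.mpr hχ₀)

theorem card_filter_pow_eq {k E : Type*} [Field k] [Fintype k] [Field E] [Fintype E] [Algebra k E]
    [DecidableEq k] [DecidableEq E] (x : Eˣ) :
    (Finset.univ.filter fun z : Eˣ => z ^ (Fintype.card k - 1) = x).card =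
      if Algebra.norm k (x : E) = 1 then Fintype.card k - 1 else 0 := by
  have hQ : 1 < Fintype.card k := Fintype.one_lt_card
  obtain ⟨m, hm⟩ : Fintype.card k - 1 ∣ Fintype.card E - 1 := by
    rw [Module.card_eq_pow_finrank (K := k) (V := E)]
    simpa using Nat.sub_dvd_pow_sub_pow (Fintype.card k) 1 (Module.finrank k E)
  have hcardE : Fintype.card Eˣ = (Fintype.card k - 1) * m := by
    rw [Fintype.card_units, hm]
  have hnorm : Algebra.norm k (x : E) = 1 ↔ x ^ m = 1 := by
    rw [← (algebraMap k E).injective.eq_iff, FiniteField.algebraMap_norm_eq_pow, map_one,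
      Nat.card_eq_fintype_card, Nat.card_eq_fintype_card, hm,
      Nat.mul_div_cancel_left _ (by omega), Units.ext_iff]
    simp
  have hrange : x ∈ (powMonoidHom (Fintype.card k - 1) : Eˣ →* Eˣ).range ↔ x ^ m = 1 := by
    constructor
    · rintro ⟨z, rfl⟩
      rw [powMonoidHom_apply, ← pow_mul, ← hcardE, pow_card_eq_one]
    · intro h
      obtain ⟨g, hg⟩ := IsCyclic.exists_generator (α := Eˣ)
      obtain ⟨j, rfl⟩ := (mem_powers_iff_mem_zpowers.mpr (hg x))
      have hord := orderOf_eq_card_of_forall_mem_zpowers hg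
      simp only at h
      rw [← pow_mul, ← orderOf_dvd_iff_pow_eq_one, hord, Nat.card_eq_fintype_card, hcardE] at h
      have hm0 : 0 < m := by
        rcases Nat.eq_zero_or_pos m with h0 | h0
        · rw [h0, mul_zero] at hcardE
          exact absurd hcardE Fintype.card_ne_zero
        · exact h0
      obtain ⟨t, rfl⟩ := Nat.dvd_of_mul_dvd_mul_right hm0 h
      exact ⟨g ^ t, by simp [← pow_mul, mul_comm]⟩
  rw [← hrange] at hnorm
  split_ifs with h
  · rw [hnorm] at h
    have h1 := MonoidHom.card_fiber_eq_of_mem_range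
      (powMonoidHom (Fintype.card k - 1) : Eˣ →* Eˣ) h ⟨1, map_one _⟩
    have h2 := IsCyclic.card_powMonoidHom_ker (G := Eˣ) (Fintype.card k - 1)
    rw [Nat.card_eq_fintype_card, Nat.card_eq_fintype_card, hcardE, Nat.gcd_mul_right_left] at h2
    simp only [powMonoidHom_apply] at h1
    rw [Fintype.card_subtype] at h2
    simp only [MonoidHom.mem_ker, powMonoidHom_apply] at h2
    rw [h1, h2]
  · rw [Finset.card_eq_zero, Finset.filter_eq_empty_iff]
    intro z _ hz
    exact h (hnorm.mpr ⟨z, hz⟩)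

section

section

variable {k E : Type*} [Field k] [Fintype k] [Field E] [Fintype E] [Algebra k E]
  [DecidableEq E]

theorem sum_mulChar_norm_eq_sum_units_pow [Fintype (MulChar k ℂ)] (f : E → ℂ) :
    ∑ χ : MulChar k ℂ, ∑ x : E, χ (Algebra.norm k x) * f x =
      ∑ z : Eˣ, f ((z : E) ^ (Fintype.card k - 1)) := by
  classical
  have hQ : 1 ≤ Fintype.card k := Fintype.card_pos
  rw [Finset.sum_comm]
  simp_rw [← Finset.sum_mul, MulChar.sum_apply_eq]
  rw [Fintype.sum_eq_add_sum_compl (0 : E), Algebra.norm_zero, if_neg zero_ne_one, zero_mul,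
    zero_add]
  have h1 : ∑ x ∈ ({0}ᶜ : Finset E), (if Algebra.norm k x = 1 then
    (Fintype.card k : ℂ) - 1 else 0) * f x
      = ∑ x : Eˣ, (if Algebra.norm k (x : E) = 1 then (Fintype.card k : ℂ) - 1 else 0) * f x := by
    symm
    refine Finset.sum_bij (fun x _ => (x : E)) (by simp) (fun x _ y _ h => Units.ext h)
      (fun x hx => ⟨Units.mk0 x (by simpa using hx), by simp, rfl⟩) (fun _ _ => rfl)
  rw [h1, ← Finset.sum_fiberwise_of_maps_to (s := Finset.univ) (t := Finset.univ)
    (g := fun z : Eˣ => z ^ (Fintype.card k - 1)) (by simp)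
    (fun z : Eˣ => f ((z : E) ^ (Fintype.card k - 1)))]
  refine Finset.sum_congr rfl fun x _ => ?_
  rw [Finset.sum_congr rfl (g := fun _ => f x), Finset.sum_const, card_filter_pow_eq]
  · split_ifs <;> simp [Nat.cast_sub hQ]
  · intro z hz
    rw [← (Finset.mem_filter.mp hz).2, Units.val_pow_eq_pow_val]

theorem norm_sum_units_pow_le {ψ : AddChar k ℂ} (hψ : ψ ≠ 1) {a : k} (ha : a ≠ 0) (b : k) {μ : ℕ}
    (hμ : 1 ≤ μ) (hE : Module.finrank k E = 2 * μ) :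
    ‖∑ z : Eˣ, ψ (Algebra.trace k E (algebraMap k E a * (z : E) ^ (Fintype.card k - 1) +
      algebraMap k E b * ((z : E) ^ (Fintype.card k - 1))⁻¹))‖ ≤
      (4 * (Fintype.card k : ℝ) ^ 2 + 1) * (Fintype.card k : ℝ) ^ μ := by
  classical
  set Q := Fintype.card k with hQ
  have hQ2 : 2 ≤ Q := Fintype.one_lt_card
  have hcardE : Fintype.card E = (Q ^ μ) ^ 2 := by
    rw [Module.card_eq_pow_finrank (K := k) (V := E), hE]; ring
  set g : Eˣ → k := fun z => Algebra.trace k E (algebraMap k E a * (z : E) ^ (Q - 1) +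
      algebraMap k E b * ((z : E) ^ (Q - 1))⁻¹) with hg
  set U : ℕ := Q ^ (2 * μ - 1) + 4 * (Q - 1) * Q ^ μ with hU
  have hn : ∀ c : k, (Finset.univ.filter fun z => g z = c).card ≤ U := by
    intro c
    have := card_filter_trace_eq_le (E := E) a b ha (Q - 1) μ (by omega) hμ ?_ hcardE
      (algebraMap k E c)
      ((Finset.univ.filter fun z => g z = c).map ⟨Units.val, Units.val_injective⟩) ?_
    · simpa using this
    · have := Nat.coprime_self_add_right (m := Q - 1) (n := 1)
      rw [show Q - 1 + 1 = Fintype.card k by omega] at this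
      rw [this]; simp
    · intro z hz
      obtain ⟨u, hu, rfl⟩ := Finset.mem_map.mp hz
      refine ⟨u.ne_zero, ?_⟩
      rw [← (Finset.mem_filter.mp hu).2, hg, FiniteField.algebraMap_trace_eq_sum_pow,
        hE, Nat.card_eq_fintype_card]
      simp
  have hsum : ∑ z : Eˣ, ψ (g z) = ∑ c : k, (((Finset.univ.filter fun z => g z = c).card : ℂ) - U) *
    ψ c := by
    simp_rw [sub_mul, Finset.sum_sub_distrib, ← Finset.mul_sum, AddChar.sum_eq_zero_of_ne_one hψ,
      mul_zero, sub_zero]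
    rw [← Finset.sum_fiberwise_of_maps_to (s := Finset.univ) (t := Finset.univ) (g := g) (by simp)]
    refine Finset.sum_congr rfl fun c _ => ?_
    rw [Finset.sum_congr rfl (g := fun _ => ψ c), Finset.sum_const, nsmul_eq_mul]
    intro z hz
    rw [(Finset.mem_filter.mp hz).2]
  have hpart : ∑ c : k, ((Finset.univ.filter fun z => g z = c).card : ℝ) =
      (Q : ℝ) ^ (2 * μ) - 1 := by
    have h1 := Finset.card_eq_sum_card_fiberwise (s := (Finset.univ : Finset Eˣ))
      (t := Finset.univ) (f := g) (by simp [Set.MapsTo])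
    rw [← Nat.cast_sum, ← h1, Finset.card_univ, Fintype.card_units, hcardE,
      Nat.cast_sub (Nat.one_le_pow _ _ (Nat.pow_pos (by omega)))]
    push_cast
    ring
  rw [hsum]
  refine (norm_sum_le _ _).trans ?_
  have h2 : ∀ c : k, ‖(((Finset.univ.filter fun z => g z = c).card : ℂ) - U) * ψ c‖ =
      (U : ℝ) - (Finset.univ.filter fun z => g z = c).card := fun c => by
    rw [norm_mul, AddChar.norm_apply, mul_one, ← Complex.ofReal_natCast, ← Complex.ofReal_natCast,
      ← Complex.ofReal_sub, Complex.norm_real, Real.norm_eq_abs, abs_sub_comm,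
      abs_of_nonneg (sub_nonneg.mpr (by exact_mod_cast hn c))]
  simp_rw [h2]
  rw [Finset.sum_sub_distrib, hpart, Finset.sum_const, Finset.card_univ, nsmul_eq_mul, ← hQ, hU]
  push_cast [Nat.cast_sub (show 1 ≤ Q by omega)]
  have h3 : (Q : ℝ) * (Q : ℝ) ^ (2 * μ - 1) = (Q : ℝ) ^ (2 * μ) := by
    rw [← pow_succ', Nat.sub_add_cancel (by omega)]
  have h4 : (1 : ℝ) ≤ (Q : ℝ) ^ μ := one_le_pow₀ (by exact_mod_cast (by omega : 1 ≤ Q))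
  have h5 : (2 : ℝ) ≤ Q := by exact_mod_cast hQ2
  rw [mul_add, h3]
  nlinarith [mul_nonneg (by linarith : (0 : ℝ) ≤ Q) (by linarith : (0:ℝ) ≤ (Q : ℝ) ^ μ)]

end

variable {k : Type*} [Field k] [Fintype k]

/-- Weil's bound for twisted Kloosterman sums, with nonzero linear coefficient. -/
theorem norm_sum_mulChar_mul_addChar_le_of_ne_zero (χ : MulChar k ℂ) {ψ : AddChar k ℂ}
    (hψ : ψ ≠ 1) {a : k} (ha : a ≠ 0)
    (b : k) : ‖∑ x : k, χ x * ψ (a * x + b * x⁻¹)‖ ≤ 2 * √(Fintype.card k) := by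
  classical
  obtain ⟨p, hp⟩ := CharP.exists k
  have : Fact p.Prime := ⟨CharP.char_is_prime k p⟩
  have := Fintype.ofFinite (MulChar k ℂ)
  set Q := Fintype.card k with hQ
  have hQ2 : 2 ≤ Q := Fintype.one_lt_card
  have hQR : (0 : ℝ) < Q := by exact_mod_cast (by omega : 0 < Q)
  have hexists : ∀ χ : MulChar k ℂ, ∃ w : Fin 2 → ℂ, ∀ r, 1 ≤ r →
      ∑ d ∈ r.divisors, ∑ P ∈ irredsOfDegree k d, (d : ℂ) * klWeight χ ψ a b P ^ (r / d) =
        -∑ i, w i ^ r := fun χ =>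
    exists_power_sums_of_newton (fun N => ∑ f ∈ monicsOfDegree k N, klWeight χ ψ a b f)
      (fun r => ∑ d ∈ r.divisors, ∑ P ∈ irredsOfDegree k d, (d : ℂ) * klWeight χ ψ a b P ^ (r / d))
      (by
        have : monicsOfDegree k 0 = {1} := by
          ext f; simp only [mem_monicsOfDegree, Finset.mem_singleton]
          exact ⟨fun h => h.1.natDegree_eq_zero.mp h.2, fun h => by simp [h]⟩
        simp [this, klWeight_one])
      (fun N hN => sum_monicsOfDegree_klWeight_eq_zero χ hψ ha b hN)
      (fun N => natCast_mul_sum_monicsOfDegree _ (klWeight_one χ ψ a b)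
          (fun f g hf hg => klWeight_mul χ ψ a b f g hf hg) N)
  choose w hw using hexists
  have hbound := norm_le_one_of_bounded_power_sums
    (fun i : MulChar k ℂ × Fin 2 => w i.1 i.2 ^ 2 / (Q : ℂ)) (4 * (Q : ℝ) ^ 2 + 1) (by
      intro μ hμ
      let E := FiniteField.Extension k p (2 * μ)
      have : NeZero (2 * μ) := ⟨by omega⟩
      have hfin : Module.finrank k E = 2 * μ := FiniteField.finrank_extension k p (2 * μ)
      have : Finite E := Module.finite_of_finite k
      have := Fintype.ofFinite E
      have h1 : ∑ i : MulChar k ℂ × Fin 2, (w i.1 i.2 ^ 2 / (Q : ℂ)) ^ μ =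
          -(∑ z : Eˣ, ψ (Algebra.trace k E (algebraMap k E a * (z : E) ^ (Fintype.card k - 1) +
      algebraMap k E b * ((z : E) ^ (Fintype.card k - 1))⁻¹))) / (Q : ℂ) ^ μ := by
        rw [← sum_mulChar_norm_eq_sum_units_pow (k := k) (fun x : E => ψ (Algebra.trace k E
          (algebraMap k E a * x + algebraMap k E b * x⁻¹)))]
        simp_rw [← sum_irredsOfDegree_klWeight, hfin, hw _ _ (show 1 ≤ 2 * μ by omega)]
        rw [Fintype.sum_prod_type, Finset.sum_neg_distrib, neg_neg, Finset.sum_div]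
        simp_rw [Finset.sum_div, div_pow, ← pow_mul]
      rw [h1, norm_div, norm_neg, div_le_iff₀ (by simp; positivity)]
      refine (norm_sum_units_pow_le hψ ha b hμ hfin).trans_eq (by simp [hQ]))
  have hle : ∀ i, ‖w χ i‖ ≤ √Q := fun i => by
    have := hbound (χ, i)
    simp only [norm_div, norm_pow, Complex.norm_natCast] at this
    rw [div_le_one hQR] at this
    exact Real.le_sqrt_of_sq_le this
  have h1 := sum_irredsOfDegree_klWeight (E := k) χ ψ a b
  rw [Module.finrank_self, hw _ _ le_rfl] at h1
  simp only [Algebra.norm_self, Algebra.trace_self, Algebra.algebraMap_self, RingHom.id_apply,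
    MonoidHom.id_apply, LinearMap.id_apply] at h1
  rw [← h1, norm_neg, Fin.sum_univ_two]
  refine (norm_add_le _ _).trans ?_
  have := hle 0
  have := hle 1
  simp only [pow_one]
  linarith

/-- Weil's bound for twisted Kloosterman sums. -/
theorem norm_sum_mulChar_mul_addChar_le (χ : MulChar k ℂ) {ψ : AddChar k ℂ} (hψ : ψ ≠ 1) {a b : k}
    (hab : a ≠ 0 ∨ b ≠ 0) : ‖∑ x : k, χ x * ψ (a * x + b * x⁻¹)‖ ≤ 2 * √(Fintype.card k) := by
  by_cases ha : a = 0
  · have hb : b ≠ 0 := hab.resolve_left (not_not.mpr ha)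
    have := norm_sum_mulChar_mul_addChar_le_of_ne_zero χ⁻¹ hψ hb a
    rw [← Equiv.sum_comp (Equiv.inv k)]
    convert this using 4 with x
    · simp [MulChar.inv_apply']
    · simp [add_comm]
  · exact norm_sum_mulChar_mul_addChar_le_of_ne_zero χ hψ ha b

end

section CharacterSums

variable {k F : Type*} [Field k] [Fintype k] [Field F] [Fintype F] [Algebra k F]

open Classical in
/-- The nonzero elements `α` such that both `α` and `α⁻¹` have trace zero. -/
def traceZeroPairs (k F : Type*) [Field k] [Field F] [Fintype F] [Algebra k F] : Finset F :=
  Finset.univ.filter fun α => α ≠ 0 ∧ Algebra.trace k F α = 0 ∧ Algebra.trace k F α⁻¹ = 0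

omit [Fintype k] in
@[simp]
theorem mem_traceZeroPairs {α : F} : α ∈ traceZeroPairs k F ↔
    α ≠ 0 ∧ Algebra.trace k F α = 0 ∧ Algebra.trace k F α⁻¹ = 0 := by
  simp [traceZeroPairs]

theorem norm_sum_traceZeroPairs_sub_le (χ : MulChar F ℂ) :
    ‖∑ α ∈ traceZeroPairs k F, χ α - (∑ α : F, χ α) / (Fintype.card k : ℂ) ^ 2‖ ≤
      (1 - 1 / (Fintype.card k : ℝ) ^ 2) * (2 * √(Fintype.card F)) := by
  classical
  obtain ⟨ψ₀, hψ₀⟩ := AddChar.exists_apply_ne_zero.mpr (one_ne_zero (α := k))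
  have hψ₀1 : ψ₀ ≠ 1 := AddChar.ne_one_iff.mpr ⟨1, hψ₀⟩
  have hprim := AddChar.IsPrimitive.of_ne_one hψ₀1
  set q := Fintype.card k with hq
  have hqpos : 0 < q := Fintype.card_pos
  have hqC : (q : ℂ) ≠ 0 := by exact_mod_cast hqpos.ne'
  let ψ : AddChar F ℂ := ψ₀.compAddMonoidHom (Algebra.trace k F).toAddMonoidHom
  have hψ : ψ ≠ 1 := by
    obtain ⟨y, hy⟩ := Algebra.trace_surjective k F 1
    refine AddChar.ne_one_iff.mpr ⟨y, ?_⟩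
    simpa [ψ, hy] using hψ₀
  have hψa : ∀ (u v : k) (α : F), ψ (algebraMap k F u * α + algebraMap k F v * α⁻¹) =
      ψ₀ (u * Algebra.trace k F α) * ψ₀ (v * Algebra.trace k F α⁻¹) := by
    intro u v α
    rw [← Algebra.smul_def, ← Algebra.smul_def, ← AddChar.map_add_eq_mul]
    simp [ψ]
  have hkey : (q : ℂ) ^ 2 * ∑ α ∈ traceZeroPairs k F, χ α =
      ∑ uv : k × k, ∑ α : F, χ α * ψ (algebraMap k F uv.1 * α + algebraMap k F uv.2 * α⁻¹) := by
    rw [Finset.sum_comm, traceZeroPairs, Finset.sum_filter, Finset.mul_sum]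
    refine Finset.sum_congr rfl fun α _ => ?_
    rw [Fintype.sum_prod_type]
    simp_rw [hψa, ← Finset.mul_sum, ← Finset.sum_mul, AddChar.sum_mulShift _ hprim]
    by_cases h0 : α = 0
    · simp [h0, MulChar.map_zero]
    · by_cases h1 : Algebra.trace k F α = 0 <;> by_cases h2 : Algebra.trace k F α⁻¹ = 0 <;>
        simp [h0, h1, h2]
      ring
  have h2 : ∑ α ∈ traceZeroPairs k F, χ α - (∑ α : F, χ α) / (q : ℂ) ^ 2 =
      (∑ uv ∈ (Finset.univ.erase (0 : k × k)), ∑ α : F,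
        χ α * ψ (algebraMap k F uv.1 * α + algebraMap k F uv.2 * α⁻¹)) / (q : ℂ) ^ 2 := by
    rw [← Finset.add_sum_erase _ _ (Finset.mem_univ (0 : k × k))] at hkey
    simp only [Prod.fst_zero, Prod.snd_zero, map_zero, zero_mul, add_zero, AddChar.map_zero_eq_one,
      mul_one] at hkey
    rw [eq_div_iff (pow_ne_zero 2 hqC), sub_mul, div_mul_cancel₀ _ (pow_ne_zero 2 hqC)]
    linear_combination hkey
  rw [h2, norm_div]
  have h3 : ‖∑ uv ∈ (Finset.univ.erase (0 : k × k)), ∑ α : F,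
        χ α * ψ (algebraMap k F uv.1 * α + algebraMap k F uv.2 * α⁻¹)‖ ≤
      ((q : ℝ) ^ 2 - 1) * (2 * √(Fintype.card F)) := by
    refine (norm_sum_le _ _).trans ?_
    refine (Finset.sum_le_card_nsmul _ _ (2 * √(Fintype.card F)) ?_).trans_eq ?_
    · intro uv huv
      apply norm_sum_mulChar_mul_addChar_le χ hψ
      have := Finset.ne_of_mem_erase huv
      by_contra! h
      simp only [map_eq_zero] at h
      exact this (Prod.ext h.1 h.2)
    · rw [Finset.card_erase_of_mem (Finset.mem_univ _), Finset.card_univ, Fintype.card_prod,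
        nsmul_eq_mul, Nat.cast_sub (Nat.mul_pos hqpos hqpos)]
      push_cast
      ring
  have hqR : (0 : ℝ) < (q : ℝ) ^ 2 := by positivity
  rw [norm_pow, Complex.norm_natCast, div_le_iff₀ hqR]
  refine h3.trans_eq ?_
  field_simp

theorem norm_sum_traceZeroPairs_le {χ : MulChar F ℂ} (hχ : χ ≠ 1) :
    ‖∑ α ∈ traceZeroPairs k F, χ α‖ ≤ 2 * √(Fintype.card F) := by
  have h := norm_sum_traceZeroPairs_sub_le (k := k) χ
  rw [MulChar.sum_eq_zero_of_ne_one hχ, zero_div, sub_zero] at h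
  refine h.trans (mul_le_of_le_one_left (by positivity) ?_)
  have : 0 ≤ 1 / (Fintype.card k : ℝ) ^ 2 := by positivity
  linarith

theorem card_traceZeroPairs_ge : (Fintype.card F : ℝ) / (Fintype.card k : ℝ) ^ 2 -
    2 * √(Fintype.card F) ≤ (traceZeroPairs k F).card := by
  classical
  have h := norm_sum_traceZeroPairs_sub_le (k := k) (1 : MulChar F ℂ)
  have h1 : ∑ α ∈ traceZeroPairs k F, (1 : MulChar F ℂ) α = ((traceZeroPairs k F).card : ℝ) := by
    rw [Finset.sum_congr rfl (g := fun _ => 1)]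
    · simp
    · intro α hα
      exact MulChar.one_apply (isUnit_iff_ne_zero.mpr (mem_traceZeroPairs.mp hα).1)
  have hF : 1 ≤ Fintype.card F := Fintype.card_pos
  have h2 : ∑ α : F, (1 : MulChar F ℂ) α = ((Fintype.card F - 1 : ℝ) : ℂ) := by
    rw [MulChar.sum_one_eq_card_units, Fintype.card_units, Nat.cast_sub hF]
    push_cast; ring
  rw [h1, h2] at h
  have h3 := (Complex.abs_re_le_norm _).trans h
  have h4 : (((traceZeroPairs k F).card : ℝ) - ((Fintype.card F - 1 : ℝ) : ℂ) /
    (Fintype.card k : ℂ) ^ 2 : ℂ) = (((traceZeroPairs k F).card - (Fintype.card F - 1 : ℝ) /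
    (Fintype.card k : ℝ) ^ 2 : ℝ) : ℂ) := by push_cast; ring
  rw [h4, Complex.ofReal_re] at h3
  have h5 := (abs_le.mp h3).1
  have hs : 1 ≤ √(Fintype.card F : ℝ) := Real.one_le_sqrt.mpr (by exact_mod_cast hF)
  have h6 : 0 ≤ 1 / (Fintype.card k : ℝ) ^ 2 := by positivity
  have h7 : ((Fintype.card F : ℝ) - 1) / (Fintype.card k : ℝ) ^ 2 =
    (Fintype.card F : ℝ) / (Fintype.card k : ℝ) ^ 2 - 1 / (Fintype.card k : ℝ) ^ 2 := by ring
  rw [h7] at h5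
  nlinarith

end CharacterSums

section Sieve

variable {F : Type*} [Field F]

/-- The indicator of not being in the kernel of `χ`. -/
def nonKer (χ : MulChar F ℂ) (α : F) : ℝ := by
  classical exact if χ α = 1 then 0 else 1

variable [Fintype F]

omit [Fintype F] in
theorem nonKer_eq {p : ℕ} (hp : p.Prime) {χ : MulChar F ℂ} (hχ : orderOf χ = p) {α : F}
    (hα : α ≠ 0) : (nonKer χ α : ℂ) =
      (1 - 1 / (p : ℂ)) - (1 / (p : ℂ)) * ∑ i ∈ Finset.Ico 1 p, (χ ^ i) α := by
  have hp0 : (p : ℂ) ≠ 0 := by exact_mod_cast hp.ne_zero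
  have hu : IsUnit α := isUnit_iff_ne_zero.mpr hα
  have h1 : ∑ i ∈ Finset.Ico 1 p, (χ ^ i) α = (∑ i ∈ Finset.range p, χ α ^ i) - 1 := by
    rw [Finset.range_eq_Ico, Finset.sum_eq_sum_Ico_succ_bot hp.pos, pow_zero]
    rw [zero_add, add_sub_cancel_left]
    refine Finset.sum_congr rfl fun i hi => MulChar.pow_apply' χ (by simp at hi; omega) α
  rw [h1]
  unfold nonKer
  split_ifs with h
  · simp only [h, one_pow, Finset.sum_const, Finset.card_range, nsmul_eq_mul, mul_one,
      Complex.ofReal_zero]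
    field_simp
    ring
  · have h2 : χ α ^ p = 1 := by
      rw [← MulChar.pow_apply' χ hp.ne_zero, ← hχ, pow_orderOf_eq_one, MulChar.one_apply hu]
    have h3 := mul_geom_sum (χ α) p
    rw [h2, sub_self] at h3
    rw [(mul_eq_zero.mp h3).resolve_left (sub_ne_zero.mpr h)]
    simp

theorem pow_card_sub_one_div_ne_one_of_nonKer {p : ℕ} (hp : p.Prime) (hpd : p ∣ Fintype.card F - 1)
    {χ : MulChar F ℂ} (hχ : orderOf χ = p) {α : F}
    (hα : α ≠ 0) (h : nonKer χ α ≠ 0) : α ^ ((Fintype.card F - 1) / p) ≠ 1 := by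
  classical
  intro h1
  apply h
  unfold nonKer
  rw [if_pos]
  obtain ⟨m, hm⟩ := hpd
  have hF : 1 < Fintype.card F := Fintype.one_lt_card
  rw [hm, Nat.mul_div_cancel_left _ hp.pos] at h1
  obtain ⟨g, hg⟩ := IsCyclic.exists_generator (α := Fˣ)
  obtain ⟨j, hj⟩ := (mem_powers_iff_mem_zpowers.mpr (hg (Units.mk0 α hα)))
  simp only at hj
  have hord := orderOf_eq_card_of_forall_mem_zpowers hg
  rw [Nat.card_eq_fintype_card, Fintype.card_units, hm] at hord
  have h2 : g ^ (j * m) = 1 := by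
    rw [pow_mul, hj]; ext; simpa using h1
  rw [← orderOf_dvd_iff_pow_eq_one, hord] at h2
  have hm0 : 0 < m := Nat.pos_of_ne_zero (by rintro rfl; omega)
  obtain ⟨t, rfl⟩ := Nat.dvd_of_mul_dvd_mul_right hm0 h2
  have h3 : α = ((g ^ t : Fˣ) : F) ^ p := by
    have := congrArg Units.val hj
    rw [Units.val_mk0] at this
    rw [← this, mul_comm, pow_mul]; simp
  rw [h3, map_pow, ← MulChar.pow_apply' χ hp.ne_zero, ← hχ, pow_orderOf_eq_one,
    MulChar.one_apply (Units.isUnit _)]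

omit [Fintype F] in
theorem nonKer_nonneg (χ : MulChar F ℂ) (α : F) : 0 ≤ nonKer χ α := by
  unfold nonKer; split_ifs <;> norm_num

omit [Fintype F] in
theorem nonKer_le_one (χ : MulChar F ℂ) (α : F) : nonKer χ α ≤ 1 := by
  unfold nonKer; split_ifs <;> norm_num

omit [Fintype F] in
theorem sum_mul_nonKer_mul {p : ℕ} (hp : p.Prime) {χ : MulChar F ℂ} (hχ : orderOf χ = p)
    (S : Finset F) (hS : 0 ∉ S) (g : F → ℂ) (η : MulChar F ℂ) :
    ∑ α ∈ S, (nonKer χ α * g α) * η α = (1 - 1 / (p : ℂ)) * ∑ α ∈ S, g α * η α -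
      (1 / (p : ℂ)) * ∑ i ∈ Finset.Ico 1 p, ∑ α ∈ S, g α * (η * χ ^ i) α := by
  rw [Finset.sum_comm, Finset.mul_sum, Finset.mul_sum, ← Finset.sum_sub_distrib]
  refine Finset.sum_congr rfl fun α hα => ?_
  rw [nonKer_eq hp hχ (ne_of_mem_of_not_mem hα hS), sub_mul, sub_mul, mul_assoc (1 / (p : ℂ)),
    mul_assoc (1 / (p : ℂ)), Finset.sum_mul, Finset.sum_mul]
  congr 1
  · ring
  · congr 1
    refine Finset.sum_congr rfl fun i _ => ?_
    rw [MulChar.mul_apply]; ring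

omit [Fintype F] in
theorem mul_pow_ne_one_of_not_dvd_orderOf {p : ℕ} (hp : p.Prime) {χ η : MulChar F ℂ}
    (hχ : orderOf χ = p) (hη : ¬ p ∣ orderOf η) {i : ℕ} (hi : i ∈ Finset.Ico 1 p) :
    η * χ ^ i ≠ 1 := by
  intro h
  rw [Finset.mem_Ico] at hi
  apply hη
  rw [eq_inv_of_mul_eq_one_left h, orderOf_inv, Nat.Coprime.orderOf_pow, hχ]
  rw [hχ, Nat.coprime_comm.symm]
  exact Nat.Coprime.symm (Nat.coprime_of_lt_prime (by omega) hi.2 hp)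

open Classical in
theorem norm_sum_prod_nonKer_sub_le (S : Finset F) (hS : 0 ∉ S) {M : ℝ}
    (hM : ∀ χ : MulChar F ℂ, χ ≠ 1 → ‖∑ α ∈ S, χ α‖ ≤ M) (c : ℕ → MulChar F ℂ) (T : Finset ℕ)
    (hT : ∀ p ∈ T, p.Prime ∧ orderOf (c p) = p) (η : MulChar F ℂ)
    (hη : ∀ p ∈ T, ¬ p ∣ orderOf η) :
    ‖∑ α ∈ S, ((∏ p ∈ T, nonKer (c p) α : ℝ) : ℂ) * η α -
        (if η = 1 then ((∏ p ∈ T, (1 - 1 / (p : ℝ)) : ℝ) : ℂ) * S.card else 0)‖ ≤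
      (∏ p ∈ T, (1 - 1 / (p : ℝ))) * (2 ^ T.card - if η = 1 then 1 else 0) * M := by
  induction T using Finset.induction_on generalizing η with
  | empty =>
    by_cases h : η = 1
    · have : ∑ α ∈ S, η α = S.card := by
        rw [Finset.sum_congr rfl (g := fun _ => 1)]
        · simp
        · intro α hα
          rw [h, MulChar.one_apply (isUnit_iff_ne_zero.mpr (ne_of_mem_of_not_mem hα hS))]
      simp only [Finset.prod_empty, Complex.ofReal_one, one_mul, this]
      simp [h]
    · simpa [h] using hM η h
  | insert p T hpT ih =>
    obtain ⟨hp, hord⟩ := hT p (Finset.mem_insert_self _ _)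
    have hT' := fun r hr => hT r (Finset.mem_insert_of_mem hr)
    have hη' : ∀ r ∈ T, ¬ r ∣ orderOf η := fun r hr => hη r (Finset.mem_insert_of_mem hr)
    have hpη := hη p (Finset.mem_insert_self _ _)
    have hp1 : (1 : ℝ) ≤ p := by exact_mod_cast hp.one_le
    set θ : ℝ := ∏ p ∈ T, (1 - 1 / (p : ℝ)) with hθ
    have hθ0 : 0 ≤ θ := Finset.prod_nonneg fun r hr => by
      have : (1 : ℝ) ≤ r := by exact_mod_cast (hT' r hr).1.one_le
      rw [sub_nonneg, div_le_one (by linarith)]; exact this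
    have h1 := ih hT' η hη'
    have h2 : ∀ i ∈ Finset.Ico 1 p, ‖∑ α ∈ S, ((∏ p ∈ T, nonKer (c p) α : ℝ) : ℂ) *
        (η * c p ^ i) α‖ ≤ θ * 2 ^ T.card * M := by
      intro i hi
      have hne := mul_pow_ne_one_of_not_dvd_orderOf hp hord hpη hi
      have := ih hT' (η * c p ^ i) (by
        intro r hr hdvd
        have h3 : r ∣ orderOf η * p :=
          (hdvd.trans (Commute.orderOf_mul_dvd_mul_orderOf (Commute.all _ _))).trans
            (mul_dvd_mul_left _ ((orderOf_pow_dvd (x := c p) i).trans hord.dvd))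
        rcases (hT' r hr).1.dvd_mul.mp h3 with h4 | h4
        · exact hη' r hr h4
        · rw [(Nat.prime_dvd_prime_iff_eq (hT' r hr).1 hp).mp h4] at hr
          exact hpT hr)
      simpa [hne] using this
    have h3 : ‖∑ i ∈ Finset.Ico 1 p, ∑ α ∈ S, ((∏ p ∈ T, nonKer (c p) α : ℝ) : ℂ) *
        (η * c p ^ i) α‖ ≤ (p - 1) * (θ * 2 ^ T.card * M) := by
      refine (norm_sum_le _ _).trans ((Finset.sum_le_card_nsmul _ _ _ h2).trans_eq ?_)
      rw [Nat.card_Ico, nsmul_eq_mul, Nat.cast_sub hp.one_le, Nat.cast_one]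
    have h4 := sum_mul_nonKer_mul hp hord S hS (fun α => ((∏ p ∈ T, nonKer (c p) α : ℝ) : ℂ)) η
    simp_rw [Finset.prod_insert hpT, Complex.ofReal_mul, Finset.card_insert_of_notMem hpT]
    rw [h4, ← hθ]
    set A := ∑ α ∈ S, ((∏ p ∈ T, nonKer (c p) α : ℝ) : ℂ) * η α
    set B := ∑ i ∈ Finset.Ico 1 p, ∑ α ∈ S, ((∏ p ∈ T, nonKer (c p) α : ℝ) : ℂ) *
        (η * c p ^ i) α
    have h5 : (1 - 1 / (p : ℂ)) * A - 1 / (p : ℂ) * B -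
        (if η = 1 then ((1 - 1 / (p : ℝ) : ℝ) : ℂ) * (θ : ℂ) * S.card else 0) =
        ((1 - 1 / (p : ℝ) : ℝ) : ℂ) * (A - if η = 1 then (θ : ℂ) * S.card else 0) -
          ((1 / (p : ℝ) : ℝ) : ℂ) * B := by
      push_cast
      split_ifs <;> ring
    rw [h5]
    have hp2 : 0 ≤ 1 - 1 / (p : ℝ) := by
      rw [sub_nonneg, div_le_one (by linarith)]; exact hp1
    refine (norm_sub_le _ _).trans ?_
    rw [norm_mul, norm_mul, Complex.norm_real, Complex.norm_real, Real.norm_of_nonneg hp2,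
      Real.norm_of_nonneg (by positivity)]
    refine (add_le_add (mul_le_mul_of_nonneg_left h1 hp2)
      (mul_le_mul_of_nonneg_left h3 (by positivity))).trans_eq ?_
    field_simp
    ring

/-- A sieve with a core set `T` and a sieving set `T'` of primes. -/
theorem exists_nonKer_of_sieve (S : Finset F) (hS : 0 ∉ S) {M D : ℝ}
    (hM : ∀ χ : MulChar F ℂ, χ ≠ 1 → ‖∑ α ∈ S, χ α‖ ≤ M) (hD : D - M ≤ S.card)
    (c : ℕ → MulChar F ℂ) (T T' : Finset ℕ) (hdisj : Disjoint T T')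
    (hT : ∀ p ∈ T ∪ T', p.Prime ∧ orderOf (c p) = p) (bad : Finset F) {δ : ℝ}
    (hδ : δ = 1 - ∑ p ∈ T', 1 / (p : ℝ)) (hδ0 : 0 ≤ δ)
    (h : (bad.card : ℝ) < (∏ p ∈ T, (1 - 1 / (p : ℝ))) *
      (δ * D - 2 ^ T.card * M * (T'.card - 1 + 2 * δ))) :
    ∃ α ∈ S, α ∉ bad ∧ ∀ p ∈ T ∪ T', nonKer (c p) α ≠ 0 := by
  classical
  by_contra! hcon
  set θ : ℝ := ∏ p ∈ T, (1 - 1 / (p : ℝ)) with hθ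
  have hθ0 : 0 ≤ θ := Finset.prod_nonneg fun r hr => by
    have : (1 : ℝ) ≤ r := by exact_mod_cast (hT r (Finset.mem_union_left _ hr)).1.one_le
    rw [sub_nonneg, div_le_one (by linarith)]; exact this
  set f : F → ℝ := fun α => ∏ p ∈ T, nonKer (c p) α with hf
  have hf0 : ∀ α, 0 ≤ f α := fun α => Finset.prod_nonneg fun _ _ => nonKer_nonneg _ _
  have hf1 : ∀ α, f α ≤ 1 := fun α => Finset.prod_le_one (fun _ _ => nonKer_nonneg _ _)
    fun _ _ => nonKer_le_one _ _
  -- the sieve inequality is pointwise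
  have hup : ∑ α ∈ S, f α * (1 - ∑ p ∈ T', (1 - nonKer (c p) α)) ≤ bad.card := by
    calc _ ≤ ∑ α ∈ S, (if α ∈ bad then (1 : ℝ) else 0) := by
          refine Finset.sum_le_sum fun α hα => ?_
          have hs : 0 ≤ ∑ p ∈ T', (1 - nonKer (c p) α) := Finset.sum_nonneg fun _ _ =>
            sub_nonneg.mpr (nonKer_le_one _ _)
          split_ifs with hb
          · nlinarith [hf0 α, hf1 α]
          · obtain ⟨p, hp, hp0⟩ := hcon α hα hb
            rcases Finset.mem_union.mp hp with hp | hp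
            · have : f α = 0 := Finset.prod_eq_zero hp hp0
              simp [this]
            · have h1 : 1 - nonKer (c p) α ≤ ∑ p ∈ T', (1 - nonKer (c p) α) :=
                Finset.single_le_sum (f := fun p => 1 - nonKer (c p) α)
                  (fun _ _ => sub_nonneg.mpr (nonKer_le_one _ _)) hp
              rw [hp0] at h1
              exact mul_nonpos_of_nonneg_of_nonpos (hf0 α) (by linarith)
      _ = ((S ∩ bad).card : ℝ) := by
          rw [← Finset.sum_filter, Finset.sum_const, nsmul_eq_mul, mul_one,
            Finset.filter_mem_eq_inter]
      _ ≤ bad.card := by exact_mod_cast Finset.card_le_card Finset.inter_subset_right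
  have hone : ∀ α ∈ S, (1 : MulChar F ℂ) α = 1 := fun α hα =>
    MulChar.one_apply (isUnit_iff_ne_zero.mpr (ne_of_mem_of_not_mem hα hS))
  have hTT : ∀ p ∈ T, p.Prime ∧ orderOf (c p) = p := fun p hp => hT p (Finset.mem_union_left _ hp)
  have h1 : θ * (D - 2 ^ T.card * M) ≤ ∑ α ∈ S, f α := by
    have := norm_sum_prod_nonKer_sub_le S hS hM c T hTT 1
      (by intro p hp; simpa using (hTT p hp).1.ne_one)
    simp only [if_true] at this
    have h2 : ∑ α ∈ S, ((∏ p ∈ T, nonKer (c p) α : ℝ) : ℂ) * (1 : MulChar F ℂ) α -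
        ((∏ p ∈ T, (1 - 1 / (p : ℝ)) : ℝ) : ℂ) * S.card =
        ((∑ α ∈ S, f α - θ * S.card : ℝ) : ℂ) := by
      push_cast
      congr 1
      · refine Finset.sum_congr rfl fun α hα => by rw [hone α hα, mul_one, hf]; simp
      · simp [hθ]
    rw [h2, Complex.norm_real, Real.norm_eq_abs] at this
    have h3 := (abs_le.mp this).1
    have h4 := mul_le_mul_of_nonneg_left hD hθ0
    linarith
  have h2 : ∀ p ∈ T', -(θ * 2 ^ T.card * M) * (1 - 1 / p) ≤ ∑ α ∈ S, f α *
    (nonKer (c p) α - (1 - 1 / p)) := by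
    intro p hp
    obtain ⟨hpp, hord⟩ := hT p (Finset.mem_union_right _ hp)
    have hp1 : (1 : ℝ) ≤ p := by exact_mod_cast hpp.one_le
    have e1 := sum_mul_nonKer_mul hpp hord S hS (fun α => (f α : ℂ)) 1
    have e2 : ∀ i ∈ Finset.Ico 1 p, ‖∑ α ∈ S, (f α : ℂ) * (1 * c p ^ i) α‖ ≤
        θ * 2 ^ T.card * M := by
      intro i hi
      have hne := mul_pow_ne_one_of_not_dvd_orderOf hpp hord (η := 1)
        (by simpa using hpp.ne_one) hi
      have := norm_sum_prod_nonKer_sub_le S hS hM c T hTT (1 * c p ^ i) (by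
        intro r hr hdvd
        have h3 : r ∣ p := by
          rw [one_mul] at hdvd
          rw [← hord]
          exact hdvd.trans (orderOf_pow_dvd i)
        rw [(Nat.prime_dvd_prime_iff_eq (hTT r hr).1 hpp).mp h3] at hr
        exact Finset.disjoint_left.mp hdisj hr hp)
      rw [if_neg hne, if_neg hne, sub_zero, sub_zero] at this
      exact this
    have e3 : ‖∑ i ∈ Finset.Ico 1 p, ∑ α ∈ S, (f α : ℂ) * (1 * c p ^ i) α‖ ≤
        (p - 1) * (θ * 2 ^ T.card * M) := by
      refine (norm_sum_le _ _).trans ((Finset.sum_le_card_nsmul _ _ _ e2).trans_eq ?_)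
      rw [Nat.card_Ico, nsmul_eq_mul, Nat.cast_sub hpp.one_le, Nat.cast_one]
    have e4 : ((∑ α ∈ S, f α * (nonKer (c p) α - (1 - 1 / p)) : ℝ) : ℂ) =
        -((1 / p : ℝ) : ℂ) * ∑ i ∈ Finset.Ico 1 p, ∑ α ∈ S, (f α : ℂ) * (1 * c p ^ i) α := by
      have e5 : ((∑ α ∈ S, f α * (nonKer (c p) α - (1 - 1 / p)) : ℝ) : ℂ) =
          ∑ α ∈ S, (nonKer (c p) α * (f α : ℂ)) * (1 : MulChar F ℂ) α -
            (1 - 1 / (p : ℂ)) * ∑ α ∈ S, (f α : ℂ) * (1 : MulChar F ℂ) α := by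
        rw [Finset.mul_sum, ← Finset.sum_sub_distrib]
        push_cast
        refine Finset.sum_congr rfl fun α hα => ?_
        rw [hone α hα]; ring
      rw [e5, e1]; push_cast; ring
    have e6 : |∑ α ∈ S, f α * (nonKer (c p) α - (1 - 1 / p))| ≤ (1 / p) *
      ((p - 1) * (θ * 2 ^ T.card * M)) := by
      rw [← Real.norm_eq_abs, ← Complex.norm_real, e4, norm_mul, norm_neg, Complex.norm_real,
        Real.norm_of_nonneg (by positivity)]
      exact mul_le_mul_of_nonneg_left e3 (by positivity)
    have e7 := (abs_le.mp e6).1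
    refine le_trans (le_of_eq ?_) e7
    field_simp
  have h3 : ∑ α ∈ S, f α * (1 - ∑ p ∈ T', (1 - nonKer (c p) α)) =
      δ * ∑ α ∈ S, f α + ∑ p ∈ T', ∑ α ∈ S, f α * (nonKer (c p) α - (1 - 1 / p)) := by
    rw [Finset.sum_comm, Finset.mul_sum, ← Finset.sum_add_distrib]
    refine Finset.sum_congr rfl fun α _ => ?_
    rw [← Finset.mul_sum, hδ]
    simp only [Finset.sum_sub_distrib]
    ring
  have h4 := Finset.sum_le_sum h2
  rw [← Finset.mul_sum, Finset.sum_sub_distrib, Finset.sum_const, nsmul_eq_mul, mul_one] at h4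
  have h5 := mul_le_mul_of_nonneg_left h1 hδ0
  have h6 : ∑ p ∈ T', 1 / (p : ℝ) = 1 - δ := by rw [hδ]; ring
  rw [h6] at h4
  rw [h3] at hup
  nlinarith

end Sieve

/-- Sieving for elements such that both traces vanish and which are not `p`-th powers. -/
theorem exists_traceZeroPair_of_sieve {k F : Type*} [Field k] [Fintype k] [Field F] [Fintype F]
    [Algebra k F] (T T' : Finset ℕ) (hdisj : Disjoint T T')
    (hT : ∀ p ∈ T ∪ T', p.Prime ∧ p ∣ Fintype.card F - 1) (bad : Finset F) {δ : ℝ}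
    (hδ : δ = 1 - ∑ p ∈ T', 1 / (p : ℝ)) (hδ0 : 0 ≤ δ)
    (h : (bad.card : ℝ) < (∏ p ∈ T, (1 - 1 / (p : ℝ))) *
      (δ * ((Fintype.card F : ℝ) / (Fintype.card k : ℝ) ^ 2) -
        2 ^ T.card * (2 * √(Fintype.card F)) * (T'.card - 1 + 2 * δ))) :
    ∃ α : F, α ≠ 0 ∧ Algebra.trace k F α = 0 ∧ Algebra.trace k F α⁻¹ = 0 ∧ α ∉ bad ∧
      ∀ p ∈ T ∪ T', α ^ ((Fintype.card F - 1) / p) ≠ 1 := by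
  have hex : ∀ p : ℕ, ∃ χ : MulChar F ℂ, p ∈ T ∪ T' → orderOf χ = p := by
    intro p
    by_cases hp : p ∈ T ∪ T'
    · obtain ⟨χ, hχ⟩ := MulChar.exists_mulChar_orderOf F (hT p hp).2
        (Complex.isPrimitiveRoot_exp p (hT p hp).1.ne_zero)
      exact ⟨χ, fun _ => hχ⟩
    · exact ⟨1, fun h => absurd h hp⟩
  choose c hc using hex
  obtain ⟨α, hα, hbad, hα'⟩ := exists_nonKer_of_sieve (traceZeroPairs k F) (by simp)
    (fun χ hχ => norm_sum_traceZeroPairs_le (k := k) hχ) card_traceZeroPairs_ge c T T' hdisj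
    (fun p hp => ⟨(hT p hp).1, hc p hp⟩) bad hδ hδ0 h
  rw [mem_traceZeroPairs] at hα
  exact ⟨α, hα.1, hα.2.1, hα.2.2, hbad, fun p hp =>
    pow_card_sub_one_div_ne_one_of_nonKer (hT p hp).1 (hT p hp).2 (hc p hp) hα.1 (hα' p hp)⟩

/-- The Lagrange-type resolvent `∑ i < n, ρ ^ i * α ^ (q ^ i)`. -/
def frobResolvent {F Ω : Type*} [Field F] [Field Ω] [Algebra F Ω] (q n : ℕ) (ρ : Ω) (α : F) : Ω :=
  ∑ i ∈ Finset.range n, ρ ^ i * algebraMap F Ω α ^ q ^ i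

section Resolvent

variable {k F Ω : Type*} [Field k] [Fintype k] [Field F] [Algebra k F]
  [Field Ω] [Algebra F Ω]

theorem algebraMap_mul_add_pow_card_pow (k : Type*) {R : Type*} [Field k] [Fintype k] [CommRing R]
    [Algebra k R] (i : ℕ)
    (x y : R) (c : k) : (algebraMap k R c * x + y) ^ Fintype.card k ^ i =
      algebraMap k R c * x ^ Fintype.card k ^ i + y ^ Fintype.card k ^ i := by
  obtain ⟨φ, hφ⟩ := exists_algHom_pow_card_pow k R i
  simp [← hφ]

theorem frobResolvent_add (n : ℕ) (ρ : Ω) (α β : F) :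
    frobResolvent (Fintype.card k) n ρ (α + β) =
      frobResolvent (Fintype.card k) n ρ α + frobResolvent (Fintype.card k) n ρ β := by
  simp_rw [frobResolvent, ← Finset.sum_add_distrib, ← map_pow]
  refine Finset.sum_congr rfl fun i _ => ?_
  have := algebraMap_mul_add_pow_card_pow k i α β 1
  simp only [map_one, one_mul] at this
  rw [this, map_add, mul_add]

omit [Fintype k] [Algebra k F] in
theorem frobResolvent_zero {q : ℕ} (hq : q ≠ 0) (n : ℕ) (ρ : Ω) :
    frobResolvent q n ρ (0 : F) = 0 := by
  simp [frobResolvent, hq]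

theorem frobResolvent_mul (n : ℕ) (ρ : Ω) (c : k) (α : F) :
    frobResolvent (Fintype.card k) n ρ (algebraMap k F c * α) =
      algebraMap F Ω (algebraMap k F c) * frobResolvent (Fintype.card k) n ρ α := by
  simp_rw [frobResolvent, Finset.mul_sum, ← map_pow]
  refine Finset.sum_congr rfl fun i _ => ?_
  have := algebraMap_mul_add_pow_card_pow k i α 0 c
  rw [add_zero, zero_pow (pow_ne_zero _ Fintype.card_ne_zero), add_zero] at this
  rw [this, map_mul]; ring

variable [Fintype F]

theorem frobResolvent_one_eq (α : F) :
    frobResolvent (Fintype.card k) (Module.finrank k F) (1 : Ω) α =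
      algebraMap F Ω (algebraMap k F (Algebra.trace k F α)) := by
  rw [FiniteField.algebraMap_trace_eq_sum_pow, frobResolvent, Nat.card_eq_fintype_card]
  simp

theorem mul_frobResolvent_pow_card {ρ : Ω} (hρ : ρ ^ Module.finrank k F = 1) (α : F) :
    ρ * frobResolvent (Fintype.card k) (Module.finrank k F) ρ (α ^ Fintype.card k) =
      frobResolvent (Fintype.card k) (Module.finrank k F) ρ α := by
  set n := Module.finrank k F with hn
  obtain ⟨m, hm⟩ : ∃ m, n = m + 1 := Nat.exists_eq_succ_of_ne_zero Module.finrank_pos.ne'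
  have hcard : α ^ Fintype.card k ^ n = α := by
    rw [hn, ← Module.card_eq_pow_finrank, FiniteField.pow_card]
  have h1 : ρ * frobResolvent (Fintype.card k) n ρ (α ^ Fintype.card k) =
      ∑ i ∈ Finset.range n, ρ ^ (i + 1) * algebraMap F Ω α ^ Fintype.card k ^ (i + 1) := by
    rw [frobResolvent, Finset.mul_sum]
    refine Finset.sum_congr rfl fun i _ => ?_
    rw [map_pow, ← pow_mul, ← pow_succ', pow_succ' ρ]; ring
  rw [h1, frobResolvent]
  conv_rhs => rw [hm, Finset.sum_range_succ']
  conv_lhs => rw [hm, Finset.sum_range_succ, ← hm, hρ, ← map_pow, hcard]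
  simp

theorem frobResolvent_pow_card_pow {ρ : Ω} (hρ : ρ ^ Module.finrank k F = 1) (α : F) (i : ℕ) :
    ρ ^ i * frobResolvent (Fintype.card k) (Module.finrank k F) ρ (α ^ Fintype.card k ^ i) =
      frobResolvent (Fintype.card k) (Module.finrank k F) ρ α := by
  induction i with
  | zero => simp
  | succ i ih =>
    rw [← ih, ← mul_frobResolvent_pow_card hρ (α ^ Fintype.card k ^ i), ← pow_mul, pow_succ,
      pow_succ]
    ring

theorem frobResolvent_polyAct {ρ : Ω} (hρ : ρ ^ Module.finrank k F = 1) (α : F) (h : k[X]) :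
    frobResolvent (Fintype.card k) (Module.finrank k F) ρ (polyAct (Fintype.card k) h α) =
      h.eval₂ ((algebraMap F Ω).comp (algebraMap k F)) ρ⁻¹ *
        frobResolvent (Fintype.card k) (Module.finrank k F) ρ α := by
  have hρ0 : ρ ≠ 0 := by
    rintro rfl
    rw [zero_pow Module.finrank_pos.ne'] at hρ
    exact zero_ne_one hρ
  rw [polyAct, eval₂_eq_sum, Polynomial.sum, Polynomial.sum, Finset.sum_mul]
  have hadd : ∀ (s : Finset ℕ) (f : ℕ → F), frobResolvent (Fintype.card k) (Module.finrank k F) ρ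
    (∑ i ∈ s, f i) =
      ∑ i ∈ s, frobResolvent (Fintype.card k) (Module.finrank k F) ρ (f i) := by
    intro s f
    refine map_sum (⟨⟨frobResolvent (Fintype.card k) (Module.finrank k F) ρ, ?_⟩, ?_⟩ : F →+ Ω) f s
    · exact frobResolvent_zero Fintype.card_ne_zero _ _
    · exact frobResolvent_add _ ρ
  rw [hadd]
  refine Finset.sum_congr rfl fun i _ => ?_
  rw [frobResolvent_mul, ← frobResolvent_pow_card_pow hρ α i]
  simp only [RingHom.comp_apply, inv_pow]
  field_simp

theorem isKNormal_one_of_frobResolvent_ne_zero {ζ : Ω}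
    (hζ : IsPrimitiveRoot ζ (Module.finrank k F)) {α : F} (htr : Algebra.trace k F α = 0)
    (hα : ∀ ρ : Ω, ρ ^ Module.finrank k F = 1 → ρ ≠ 1 →
      frobResolvent (Fintype.card k) (Module.finrank k F) ρ α ≠ 0) :
    IsKNormal k (Fintype.card k) (Module.finrank k F) 1 α := by
  classical
  set n := Module.finrank k F with hn
  have hn0 : n ≠ 0 := Module.finrank_pos.ne'
  have hmul := geom_sum_mul (X : k[X]) n
  have hX1 : (X - 1 : k[X]) = X - C 1 := by simp
  have hmonic : (∑ i ∈ Finset.range n, (X : k[X]) ^ i).Monic :=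
    Monic.of_mul_monic_right (hX1 ▸ monic_X_sub_C 1) (hmul ▸ (by
      simpa using monic_X_pow_sub_C (1 : k) hn0))
  have hdeg : (∑ i ∈ Finset.range n, (X : k[X]) ^ i).natDegree = n - 1 := by
    have := congrArg natDegree hmul
    rw [hmonic.natDegree_mul (hX1 ▸ monic_X_sub_C 1), hX1, natDegree_X_sub_C] at this
    have h2 := natDegree_X_pow_sub_C (n := n) (r := (1 : k))
    rw [map_one] at h2
    omega
  refine ⟨∑ i ∈ Finset.range n, X ^ i, ⟨hmonic, ⟨X - 1, hmul.symm⟩, ?_, ?_⟩, hdeg⟩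
  · rw [polyAct, sum_over_range' _ (by simp) n (by omega)]
    have h1 := FiniteField.algebraMap_trace_eq_sum_pow k F α
    rw [htr, map_zero, Nat.card_eq_fintype_card, ← hn] at h1
    rw [h1]
    refine Finset.sum_congr rfl fun i hi => ?_
    rw [finsetSum_coeff]
    simp only [coeff_X_pow, Finset.sum_ite_eq, hi, if_true, map_one, one_mul]
  · intro h' hm hdvd hact
    have h0 : h'.map ((algebraMap F Ω).comp (algebraMap k F)) ≠ 0 :=
      (hm.map _).ne_zero
    have hsub : (Polynomial.nthRootsFinset n (1 : Ω)).erase 1 ⊆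
        (h'.map ((algebraMap F Ω).comp (algebraMap k F))).roots.toFinset := by
      intro ρ hρ
      rw [Finset.mem_erase, mem_nthRootsFinset (Nat.pos_of_ne_zero hn0)] at hρ
      have h1 := frobResolvent_polyAct (k := k) (ρ := ρ⁻¹) (by rw [inv_pow, hρ.2, inv_one]) α h'
      have h2 := hα ρ⁻¹ (by rw [inv_pow, hρ.2, inv_one]) (by simpa using hρ.1)
      rw [hact, frobResolvent_zero Fintype.card_ne_zero, inv_inv] at h1
      rw [Multiset.mem_toFinset, mem_roots h0, IsRoot.def, eval_map]
      exact (mul_eq_zero.mp h1.symm).resolve_right h2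
    have hc := Finset.card_le_card hsub
    rw [Finset.card_erase_of_mem (by simp [mem_nthRootsFinset (Nat.pos_of_ne_zero hn0)]),
      hζ.card_nthRootsFinset] at hc
    rw [hdeg]
    exact hc.trans ((Multiset.toFinset_card_le _).trans ((card_roots' _).trans natDegree_map_le))
end Resolvent

section

variable {k F Ω : Type*} [Field k] [Fintype k] [Field F] [Fintype F] [Algebra k F]
  [Field Ω] [Algebra F Ω]

/-- Up to a factor in the base field, `α` and `α⁻¹` are primitive and `1`-normal. -/
structure IsGoodElement (k Ω : Type*) {F : Type*} [Field k] [Fintype k] [Field F] [Fintype F]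
    [Algebra k F] [Field Ω] [Algebra F Ω] (α : F) : Prop where
  ne_zero : α ≠ 0
  trace_eq : Algebra.trace k F α = 0
  trace_inv_eq : Algebra.trace k F α⁻¹ = 0
  frobResolvent_ne : ∀ ρ : Ω, ρ ^ Module.finrank k F = 1 → ρ ≠ 1 →
    frobResolvent (Fintype.card k) (Module.finrank k F) ρ α ≠ 0
  frobResolvent_inv_ne : ∀ ρ : Ω, ρ ^ Module.finrank k F = 1 → ρ ≠ 1 →
    frobResolvent (Fintype.card k) (Module.finrank k F) ρ α⁻¹ ≠ 0
  pow_ne_one : ∀ p : ℕ, p.Prime → p ∣ (Fintype.card F - 1) / (Fintype.card k - 1) →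
    α ^ ((Fintype.card F - 1) / p) ≠ 1

theorem card_sub_one_dvd_card_sub_one (k F : Type*) [Field k] [Fintype k] [Field F] [Fintype F]
    [Algebra k F] : Fintype.card k - 1 ∣ Fintype.card F - 1 := by
  rw [Module.card_eq_pow_finrank (K := k) (V := F)]
  simpa using Nat.sub_dvd_pow_sub_pow (Fintype.card k) 1 (Module.finrank k F)

omit [Fintype F] in
theorem exists_algebraMap_eq_of_pow_card_eq {x : F} (hx : x ^ Fintype.card k = x) :
    ∃ c : k, algebraMap k F c = x := by
  classical
  have h1 : (X ^ Fintype.card k - X : F[X]) ≠ 0 :=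
    FiniteField.X_pow_card_sub_X_ne_zero F Fintype.one_lt_card
  have h2 : Finset.univ.image (algebraMap k F) =
      (X ^ Fintype.card k - X : F[X]).roots.toFinset := by
    refine Finset.eq_of_subset_of_card_le ?_ ?_
    · intro y hy
      obtain ⟨c, -, rfl⟩ := Finset.mem_image.mp hy
      rw [Multiset.mem_toFinset, mem_roots h1]
      simp [← map_pow, FiniteField.pow_card]
    · rw [Finset.card_image_of_injective _ (algebraMap k F).injective, Finset.card_univ]
      refine (Multiset.toFinset_card_le _).trans ((card_roots' _).trans ?_)
      rw [FiniteField.X_pow_card_sub_X_natDegree_eq F Fintype.one_lt_card]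
  have h3 : x ∈ (X ^ Fintype.card k - X : F[X]).roots.toFinset := by
    rw [Multiset.mem_toFinset, mem_roots h1]
    simp [hx]
  rw [← h2] at h3
  obtain ⟨c, -, hc⟩ := Finset.mem_image.mp h3
  exact ⟨c, hc⟩

theorem exists_orderOf_algebraMap_mul_eq {α : F} (hα : α ≠ 0)
    (h : ∀ p : ℕ, p.Prime → p ∣ (Fintype.card F - 1) / (Fintype.card k - 1) →
      α ^ ((Fintype.card F - 1) / p) ≠ 1) :
    ∃ c : k, c ≠ 0 ∧ orderOf (algebraMap k F c * α) = Fintype.card F - 1 := by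
  classical
  have hq : 1 < Fintype.card k := Fintype.one_lt_card
  have hQ : 1 < Fintype.card F := Fintype.one_lt_card
  obtain ⟨m, hm⟩ := card_sub_one_dvd_card_sub_one k F
  rw [hm, Nat.mul_div_cancel_left _ (by omega)] at h
  set N := Fintype.card F - 1 with hN
  rw [← hm] at h
  have hN0 : 0 < N := by omega
  have : NeZero N := ⟨by omega⟩
  obtain ⟨g, hg⟩ := IsCyclic.exists_generator (α := Fˣ)
  obtain ⟨a, ha⟩ := (mem_powers_iff_mem_zpowers.mpr (hg (Units.mk0 α hα)))
  simp only at ha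
  have hord : orderOf g = N := by
    rw [orderOf_eq_card_of_forall_mem_zpowers hg, Nat.card_eq_fintype_card, Fintype.card_units]
  have hmN : m ∣ N := ⟨_, by rw [hm, mul_comm]⟩
  have hcop : Nat.Coprime a m := by
    by_contra hcon
    obtain ⟨p, hp, hpa, hpm⟩ := Nat.Prime.not_coprime_iff_dvd.mp hcon
    refine h p hp hpm ?_
    obtain ⟨b, rfl⟩ := hpa
    obtain ⟨d, hd⟩ := hpm.trans hmN
    have : α = ((g ^ (p * b) : Fˣ) : F) := by rw [ha]; rfl
    rw [this, ← Units.val_pow_eq_pow_val, hd, Nat.mul_div_cancel_left _ hp.pos, ← pow_mul,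
      show p * b * d = p * d * b by ring, ← hd, pow_mul, ← hord, pow_orderOf_eq_one, one_pow,
      Units.val_one]
  obtain ⟨u, hu⟩ := ZMod.unitsMap_surjective hmN (ZMod.unitOfCoprime a hcop)
  set b := (u : ZMod N).val with hb
  have hbN : Nat.Coprime b N := ZMod.val_coe_unit_coprime u
  have hba : (b : ℤ) ≡ a [ZMOD m] := by
    rw [← ZMod.intCast_eq_intCast_iff]
    have h1 := congrArg Units.val hu
    rw [ZMod.unitsMap_val, ZMod.coe_unitOfCoprime] at h1
    push_cast
    rw [← h1, hb, ZMod.natCast_val]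
  obtain ⟨t, ht⟩ := hba.symm.dvd
  have hc : ((g ^ ((m : ℤ) * t) : Fˣ) : F) ^ Fintype.card k = ((g ^ ((m : ℤ) * t) : Fˣ) : F) := by
    rw [← Units.val_pow_eq_pow_val]
    congr 1
    have : (g ^ ((m : ℤ) * t)) ^ (Fintype.card k - 1) = 1 := by
      rw [← zpow_natCast, ← zpow_mul, show (m : ℤ) * t * ((Fintype.card k - 1 : ℕ) : ℤ) =
        ((N : ℕ) : ℤ) * t by
        rw [hm]; push_cast; ring, zpow_mul, zpow_natCast, ← hord, pow_orderOf_eq_one, one_zpow]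
    rw [show Fintype.card k = Fintype.card k - 1 + 1 by omega, pow_succ, this, one_mul]
  obtain ⟨c, hc'⟩ := exists_algebraMap_eq_of_pow_card_eq hc
  refine ⟨c, ?_, ?_⟩
  · rintro rfl
    rw [map_zero] at hc'
    exact (Units.ne_zero _) hc'.symm
  · have h2 : algebraMap k F c * α = ((g ^ b : Fˣ) : F) := by
      rw [hc', show α = ((g ^ a : Fˣ) : F) by rw [ha]; rfl, ← Units.val_mul, ← zpow_natCast g a,
        ← zpow_add, ← ht, ← zpow_natCast g b]
      congr 2
      ring
    rw [h2, orderOf_units, Nat.Coprime.orderOf_pow, hord]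
    rw [hord]; exact hbN.symm

theorem IsGoodElement.exists_primitive_isKNormal {ζ : Ω}
    (hζ : IsPrimitiveRoot ζ (Module.finrank k F)) {α : F} (hα : IsGoodElement k Ω α) :
    ∃ α : F, α ≠ 0 ∧ orderOf α = Fintype.card F - 1 ∧ orderOf α⁻¹ = Fintype.card F - 1 ∧
      IsKNormal k (Fintype.card k) (Module.finrank k F) 1 α ∧
      IsKNormal k (Fintype.card k) (Module.finrank k F) 1 α⁻¹ := by
  obtain ⟨c, hc, hord⟩ := exists_orderOf_algebraMap_mul_eq hα.ne_zero hα.pow_ne_one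
  have hc' : algebraMap k F c ≠ 0 := by simpa using hc
  have hinv : (algebraMap k F c * α)⁻¹ = algebraMap k F c⁻¹ * α⁻¹ := by rw [mul_inv, map_inv₀]
  refine ⟨algebraMap k F c * α, mul_ne_zero hc' hα.ne_zero, hord, ?_, ?_, ?_⟩
  · have h0 : algebraMap k F c * α ≠ 0 := mul_ne_zero hc' hα.ne_zero
    rw [← hord, ← Units.val_mk0 h0, ← Units.val_inv_eq_inv_val, orderOf_units, orderOf_units,
      orderOf_inv]
  · refine isKNormal_one_of_frobResolvent_ne_zero hζ ?_ fun ρ h1 h2 => ?_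
    · rw [← Algebra.smul_def, map_smul, hα.trace_eq, smul_zero]
    · rw [frobResolvent_mul]
      exact mul_ne_zero (by simpa using hc) (hα.frobResolvent_ne ρ h1 h2)
  · rw [hinv]
    refine isKNormal_one_of_frobResolvent_ne_zero hζ ?_ fun ρ h1 h2 => ?_
    · rw [← Algebra.smul_def, map_smul, hα.trace_inv_eq, smul_zero]
    · rw [frobResolvent_mul]
      exact mul_ne_zero (by simpa using hc) (hα.frobResolvent_inv_ne ρ h1 h2)

end

section

variable {k F Ω : Type*} [Field k] [Fintype k] [Field F] [Fintype F] [Algebra k F]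
  [Field Ω] [Algebra F Ω]

open Classical in
theorem card_trace_eq_zero_triples_le {w : F} (hw : ∀ c : k, algebraMap k F c ≠ w) :
    (((traceZeroPairs k F).filter fun α => Algebra.trace k F (w * α) = 0).card : ℝ) ≤
      (Fintype.card F : ℝ) / (Fintype.card k : ℝ) ^ 3 + 2 * √(Fintype.card F) := by
  obtain ⟨ψ₀, hψ₀⟩ := AddChar.exists_apply_ne_zero.mpr (one_ne_zero (α := k))
  have hψ₀1 : ψ₀ ≠ 1 := AddChar.ne_one_iff.mpr ⟨1, hψ₀⟩
  have hprim := AddChar.IsPrimitive.of_ne_one hψ₀1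
  set q := Fintype.card k with hq
  have hqpos : 0 < q := Fintype.card_pos
  let ψ : AddChar F ℂ := ψ₀.compAddMonoidHom (Algebra.trace k F).toAddMonoidHom
  have hψ : ψ ≠ 1 := by
    obtain ⟨y, hy⟩ := Algebra.trace_surjective k F 1
    refine AddChar.ne_one_iff.mpr ⟨y, ?_⟩
    simpa [ψ, hy] using hψ₀
  have hψa : ∀ (u v t : k) (α : F), ψ ((algebraMap k F u + algebraMap k F t * w) * α +
      algebraMap k F v * α⁻¹) = ψ₀ (u * Algebra.trace k F α) * ψ₀ (v * Algebra.trace k F α⁻¹) *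
        ψ₀ (t * Algebra.trace k F (w * α)) := by
    intro u v t α
    rw [add_mul, mul_assoc, ← Algebra.smul_def, ← Algebra.smul_def, ← Algebra.smul_def,
      ← AddChar.map_add_eq_mul, ← AddChar.map_add_eq_mul]
    simp [ψ]
    congr 1
    ring
  have hkey : (q : ℂ) ^ 3 *
      ((traceZeroPairs k F).filter fun α => Algebra.trace k F (w * α) = 0).card =
      ∑ uvt : k × k × k, ∑ α : F, (1 : MulChar F ℂ) α *
        ψ ((algebraMap k F uvt.1 + algebraMap k F uvt.2.2 * w) * α + algebraMap k F uvt.2.1 *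
            α⁻¹) := by
    rw [Finset.sum_comm, Finset.card_eq_sum_ones, traceZeroPairs, Finset.filter_filter,
      Finset.sum_filter]
    push_cast
    rw [Finset.mul_sum]
    refine Finset.sum_congr rfl fun α _ => ?_
    rw [Fintype.sum_prod_type]
    simp_rw [Fintype.sum_prod_type, hψa, ← Finset.mul_sum, ← Finset.sum_mul,
      AddChar.sum_mulShift _ hprim]
    simp_rw [← Finset.mul_sum, ← Finset.sum_mul, AddChar.sum_mulShift _ hprim]
    by_cases h0 : α = 0
    · simp [h0, MulChar.map_zero]
    · rw [MulChar.one_apply (isUnit_iff_ne_zero.mpr h0)]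
      by_cases h1 : Algebra.trace k F α = 0 <;> by_cases h2 : Algebra.trace k F α⁻¹ = 0 <;>
        by_cases h3 : Algebra.trace k F (w * α) = 0 <;> simp [h0, h1, h2, h3]
      ring
  have hF : 1 ≤ Fintype.card F := Fintype.card_pos
  have h2 := congrArg norm hkey
  rw [norm_mul, norm_pow, Complex.norm_natCast, Complex.norm_natCast,
    ← Finset.add_sum_erase _ _ (Finset.mem_univ (0 : k × k × k))] at h2
  have h3 : ‖∑ α : F, (1 : MulChar F ℂ) α * ψ ((algebraMap k F (0 : k × k × k).1 +
      algebraMap k F (0 : k × k × k).2.2 * w) * α + algebraMap k F (0 : k × k × k).2.1 * α⁻¹)‖ ≤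
      Fintype.card F := by
    refine (norm_sum_le _ _).trans ((Finset.sum_le_card_nsmul _ _ 1 ?_).trans_eq (by simp))
    intro α _
    rw [norm_mul, AddChar.norm_apply, mul_one]
    by_cases h0 : α = 0
    · simp [h0, MulChar.map_zero]
    · rw [MulChar.one_apply (isUnit_iff_ne_zero.mpr h0), norm_one]
  have h4 : ‖∑ uvt ∈ (Finset.univ.erase (0 : k × k × k)), ∑ α : F, (1 : MulChar F ℂ) α *
        ψ ((algebraMap k F uvt.1 + algebraMap k F uvt.2.2 * w) * α + algebraMap k F uvt.2.1 *
            α⁻¹)‖ ≤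
      (q : ℝ) ^ 3 * (2 * √(Fintype.card F)) := by
    refine (norm_sum_le _ _).trans ?_
    refine (Finset.sum_le_card_nsmul _ _ (2 * √(Fintype.card F)) ?_).trans ?_
    · intro uvt huvt
      apply norm_sum_mulChar_mul_addChar_le 1 hψ
      have hne := Finset.ne_of_mem_erase huvt
      by_contra! h
      obtain ⟨u, v, t⟩ := uvt
      simp only [map_eq_zero] at h
      obtain ⟨h5, rfl⟩ := h
      by_cases ht : t = 0
      · subst ht
        simp only [map_zero, zero_mul, add_zero, map_eq_zero] at h5
        exact hne (by rw [h5]; rfl)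
      · apply hw (-u / t)
        have ht' : algebraMap k F t ≠ 0 := by simpa using ht
        rw [map_div₀, map_neg, div_eq_iff ht']
        linear_combination -h5
    · rw [nsmul_eq_mul]
      refine mul_le_mul_of_nonneg_right ?_ (by positivity)
      rw [Finset.card_erase_of_mem (Finset.mem_univ _), Finset.card_univ, Fintype.card_prod,
        Fintype.card_prod]
      calc ((Fintype.card k * (Fintype.card k * Fintype.card k) - 1 : ℕ) : ℝ)
          ≤ ((Fintype.card k * (Fintype.card k * Fintype.card k) : ℕ) : ℝ) := by
            exact_mod_cast Nat.sub_le _ _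
        _ = (q : ℝ) ^ 3 := by push_cast; ring
  have hqR : (0 : ℝ) < (q : ℝ) ^ 3 := by positivity
  have h5 := h2.le.trans ((norm_add_le _ _).trans (add_le_add h3 h4))
  rw [div_add' _ _ _ hqR.ne', le_div_iff₀ hqR]
  linarith

omit [Fintype F] in
/-- A `q`-linearized polynomial of `q`-degree `m` has at most `q ^ m` zeros. -/
theorem card_le_of_linearized {q : ℕ} (hq : 1 < q) (c : ℕ → Ω) (m : ℕ) (hc : c m ≠ 0) (Z : Finset F)
    (hZ : ∀ α ∈ Z, ∑ i ∈ Finset.range (m + 1), c i * algebraMap F Ω α ^ q ^ i = 0) :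
    Z.card ≤ q ^ m := by
  classical
  set P : Polynomial Ω := ∑ i ∈ Finset.range (m + 1), C (c i) * X ^ q ^ i with hP
  have hcoeff : P.coeff (q ^ m) = c m := by
    rw [hP, finsetSum_coeff, Finset.sum_eq_single m]
    · simp
    · intro i _ hi
      rw [coeff_C_mul, coeff_X_pow, if_neg, mul_zero]
      exact fun h => hi (Nat.pow_right_injective hq h).symm
    · simp
  have hP0 : P ≠ 0 := by rintro h; rw [h, coeff_zero] at hcoeff; exact hc hcoeff.symm
  have hdeg : P.natDegree ≤ q ^ m := by
    refine natDegree_sum_le_of_forall_le _ _ fun i hi => ?_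
    refine (natDegree_C_mul_X_pow_le _ _).trans (Nat.pow_le_pow_right (by omega) ?_)
    rw [Finset.mem_range] at hi
    omega
  have hsub : Z.image (algebraMap F Ω) ⊆ P.roots.toFinset := by
    intro x hx
    obtain ⟨α, hα, rfl⟩ := Finset.mem_image.mp hx
    rw [Multiset.mem_toFinset, mem_roots hP0, IsRoot.def, hP, eval_finsetSum]
    simpa using hZ α hα
  have h1 := Finset.card_le_card hsub
  rw [Finset.card_image_of_injective _ (algebraMap F Ω).injective] at h1
  exact h1.trans ((Multiset.toFinset_card_le _).trans ((card_roots' _).trans hdeg))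

theorem card_le_of_frobResolvent_eq_zero {n : ℕ} (hn : 2 ≤ n) (hdim : Module.finrank k F = n)
    {ρ : Ω} (hρ : ρ ^ n = 1) (hρ1 : ρ ≠ 1) (Z : Finset F)
    (hZ : ∀ α ∈ Z, Algebra.trace k F α = 0 ∧ frobResolvent (Fintype.card k) n ρ α = 0) :
    Z.card ≤ Fintype.card k ^ (n - 2) := by
  obtain ⟨m, rfl⟩ : ∃ m, n = m + 2 := ⟨n - 2, by omega⟩
  have hρ0 : ρ ≠ 0 := by rintro rfl; simp at hρ
  refine card_le_of_linearized (Ω := Ω) Fintype.one_lt_card (fun i => ρ ^ i - ρ ^ (m + 1)) m ?_ Z ?_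
  · rw [pow_succ, ← mul_one_sub]
    exact mul_ne_zero (pow_ne_zero _ hρ0) (sub_ne_zero.mpr hρ1.symm)
  · intro α hα
    obtain ⟨h1, h2⟩ := hZ α hα
    have h3 := frobResolvent_one_eq (k := k) (Ω := Ω) α
    rw [h1, map_zero, map_zero, hdim] at h3
    simp only [frobResolvent, one_pow, one_mul] at h2 h3
    rw [Finset.sum_range_succ] at h2 h3
    simp_rw [sub_mul, Finset.sum_sub_distrib, ← Finset.mul_sum]
    linear_combination h2 - ρ ^ (m + 1) * h3

theorem card_le_of_frobResolvent_eq_zero_of_ne {n : ℕ} (hn : 3 ≤ n)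
    (hdim : Module.finrank k F = n)
    {ρ σ : Ω} (hρ : ρ ^ n = 1) (hρ1 : ρ ≠ 1) (hσ : σ ^ n = 1) (hσ1 : σ ≠ 1) (hρσ : ρ ≠ σ)
        (Z : Finset F)
    (hZ : ∀ α ∈ Z, Algebra.trace k F α = 0 ∧ frobResolvent (Fintype.card k) n ρ α = 0 ∧
      frobResolvent (Fintype.card k) n σ α = 0) :
    Z.card ≤ Fintype.card k ^ (n - 3) := by
  obtain ⟨m, rfl⟩ : ∃ m, n = m + 3 := ⟨n - 3, by omega⟩
  have hρ0 : ρ ≠ 0 := by rintro rfl; simp at hρ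
  have hσ0 : σ ≠ 0 := by rintro rfl; simp at hσ
  refine card_le_of_linearized (Ω := Ω) Fintype.one_lt_card
    (fun i => σ ^ (m + 1) * (1 - σ) * (ρ ^ i - ρ ^ (m + 2)) -
      ρ ^ (m + 1) * (1 - ρ) * (σ ^ i - σ ^ (m + 2))) m ?_ Z ?_
  · have : σ ^ (m + 1) * (1 - σ) * (ρ ^ m - ρ ^ (m + 2)) -
      ρ ^ (m + 1) * (1 - ρ) * (σ ^ m - σ ^ (m + 2)) =
        ρ ^ m * σ ^ m * (1 - ρ) * (1 - σ) * (σ - ρ) := by ring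
    rw [this]
    exact mul_ne_zero (mul_ne_zero (mul_ne_zero
      (mul_ne_zero (pow_ne_zero _ hρ0) (pow_ne_zero _ hσ0))
      (sub_ne_zero.mpr hρ1.symm)) (sub_ne_zero.mpr hσ1.symm)) (sub_ne_zero.mpr hρσ.symm)
  · intro α hα
    obtain ⟨h1, h2, h4⟩ := hZ α hα
    have h3 := frobResolvent_one_eq (k := k) (Ω := Ω) α
    rw [h1, map_zero, map_zero, hdim] at h3
    simp only [frobResolvent, one_pow, one_mul] at h2 h3 h4
    rw [Finset.sum_range_succ, Finset.sum_range_succ] at h2 h3 h4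
    rw [Finset.sum_congr rfl (fun i _ => show _ = σ ^ (m + 1) * (1 - σ) *
      (ρ ^ i * algebraMap F Ω α ^ Fintype.card k ^ i) - ρ ^ (m + 1) * (1 - ρ) *
      (σ ^ i * algebraMap F Ω α ^ Fintype.card k ^ i) - (σ ^ (m + 1) * (1 - σ) * ρ ^ (m + 2) -
        ρ ^ (m + 1) * (1 - ρ) * σ ^ (m + 2)) * algebraMap F Ω α ^ Fintype.card k ^ i by ring)]
    simp_rw [Finset.sum_sub_distrib, ← Finset.mul_sum]
    linear_combination (σ ^ (m + 1) * (1 - σ)) * h2 - (ρ ^ (m + 1) * (1 - ρ)) * h4 -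
      (σ ^ (m + 1) * (1 - σ) * ρ ^ (m + 2) - ρ ^ (m + 1) * (1 - ρ) * σ ^ (m + 2)) * h3

theorem card_filter_trace_eq_zero [DecidableEq k] :
    (Finset.univ.filter fun α : F => Algebra.trace k F α = 0).card * Fintype.card k =
      Fintype.card F := by
  have h1 := Submodule.card_eq_card_quotient_mul_card (LinearMap.ker (Algebra.trace k F))
  rw [Nat.card_congr ((Algebra.trace k F).quotKerEquivOfSurjective
    (Algebra.trace_surjective k F)).toEquiv] at h1
  rw [← Nat.card_eq_fintype_card (α := F), h1, ← Nat.card_eq_fintype_card (α := k)]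
  congr 1
  rw [← Fintype.card_subtype, ← Nat.card_eq_fintype_card]
  exact Nat.card_congr (Equiv.subtypeEquivRight fun α => by simp [LinearMap.mem_ker])

theorem exists_trace_eq_zero_of_frobResolvent_eq_zero {n : ℕ} (hn : 2 ≤ n)
    (hdim : Module.finrank k F = n) {ρ : Ω} (hρ : ρ ^ n = 1) (hρ1 : ρ ≠ 1) :
    ∃ w : F, (∀ c : k, algebraMap k F c ≠ w) ∧
      ∀ α : F, frobResolvent (Fintype.card k) n ρ α = 0 → Algebra.trace k F (w * α) = 0 := by
  classical
  obtain ⟨β, hβ, hβ'⟩ : ∃ β : F, Algebra.trace k F β = 0 ∧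
      frobResolvent (Fintype.card k) n ρ β ≠ 0 := by
    by_contra! hcon
    have h1 := card_le_of_frobResolvent_eq_zero hn hdim hρ hρ1
      (Finset.univ.filter fun α : F => Algebra.trace k F α = 0)
      (fun α hα => ⟨(Finset.mem_filter.mp hα).2, hcon α (Finset.mem_filter.mp hα).2⟩)
    have h2 := card_filter_trace_eq_zero (k := k) (F := F)
    rw [Module.card_eq_pow_finrank (K := k) (V := F), hdim] at h2
    have hq : 1 < Fintype.card k := Fintype.one_lt_card
    have h3 : Fintype.card k ^ n = Fintype.card k ^ (n - 2) * Fintype.card k * Fintype.card k := by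
      rw [← pow_succ, ← pow_succ]; congr 1; omega
    have h4 : 0 < Fintype.card k ^ (n - 2) := by positivity
    have h5 := Nat.mul_le_mul_right (Fintype.card k) h1
    rw [h2, h3] at h5
    nlinarith [Nat.mul_pos h4 (by omega : 0 < Fintype.card k)]
  let _ : Algebra k Ω := ((algebraMap F Ω).comp (algebraMap k F)).toAlgebra
  let L : F →ₗ[k] Ω :=
    { toFun := frobResolvent (Fintype.card k) n ρ
      map_add' := frobResolvent_add n ρ
      map_smul' := fun c α => by
        rw [Algebra.smul_def, frobResolvent_mul]
        simp [Algebra.smul_def, RingHom.algebraMap_toAlgebra] }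
  obtain ⟨φ, hφ⟩ : ∃ φ : Module.Dual k Ω, φ (L β) ≠ 0 := by
    by_contra! hcon
    exact hβ' ((Module.forall_dual_apply_eq_zero_iff k (L β)).mp hcon)
  let w := ((Algebra.traceForm k F).toDual (traceForm_nondegenerate k F)).symm (φ.comp L)
  have hw : ∀ α, Algebra.trace k F (w * α) = φ (L α) := fun α => by
    have := LinearMap.BilinForm.apply_toDual_symm_apply (hB := traceForm_nondegenerate k F)
      (f := φ.comp L) (v := α)
    rwa [Algebra.traceForm_apply] at this
  refine ⟨w, ?_, ?_⟩
  · intro c hc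
    apply hφ
    rw [← hw, ← hc, ← Algebra.smul_def, map_smul, hβ, smul_zero]
  · intro α hα
    rw [hw, show L α = 0 from hα, map_zero]

end

section

variable {k F Ω : Type*} [Field k] [Fintype k] [Field F] [Fintype F] [Algebra k F]
  [Field Ω] [Algebra F Ω]

open Classical in
/-- Existence of a good element from a sieve inequality, given a bound for the number of pairs with
a prescribed vanishing resolvent. -/
theorem exists_isGoodElement_of_sieve {n : ℕ} (hn : 2 ≤ n) (hdim : Module.finrank k F = n) {ζ : Ω}
    (hζ : IsPrimitiveRoot ζ n) {B : ℝ}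
    (hB : ∀ ρ : Ω, ρ ^ n = 1 → ρ ≠ 1 → (((traceZeroPairs k F).filter fun α =>
      frobResolvent (Fintype.card k) n ρ α = 0).card : ℝ) ≤ B)
    (T T' : Finset ℕ) (hdisj : Disjoint T T')
    (hT : T ∪ T' = ((Fintype.card F - 1) / (Fintype.card k - 1)).primeFactors) {δ : ℝ}
    (hδ : δ = 1 - ∑ p ∈ T', 1 / (p : ℝ)) (hδ0 : 0 ≤ δ)
    (h : 2 * (n - 1) * B < (∏ p ∈ T, (1 - 1 / (p : ℝ))) *
      (δ * ((Fintype.card F : ℝ) / (Fintype.card k : ℝ) ^ 2) -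
        2 ^ T.card * (2 * √(Fintype.card F)) * (T'.card - 1 + 2 * δ))) :
    ∃ α : F, IsGoodElement k Ω α := by
  let Z : Ω → Finset F := fun ρ => (traceZeroPairs k F).filter fun α =>
      frobResolvent (Fintype.card k) n ρ α = 0
  let Z' : Ω → Finset F := fun ρ => (traceZeroPairs k F).filter fun α =>
      frobResolvent (Fintype.card k) n ρ α⁻¹ = 0
  have hZ' : ∀ ρ, (Z' ρ).card ≤ (Z ρ).card := by
    intro ρ
    refine Finset.card_le_card_of_injOn (fun α => α⁻¹) ?_ (inv_injective.injOn)
    intro α hα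
    simp only [Z', Z, Finset.coe_filter, Set.mem_ofPred_eq, mem_traceZeroPairs] at hα ⊢
    exact ⟨⟨inv_ne_zero hα.1.1, hα.1.2.2, by rw [inv_inv]; exact hα.1.2.1⟩, hα.2⟩
  let bad : Finset F := (Finset.Ico 1 n).biUnion fun j => Z (ζ ^ j) ∪ Z' (ζ ^ j)
  have hbad : (bad.card : ℝ) ≤ 2 * (n - 1) * B := by
    have h1 : (bad.card : ℝ) ≤ ∑ j ∈ Finset.Ico 1 n, ((Z (ζ ^ j) ∪ Z' (ζ ^ j)).card : ℝ) := by
      exact_mod_cast Finset.card_biUnion_le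
    refine h1.trans ((Finset.sum_le_card_nsmul _ _ (2 * B) ?_).trans_eq ?_)
    · intro j hj
      rw [Finset.mem_Ico] at hj
      have h2 : ((Z (ζ ^ j) ∪ Z' (ζ ^ j)).card : ℝ) ≤ (Z (ζ ^ j)).card + (Z' (ζ ^ j)).card := by
        exact_mod_cast Finset.card_union_le _ _
      have h3 : ((Z' (ζ ^ j)).card : ℝ) ≤ (Z (ζ ^ j)).card := by exact_mod_cast hZ' _
      have h4 := hB (ζ ^ j) (by rw [← pow_mul, mul_comm, pow_mul, hζ.pow_eq_one, one_pow])
        (hζ.pow_ne_one_of_pos_of_lt (by omega) hj.2)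
      change ((Z (ζ ^ j)).card : ℝ) ≤ B at h4
      linarith
    · rw [Nat.card_Ico, nsmul_eq_mul, Nat.cast_sub (by omega)]
      push_cast
      ring
  have hTp : ∀ p ∈ T ∪ T', p.Prime ∧ p ∣ Fintype.card F - 1 := by
    intro p hp
    rw [hT] at hp
    exact ⟨Nat.prime_of_mem_primeFactors hp, (Nat.dvd_of_mem_primeFactors hp).trans
      (Nat.div_dvd_of_dvd (card_sub_one_dvd_card_sub_one k F))⟩
  obtain ⟨α, h0, h1, h2, h3, h4⟩ :=
    exists_traceZeroPair_of_sieve (k := k) T T' hdisj hTp bad hδ hδ0 (hbad.trans_lt h)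
  have hmem : α ∈ traceZeroPairs k F := mem_traceZeroPairs.mpr ⟨h0, h1, h2⟩
  have hρ : ∀ ρ : Ω, ρ ^ n = 1 → ρ ≠ 1 → ∃ j ∈ Finset.Ico 1 n, ζ ^ j = ρ := by
    intro ρ hρ hρ1
    have : NeZero n := ⟨by omega⟩
    obtain ⟨i, hi, rfl⟩ := hζ.eq_pow_of_pow_eq_one hρ
    refine ⟨i, Finset.mem_Ico.mpr ⟨?_, hi⟩, rfl⟩
    rcases Nat.eq_zero_or_pos i with rfl | hi0
    · exact absurd (pow_zero _) hρ1
    · exact hi0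
  refine ⟨α, h0, h1, h2, ?_, ?_, ?_⟩
  · rw [hdim]
    intro ρ hρn hρ1 hcon
    obtain ⟨j, hj, rfl⟩ := hρ ρ hρn hρ1
    exact h3 (Finset.mem_biUnion.mpr ⟨j, hj, Finset.mem_union_left _
      (Finset.mem_filter.mpr ⟨hmem, hcon⟩)⟩)
  · rw [hdim]
    intro ρ hρn hρ1 hcon
    obtain ⟨j, hj, rfl⟩ := hρ ρ hρn hρ1
    exact h3 (Finset.mem_biUnion.mpr ⟨j, hj, Finset.mem_union_right _
      (Finset.mem_filter.mpr ⟨hmem, hcon⟩)⟩)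
  · intro p hp hpd
    refine h4 p ?_
    rw [hT, Nat.mem_primeFactors]
    refine ⟨hp, hpd, (Nat.div_pos (Nat.le_of_dvd ?_ (card_sub_one_dvd_card_sub_one k F)) ?_).ne'⟩
    · have : 1 < Fintype.card F := Fintype.one_lt_card
      omega
    · have : 1 < Fintype.card k := Fintype.one_lt_card
      omega

open Classical in
theorem card_frobResolvent_eq_zero_le {n : ℕ} (hn : 2 ≤ n) (hdim : Module.finrank k F = n) {ρ : Ω}
    (hρ : ρ ^ n = 1) (hρ1 : ρ ≠ 1) :
    (((traceZeroPairs k F).filter fun α => frobResolvent (Fintype.card k) n ρ α = 0).card : ℝ) ≤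
      (Fintype.card F : ℝ) / (Fintype.card k : ℝ) ^ 3 + 2 * √(Fintype.card F) := by
  obtain ⟨w, hw, hw'⟩ := exists_trace_eq_zero_of_frobResolvent_eq_zero hn hdim hρ hρ1
  refine le_trans ?_ (card_trace_eq_zero_triples_le hw)
  exact_mod_cast Finset.card_le_card (Finset.monotone_filter_right _ fun α _ h => hw' α h)

open Classical in
theorem card_frobResolvent_eq_zero_le_of_pow_ne {n : ℕ} (hn : 3 ≤ n)
    (hdim : Module.finrank k F = n) {ρ : Ω}
    (hρ : ρ ^ n = 1) (hρ1 : ρ ≠ 1) (hρq : ρ ^ Fintype.card k ≠ ρ) (hρq1 : ρ ^ Fintype.card k ≠ 1) :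
    ((traceZeroPairs k F).filter fun α => frobResolvent (Fintype.card k) n ρ α = 0).card ≤
      Fintype.card k ^ (n - 3) := by
  refine card_le_of_frobResolvent_eq_zero_of_ne hn hdim hρ hρ1
    (by rw [← pow_mul, mul_comm, pow_mul, hρ, one_pow]) hρq1 hρq.symm _ fun α hα => ?_
  rw [Finset.mem_filter, mem_traceZeroPairs] at hα
  refine ⟨hα.1.2.1, hα.2, ?_⟩
  subst hdim
  have h2 := mul_frobResolvent_pow_card (k := k)
    (show (ρ ^ Fintype.card k) ^ Module.finrank k F = 1 by
      rw [← pow_mul, mul_comm, pow_mul, hρ, one_pow]) α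
  rw [← h2, mul_eq_zero]
  right
  have h3 := hα.2
  obtain ⟨φ, hφ⟩ : ∃ φ : Ω →+* Ω, ∀ x, φ x = x ^ Fintype.card k := by
    let _ : Algebra k Ω := ((algebraMap F Ω).comp (algebraMap k F)).toAlgebra
    obtain ⟨φ, hφ⟩ := exists_algHom_pow_card_pow k Ω 1
    exact ⟨φ, by simpa using hφ⟩
  have h4 := congrArg φ h3
  rw [map_zero, frobResolvent, map_sum] at h4
  rw [frobResolvent, ← h4]
  refine Finset.sum_congr rfl fun i _ => ?_
  rw [hφ, mul_pow, map_pow, ← pow_mul, ← pow_mul, ← pow_mul, ← pow_mul, mul_comm i,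
    mul_comm (Fintype.card k ^ i)]

end

section

/-- If `P` consists of numbers below `y`, every element of `S` lies in `P` or is at least `y`, and
the product of `S` is small, then `S` has at most as many elements as `P` and at most the same
sum of reciprocals. -/
theorem card_le_and_sum_inv_le_of_prod_lt {S P : Finset ℕ} {y : ℕ}
    (hP : ∀ x ∈ P, 0 < x ∧ x < y) (hS : ∀ x ∈ S, 0 < x ∧ (x < y → x ∈ P)) (hy : 0 < y)
    (h : ∏ x ∈ S, x < y * ∏ x ∈ P, x) :
    S.card ≤ P.card ∧ ∑ x ∈ S, 1 / (x : ℝ) ≤ ∑ x ∈ P, 1 / (x : ℝ) := by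
  have hA : ∀ x ∈ S \ P, y ≤ x := fun x hx => by
    rw [Finset.mem_sdiff] at hx
    by_contra! hlt
    exact hx.2 ((hS x hx.1).2 hlt)
  have hcard : (S \ P).card ≤ (P \ S).card := by
    by_contra! hlt
    have h1 : y ^ (S \ P).card ≤ ∏ x ∈ S \ P, x := by
      rw [← Finset.prod_const]
      exact Finset.prod_le_prod' hA
    have h2 : ∏ x ∈ P \ S, x ≤ y ^ (P \ S).card := by
      rw [← Finset.prod_const]
      exact Finset.prod_le_prod' fun x hx => (hP x (Finset.mem_sdiff.mp hx).1).2.le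
    have h3 : y * ∏ x ∈ P \ S, x ≤ ∏ x ∈ S \ P, x := by
      calc y * ∏ x ∈ P \ S, x ≤ y ^ ((P \ S).card + 1) := by
            rw [pow_succ']; exact Nat.mul_le_mul_left _ h2
        _ ≤ y ^ (S \ P).card := Nat.pow_le_pow_right hy hlt
        _ ≤ _ := h1
    rw [← Finset.prod_inter_mul_prod_sdiff S P, ← Finset.prod_inter_mul_prod_sdiff P S,
      Finset.inter_comm P S] at h
    refine absurd h (not_lt.mpr ?_)
    calc y * ((∏ x ∈ S ∩ P, x) * ∏ x ∈ P \ S, x) =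
        (∏ x ∈ S ∩ P, x) * (y * ∏ x ∈ P \ S, x) := by ring
      _ ≤ _ := Nat.mul_le_mul_left _ h3
  refine ⟨?_, ?_⟩
  · rw [← Finset.card_inter_add_card_sdiff S P, ← Finset.card_inter_add_card_sdiff P S,
      Finset.inter_comm P S]
    omega
  · rw [← Finset.sum_inter_add_sum_sdiff S P, ← Finset.sum_inter_add_sum_sdiff P S,
      Finset.inter_comm P S]
    have hy' : (0 : ℝ) < y := by exact_mod_cast hy
    refine add_le_add_right ?_ _
    calc ∑ x ∈ S \ P, 1 / (x : ℝ) ≤ (S \ P).card • (1 / (y : ℝ)) := by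
          refine Finset.sum_le_card_nsmul _ _ _ fun x hx => ?_
          exact one_div_le_one_div_of_le hy' (by exact_mod_cast hA x hx)
      _ ≤ (P \ S).card • (1 / (y : ℝ)) := by
          rw [nsmul_eq_mul, nsmul_eq_mul]
          refine mul_le_mul_of_nonneg_right (by exact_mod_cast hcard) (by positivity)
      _ ≤ _ := by
          refine Finset.card_nsmul_le_sum _ _ _ fun x hx => ?_
          obtain ⟨h1, h2⟩ := hP x (Finset.mem_sdiff.mp hx).1
          exact one_div_le_one_div_of_le (by exact_mod_cast h1) (by exact_mod_cast h2.le)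

theorem factorial_card_add_one_le_prod {S : Finset ℕ} (hS : ∀ x ∈ S, 2 ≤ x) :
    (S.card + 1).factorial ≤ ∏ x ∈ S, x := by
  rcases Nat.eq_zero_or_pos S.card with h0 | h0
  · rw [Finset.card_eq_zero] at h0
    simp [h0]
  · by_contra! hlt
    have hprod : ∏ x ∈ Finset.Ico 2 (S.card + 1), x = S.card.factorial := by
      have h1 := Finset.prod_eq_prod_Ico_succ_bot (show 1 < S.card + 1 by omega) (fun x => x)
      rwa [Finset.prod_Ico_id_eq_factorial, one_mul, eq_comm] at h1
    have := (card_le_and_sum_inv_le_of_prod_lt (S := S) (P := Finset.Ico 2 (S.card + 1))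
      (y := S.card + 1)
      (fun x hx => by rw [Finset.mem_Ico] at hx; omega)
      (fun x hx => ⟨by have := hS x hx; omega,
        fun h => by rw [Finset.mem_Ico]; exact ⟨hS x hx, h⟩⟩) (by omega)
      (by rwa [hprod, ← Nat.factorial_succ])).1
    rw [Nat.card_Ico] at this
    omega

theorem sum_one_div_le_of_sum_div_add_one_le {P : Finset ℕ} {A N : ℕ} (hN : 0 < N)
    (hP : ∀ x ∈ P, 0 < x) (h : ∑ x ∈ P, (N / x + 1) ≤ A) :
    ∑ x ∈ P, 1 / (x : ℝ) ≤ A / N := by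
  have hN' : (0 : ℝ) < N := by exact_mod_cast hN
  rw [le_div_iff₀ hN', Finset.sum_mul]
  have h' : ((∑ x ∈ P, (N / x + 1) : ℕ) : ℝ) ≤ A := by exact_mod_cast h
  refine le_trans ?_ h'
  push_cast
  refine Finset.sum_le_sum fun x hx => ?_
  have hx' : (0 : ℝ) < x := by exact_mod_cast hP x hx
  rw [one_div, inv_mul_eq_div, div_le_iff₀ hx']
  have h1 : N < (N / x + 1) * x := Nat.lt_mul_of_div_lt (Nat.lt_succ_self _) (hP x hx)
  exact_mod_cast h1.le

theorem two_pow_lt_factorial_of_le {s : ℕ} (hs : 100 ≤ s) : 2 ^ (5 * s + 31) <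
    (s + 1).factorial := by
  induction s, hs using Nat.le_induction with
  | base => decide +kernel
  | succ s hs ih =>
    rw [Nat.factorial_succ, show 5 * (s + 1) + 31 = 5 * s + 31 + 5 by ring, pow_add, mul_comm]
    exact Nat.mul_lt_mul_of_le_of_lt (by omega) ih (by omega)

theorem two_pow_lt_factorial_of_le' {s : ℕ} (hs : 720 ≤ s) :
    2 ^ (8 * s + 41) < (s + 1).factorial := by
  induction s, hs using Nat.le_induction with
  | base => decide +kernel
  | succ s hs ih =>
    rw [Nat.factorial_succ, show 8 * (s + 1) + 41 = 8 * s + 41 + 8 by ring, pow_add, mul_comm]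
    exact Nat.mul_lt_mul_of_le_of_lt (by omega) ih (by omega)

end

section

theorem pow_sub_one_div_sub_one_eq_five {q : ℕ} (hq : 1 < q) :
    (q ^ 5 - 1) / (q - 1) = 1 + q + q ^ 2 + q ^ 3 + q ^ 4 := by
  rw [← Nat.geomSum_eq hq]
  simp [Finset.sum_range_succ]

theorem pow_sub_one_div_sub_one_eq_six {q : ℕ} (hq : 1 < q) :
    (q ^ 6 - 1) / (q - 1) = 1 + q + q ^ 2 + q ^ 3 + q ^ 4 + q ^ 5 := by
  rw [← Nat.geomSum_eq hq]
  simp [Finset.sum_range_succ]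

theorem prime_dvd_one_add_pow_four {p q : ℕ} (hp : p.Prime)
    (h : p ∣ 1 + q + q ^ 2 + q ^ 3 + q ^ 4) : p = 5 ∧ q % 5 = 1 ∨ p % 10 = 1 := by
  have : Fact p.Prime := ⟨hp⟩
  have hmod : ∀ r, 1 + q + q ^ 2 + q ^ 3 + q ^ 4 ≡
      1 + q % r + (q % r) ^ 2 + (q % r) ^ 3 + (q % r) ^ 4 [MOD r] := fun r =>
    have hq : q ≡ q % r [MOD r] := (Nat.mod_modEq q r).symm
    ((((Nat.ModEq.refl 1).add hq).add (hq.pow 2)).add (hq.pow 3)).add (hq.pow 4)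
  by_cases h5 : p = 5
  · left
    subst h5
    refine ⟨rfl, ?_⟩
    have h1 := (hmod 5).symm.trans (Nat.modEq_zero_iff_dvd.mpr h)
    have h2 : q % 5 < 5 := Nat.mod_lt _ (by norm_num)
    interval_cases q % 5 <;> simp_all [Nat.ModEq]
  · right
    have h0 : (1 + (q : ZMod p) + q ^ 2 + q ^ 3 + q ^ 4) = 0 := by
      have := (ZMod.natCast_eq_zero_iff _ p).mpr h
      exact_mod_cast this
    have hq5 : (q : ZMod p) ^ 5 = 1 := by
      linear_combination ((q : ZMod p) - 1) * h0
    have hq1 : (q : ZMod p) ≠ 1 := by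
      intro h1
      rw [h1] at h0
      have h2 : ((5 : ℕ) : ZMod p) = 0 := by push_cast; linear_combination h0
      rw [ZMod.natCast_eq_zero_iff] at h2
      exact h5 ((Nat.prime_dvd_prime_iff_eq hp Nat.prime_five).mp h2)
    have : Fact (Nat.Prime 5) := ⟨Nat.prime_five⟩
    have hord := orderOf_eq_prime hq5 hq1
    have hq0 : (q : ZMod p) ≠ 0 := by
      intro h1
      rw [h1] at h0
      simp at h0
    have h1 := orderOf_dvd_of_pow_eq_one (ZMod.pow_card_sub_one_eq_one hq0)
    rw [hord] at h1
    have h2 : p ≠ 2 := by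
      rintro rfl
      have h3 := (hmod 2).symm.trans (Nat.modEq_zero_iff_dvd.mpr h)
      have h4 : q % 2 < 2 := Nat.mod_lt _ (by norm_num)
      interval_cases q % 2 <;> simp_all [Nat.ModEq]
    have h3 := hp.eq_two_or_odd
    have h4 := hp.two_le
    omega

variable {k F Ω : Type*} [Field k] [Fintype k] [Field F] [Fintype F] [Algebra k F]
  [Field Ω] [Algebra F Ω]

omit [Field Ω] [Algebra F Ω] in
theorem card_eq_pow_of_finrank_eq {n : ℕ} (hdim : Module.finrank k F = n) :
    Fintype.card F = Fintype.card k ^ n := by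
  rw [Module.card_eq_pow_finrank (K := k) (V := F), hdim]

theorem Real.sqrt_pow_five (q : ℝ) : √(q ^ 5) = q ^ 2 * √q := by
  rw [show q ^ 5 = (q ^ 2) ^ 2 * q by ring, Real.sqrt_mul (by positivity),
    Real.sqrt_sq (by positivity)]

theorem Real.sqrt_pow_six {q : ℝ} (hq : 0 ≤ q) : √(q ^ 6) = q ^ 3 := by
  rw [show q ^ 6 = (q ^ 3) ^ 2 by ring, Real.sqrt_sq (by positivity)]

open Classical in
theorem exists_isGoodElement_five_of_le (hdim : Module.finrank k F = 5) {ζ : Ω}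
    (hζ : IsPrimitiveRoot ζ 5) {q : ℕ} (hqk : Fintype.card k = q) {e : ℝ}
    (hB : ∀ ρ : Ω, ρ ^ 5 = 1 → ρ ≠ 1 → (((traceZeroPairs k F).filter fun α =>
      frobResolvent (Fintype.card k) 5 ρ α = 0).card : ℝ) ≤ q ^ 2 * (1 + e * √q))
    {s : ℕ} {σ r : ℝ} (hs : (Nat.primeFactors (1 + q + q ^ 2 + q ^ 3 + q ^ 4)).card ≤ s)
    (hσ : ∑ p ∈ Nat.primeFactors (1 + q + q ^ 2 + q ^ 3 + q ^ 4), 1 / (p : ℝ) ≤ σ) (hσ1 : σ ≤ 1)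
    (hr4 : 4 ≤ r) (hr : r ^ 2 ≤ q) (h0 : 0 ≤ (1 - σ) * (r - 4) - 2 * (s - 1) - 8 * e)
    (h : 8 < r * ((1 - σ) * (r - 4) - 2 * (s - 1) - 8 * e)) :
    ∃ α : F, IsGoodElement k Ω α := by
  have hq1 : 1 < q := hqk ▸ Fintype.one_lt_card
  have hm := pow_sub_one_div_sub_one_eq_five hq1
  set S := Nat.primeFactors (1 + q + q ^ 2 + q ^ 3 + q ^ 4) with hS
  refine exists_isGoodElement_of_sieve (by norm_num) hdim hζ hB ∅ S (Finset.disjoint_empty_left _)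
    (by rw [Finset.empty_union, card_eq_pow_of_finrank_eq hdim, hqk, hm]) rfl (by linarith) ?_
  rw [card_eq_pow_of_finrank_eq hdim, hqk]
  push_cast
  have hqR : (0 : ℝ) < q := by exact_mod_cast (by omega : 0 < q)
  rw [Real.sqrt_pow_five, show (q : ℝ) ^ 5 / q ^ 2 = q ^ 3 by field_simp]
  rw [Finset.prod_empty, Finset.card_empty, pow_zero, one_mul, one_mul]
  set δ := 1 - ∑ p ∈ S, 1 / (p : ℝ) with hδ
  have hδ' : 1 - σ ≤ δ := by linarith
  have hs' : (S.card : ℝ) ≤ s := by exact_mod_cast hs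
  set x := √(q : ℝ) with hx
  have hxq : x ^ 2 = q := Real.sq_sqrt hqR.le
  have hrx : r ≤ x := Real.le_sqrt_of_sq_le hr
  have hmono : (1 - σ) * (r - 4) - 2 * (s - 1) - 8 * e ≤
      δ * (x - 4) - 2 * (S.card - 1) - 8 * e := by
    have : (1 - σ) * (r - 4) ≤ δ * (x - 4) := by
      apply mul_le_mul hδ' (by linarith) (by linarith) (by linarith)
    linarith
  have hkey : 8 < x * (δ * (x - 4) - 2 * (S.card - 1) - 8 * e) :=
    h.trans_le (mul_le_mul hrx hmono h0 (by linarith))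
  rw [← hxq]
  have hx4 : 0 < x ^ 4 := by positivity
  have := mul_lt_mul_of_pos_left hkey hx4
  linarith

open Classical in
theorem exists_isGoodElement_six_of_le (hdim : Module.finrank k F = 6) {ζ : Ω}
    (hζ : IsPrimitiveRoot ζ 6) {q : ℕ} (hqk : Fintype.card k = q) (core : Finset ℕ)
    (hcore : ∀ p ∈ core, p.Prime)
    {s : ℕ} {σ θ r : ℝ}
    (hs : (Nat.primeFactors (1 + q + q ^ 2 + q ^ 3 + q ^ 4 + q ^ 5) \ core).card ≤ s)
    (hσ : ∑ p ∈ Nat.primeFactors (1 + q + q ^ 2 + q ^ 3 + q ^ 4 + q ^ 5) \ core, 1 / (p : ℝ) ≤ σ)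
    (hσ1 : σ ≤ 1) (hr4 : 2 ^ (core.card + 2) ≤ r) (hr : r ≤ q) (hθ0 : 0 < θ)
    (hθ : θ ≤ ∏ p ∈ core, (1 - 1 / (p : ℝ)))
    (h : 30 < θ * ((1 - σ) * (r - 2 ^ (core.card + 2)) - 2 ^ (core.card + 1) * (s - 1))) :
    ∃ α : F, IsGoodElement k Ω α := by
  have hq1 : 1 < q := hqk ▸ Fintype.one_lt_card
  have hm := pow_sub_one_div_sub_one_eq_six hq1
  set S := Nat.primeFactors (1 + q + q ^ 2 + q ^ 3 + q ^ 4 + q ^ 5) with hS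
  have hqR : (0 : ℝ) < q := by exact_mod_cast (by omega : 0 < q)
  have hB : ∀ ρ : Ω, ρ ^ 6 = 1 → ρ ≠ 1 → (((traceZeroPairs k F).filter fun α =>
      frobResolvent (Fintype.card k) 6 ρ α = 0).card : ℝ) ≤ 3 * q ^ 3 := by
    intro ρ hρ hρ1
    refine (card_frobResolvent_eq_zero_le (by norm_num) hdim hρ hρ1).trans_eq ?_
    rw [card_eq_pow_of_finrank_eq hdim, hqk]
    push_cast
    rw [Real.sqrt_pow_six hqR.le]
    field_simp
    ring
  have hfac : ∀ p ∈ core, 0 ≤ 1 - 1 / (p : ℝ) ∧ 1 - 1 / (p : ℝ) ≤ 1 := by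
    intro p hp
    have h2 : (1 : ℝ) ≤ p := by exact_mod_cast (hcore p hp).one_lt.le
    have h3 : 1 / (p : ℝ) ≤ 1 := by rw [div_le_one (by linarith)]; exact h2
    have h4 : 0 ≤ 1 / (p : ℝ) := by positivity
    constructor <;> linarith
  refine exists_isGoodElement_of_sieve (by norm_num) hdim hζ hB (S ∩ core) (S \ core)
    (Finset.disjoint_sdiff_inter _ _).symm
    (by rw [Finset.union_comm, Finset.sdiff_union_inter, card_eq_pow_of_finrank_eq hdim, hqk,
        hm]) rfl
    (by linarith) ?_
  rw [card_eq_pow_of_finrank_eq hdim, hqk]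
  push_cast
  rw [Real.sqrt_pow_six hqR.le, show (q : ℝ) ^ 6 / q ^ 2 = q ^ 4 by field_simp]
  set δ := 1 - ∑ p ∈ S \ core, 1 / (p : ℝ) with hδ
  have hδ' : 1 - σ ≤ δ := by linarith
  have hs' : ((S \ core).card : ℝ) ≤ s := by exact_mod_cast hs
  have hθ' : θ ≤ ∏ p ∈ S ∩ core, (1 - 1 / (p : ℝ)) := by
    refine hθ.trans ?_
    rw [← Finset.prod_inter_mul_prod_sdiff core S, Finset.inter_comm core S]
    refine mul_le_of_le_one_right (Finset.prod_nonneg fun p hp =>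
      (hfac p (Finset.mem_inter.mp hp).2).1) (Finset.prod_le_one ?_ ?_)
    · exact fun p hp => (hfac p (Finset.mem_sdiff.mp hp).1).1
    · exact fun p hp => (hfac p (Finset.mem_sdiff.mp hp).1).2
  have hpow : (2 : ℝ) ^ (S ∩ core).card ≤ 2 ^ core.card :=
    pow_le_pow_right₀ (by norm_num) (Finset.card_le_card Finset.inter_subset_right)
  have hnn : 0 ≤ ((S \ core).card : ℝ) - 1 + 2 * δ := by
    rcases Nat.eq_zero_or_pos (S \ core).card with h0 | h0
    · have : δ = 1 := by rw [hδ, Finset.card_eq_zero.mp h0]; simp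
      rw [h0, this]; norm_num
    · have : (1 : ℝ) ≤ (S \ core).card := by exact_mod_cast h0
      linarith
  rw [pow_add, pow_add] at h
  rw [pow_add] at hr4
  have h1 : (1 - σ) * (r - 2 ^ core.card * 2 ^ 2) - 2 ^ core.card * 2 ^ 1 * (s - 1) ≤
      δ * q - 2 ^ (S ∩ core).card * 2 * ((S \ core).card - 1 + 2 * δ) := by
    have h2 : (1 - σ) * (r - 2 ^ core.card * 2 ^ 2) ≤ δ * (q - 2 ^ core.card * 2 ^ 2) :=
      mul_le_mul hδ' (by linarith) (by linarith) (by linarith)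
    have h3 := mul_le_mul_of_nonneg_right hpow hnn
    have h4 : (2 : ℝ) ^ core.card * ((S \ core).card - 1) ≤ 2 ^ core.card * (s - 1) :=
      mul_le_mul_of_nonneg_left (by linarith) (by positivity)
    linarith
  have h0 : 0 ≤ (1 - σ) * (r - 2 ^ core.card * 2 ^ 2) - 2 ^ core.card * 2 ^ 1 * (s - 1) := by
    by_contra! hneg
    have := mul_neg_of_pos_of_neg hθ0 hneg
    linarith
  have hkey := h.trans_le (mul_le_mul hθ' h1 h0 (hθ0.le.trans hθ'))
  have := mul_lt_mul_of_pos_left hkey (show (0 : ℝ) < q ^ 3 by positivity)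
  linarith

end

section

/-- Candidates for the prime divisors of `1 + q + q² + q³ + q⁴`. -/
abbrev IsFiveCandidate (x : ℕ) : Prop :=
  1 < x ∧ (x = 5 ∨ x % 10 = 1 ∧ Nat.gcd x 21 = 1 ∧ x % 121 ≠ 0)

theorem isFiveCandidate_of_prime {p : ℕ} (hp : p.Prime) (h : p = 5 ∨ p % 10 = 1) :
    IsFiveCandidate p := by
  refine ⟨hp.one_lt, h.imp_right fun h => ⟨h, ?_, ?_⟩⟩
  · refine (Nat.Prime.coprime_iff_not_dvd hp).mpr fun hd => ?_
    have := Nat.le_of_dvd (by norm_num) hd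
    have := hp.two_le
    interval_cases p <;> first | omega | exact absurd hp (by norm_num)
  · intro h0
    have h1 : 11 * 11 ∣ p := Nat.dvd_of_mod_eq_zero h0
    have h2 := (Nat.prime_dvd_prime_iff_eq (by norm_num) hp).mp (dvd_of_mul_left_dvd h1)
    subst h2
    norm_num at h1

variable {k F Ω : Type*} [Field k] [Fintype k] [Field F] [Fintype F] [Algebra k F]
  [Field Ω] [Algebra F Ω]

open Classical in
theorem exists_isGoodElement_five_of_tier (hdim : Module.finrank k F = 5) {ζ : Ω}
    (hζ : IsPrimitiveRoot ζ 5) {q : ℕ} (hqk : Fintype.card k = q) {e : ℝ}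
    (hB : ∀ ρ : Ω, ρ ^ 5 = 1 → ρ ≠ 1 → (((traceZeroPairs k F).filter fun α =>
      frobResolvent (Fintype.card k) 5 ρ α = 0).card : ℝ) ≤ q ^ 2 * (1 + e * √q))
    (p : ℕ → Prop) [DecidablePred p]
    (hp : ∀ x ∈ Nat.primeFactors (1 + q + q ^ 2 + q ^ 3 + q ^ 4), p x) (hp0 : ¬ p 0)
    (y s A q₁ : ℕ) (r : ℝ) (hy : 0 < y) (hq₁ : q ≤ q₁)
    (hprod : 1 + q₁ + q₁ ^ 2 + q₁ ^ 3 + q₁ ^ 4 < y * ∏ x ∈ (Finset.range y).filter p, x)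
    (hs : ((Finset.range y).filter p).card ≤ s)
    (hA : ∑ x ∈ (Finset.range y).filter p, (10 ^ 9 / x + 1) ≤ A) (hA1 : A ≤ 10 ^ 9)
    (hr4 : 4 ≤ r) (hr : r ^ 2 ≤ q)
    (h0 : 0 ≤ (1 - A / 10 ^ 9) * (r - 4) - 2 * (s - 1) - 8 * e)
    (h : 8 < r * ((1 - A / 10 ^ 9) * (r - 4) - 2 * (s - 1) - 8 * e)) :
    ∃ α : F, IsGoodElement k Ω α := by
  have hP : ∀ x ∈ (Finset.range y).filter p, 0 < x ∧ x < y := by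
    intro x hx
    rw [Finset.mem_filter, Finset.mem_range] at hx
    refine ⟨Nat.pos_of_ne_zero ?_, hx.1⟩
    rintro rfl
    exact hp0 hx.2
  have hpos : 0 < 1 + q + q ^ 2 + q ^ 3 + q ^ 4 := by positivity
  obtain ⟨h1, h2⟩ := card_le_and_sum_inv_le_of_prod_lt (y := y)
    (S := Nat.primeFactors (1 + q + q ^ 2 + q ^ 3 + q ^ 4)) hP
    (fun x hx => ⟨(Nat.prime_of_mem_primeFactors hx).pos, fun hlt => Finset.mem_filter.mpr
      ⟨Finset.mem_range.mpr hlt, hp x hx⟩⟩) hy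
    (((Nat.le_of_dvd hpos (Nat.prod_primeFactors_dvd _)).trans (by gcongr)).trans_lt hprod)
  have h3 := sum_one_div_le_of_sum_div_add_one_le (N := 10 ^ 9) (by norm_num)
    (fun x hx => (hP x hx).1) hA
  have hA1' : (A : ℝ) ≤ 10 ^ 9 := by exact_mod_cast hA1
  exact exists_isGoodElement_five_of_le hdim hζ hqk hB (h1.trans hs)
    (h2.trans (h3.trans_eq (by norm_num)))
    (by rw [div_le_one (by norm_num)]; exact hA1') hr4 hr h0 h

open Classical in
theorem card_frobResolvent_eq_zero_le_five (hdim : Module.finrank k F = 5) {q : ℕ}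
    (hqk : Fintype.card k = q) (ρ : Ω) (hρ : ρ ^ 5 = 1) (hρ1 : ρ ≠ 1) :
    (((traceZeroPairs k F).filter fun α => frobResolvent (Fintype.card k) 5 ρ α = 0).card : ℝ) ≤
      q ^ 2 * (1 + 2 * √q) := by
  have hq1 : 1 < q := hqk ▸ Fintype.one_lt_card
  have hqR : (0 : ℝ) < q := by exact_mod_cast (by omega : 0 < q)
  refine (card_frobResolvent_eq_zero_le (by norm_num) hdim hρ hρ1).trans_eq ?_
  rw [card_eq_pow_of_finrank_eq hdim, hqk]
  push_cast
  rw [Real.sqrt_pow_five]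
  field_simp

open Classical in
theorem card_frobResolvent_eq_zero_le_five_of_mod_ne (hdim : Module.finrank k F = 5) {q : ℕ}
    (hqk : Fintype.card k = q) (hq5 : q % 5 ≠ 1) (hq0 : q % 5 ≠ 0) (ρ : Ω) (hρ : ρ ^ 5 = 1)
    (hρ1 : ρ ≠ 1) :
    (((traceZeroPairs k F).filter fun α => frobResolvent (Fintype.card k) 5 ρ α = 0).card : ℝ) ≤
      q ^ 2 * (1 + 0 * √q) := by
  have : Fact (Nat.Prime 5) := ⟨Nat.prime_five⟩
  have hord := orderOf_eq_prime (p := 5) hρ hρ1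
  have hρ0 : ρ ≠ 0 := by rintro rfl; simp at hρ
  rw [zero_mul, add_zero, mul_one, ← hqk]
  rw [← hqk] at hq5 hq0
  have hq1 : 1 < Fintype.card k := Fintype.one_lt_card
  have h1 := card_frobResolvent_eq_zero_le_of_pow_ne (by norm_num) hdim hρ hρ1
    (fun h => by
      have h2 : ρ ^ (Fintype.card k - 1) = 1 := by
        refine mul_right_cancel₀ hρ0 ?_
        rw [← pow_succ, Nat.sub_add_cancel hq1.le, h, one_mul]
      have h3 := orderOf_dvd_of_pow_eq_one h2
      rw [hord] at h3
      omega)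
    (fun h => by
      have h2 := orderOf_dvd_of_pow_eq_one h
      rw [hord] at h2
      omega)
  exact_mod_cast h1

open Classical in
theorem exists_isGoodElement_five_of_two_pow_le (hdim : Module.finrank k F = 5) {ζ : Ω}
    (hζ : IsPrimitiveRoot ζ 5) {q : ℕ} (hqk : Fintype.card k = q) (hq : 2 ^ 1450 ≤ q) :
    ∃ α : F, IsGoodElement k Ω α := by
  have hq1 : 1 < q := hqk ▸ Fintype.one_lt_card
  have hm := pow_sub_one_div_sub_one_eq_five hq1
  set S := Nat.primeFactors (1 + q + q ^ 2 + q ^ 3 + q ^ 4) with hS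
  have hqR : (0 : ℝ) < q := by exact_mod_cast (by omega : 0 < q)
  have hSq : 2 ^ (2 * S.card + 10) ≤ q := by
    by_contra! hlt
    have hs : 720 ≤ S.card := by
      by_contra! hs
      have := Nat.pow_le_pow_right (n := 2) (by norm_num) (show 2 * S.card + 10 ≤ 1450 by omega)
      omega
    have h1 := factorial_card_add_one_le_prod (S := S)
      (fun x hx => (Nat.prime_of_mem_primeFactors hx).two_le)
    have h2 : ∏ x ∈ S, x ≤ 1 + q + q ^ 2 + q ^ 3 + q ^ 4 :=
      Nat.le_of_dvd (by positivity) (Nat.prod_primeFactors_dvd _)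
    have h3 : 1 + q + q ^ 2 + q ^ 3 + q ^ 4 ≤ 2 * q ^ 4 := by
      have h4 : 2 * q ≤ q ^ 2 := by rw [pow_two]; exact Nat.mul_le_mul_right q hq1
      have h5 : 2 * q ^ 2 ≤ q ^ 3 := by rw [pow_succ' q 2]; exact Nat.mul_le_mul_right _ hq1
      have h6 : 2 * q ^ 3 ≤ q ^ 4 := by rw [pow_succ' q 3]; exact Nat.mul_le_mul_right _ hq1
      omega
    have h4 := two_pow_lt_factorial_of_le' hs
    have h5 := Nat.pow_le_pow_left hlt.le 4
    rw [← pow_mul] at h5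
    have h6 : 2 ^ (8 * S.card + 41) = 2 * 2 ^ ((2 * S.card + 10) * 4) := by
      rw [← pow_succ']; congr 1; ring
    omega
  refine exists_isGoodElement_of_sieve (by norm_num) hdim hζ
    (card_frobResolvent_eq_zero_le_five hdim hqk) S ∅ (Finset.disjoint_empty_right _)
    (by rw [Finset.union_empty, card_eq_pow_of_finrank_eq hdim, hqk, hm]) rfl (by simp) ?_
  rw [card_eq_pow_of_finrank_eq hdim, hqk]
  push_cast
  rw [Real.sqrt_pow_five, show (q : ℝ) ^ 5 / q ^ 2 = q ^ 3 by field_simp]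
  simp only [Finset.sum_empty, sub_zero, Finset.card_empty, Nat.cast_zero, zero_sub, one_mul,
    mul_one]
  set x := √(q : ℝ) with hx
  have hxq : x ^ 2 = q := Real.sq_sqrt hqR.le
  have hrx : 2 ^ (S.card + 5) ≤ x := by
    refine Real.le_sqrt_of_sq_le ?_
    rw [← pow_mul, show (S.card + 5) * 2 = 2 * S.card + 10 by ring]
    exact_mod_cast hSq
  have hθ : (1 / 2 : ℝ) ^ S.card ≤ ∏ p ∈ S, (1 - 1 / (p : ℝ)) := by
    rw [← Finset.prod_const]
    refine Finset.prod_le_prod (by norm_num) fun p hp => ?_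
    have : (2 : ℝ) ≤ p := by exact_mod_cast (Nat.prime_of_mem_primeFactors hp).two_le
    have := one_div_le_one_div_of_le (by norm_num) this
    linarith
  rw [← hxq]
  have hpos : (0 : ℝ) < 2 ^ S.card := by positivity
  have h1 : (1 : ℝ) ≤ 2 ^ S.card := one_le_pow₀ (by norm_num)
  rw [pow_add] at hrx
  have hin : (0 : ℝ) ≤ (x ^ 2) ^ 3 - 2 ^ S.card * (2 * ((x ^ 2) ^ 2 * x)) * (-1 + 2) := by
    have : 0 ≤ x ^ 5 * (x - 2 * 2 ^ S.card) :=
      mul_nonneg (by positivity) (by linarith)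
    linarith
  refine lt_of_lt_of_le ?_ (mul_le_mul_of_nonneg_right hθ hin)
  rw [one_div, inv_pow, ← div_eq_inv_mul, lt_div_iff₀ hpos]
  have h2 : 0 < x ^ 4 := by
    have : 0 < x := by linarith
    positivity
  have h3 : 8 * (1 + 2 * x) * 2 ^ S.card < x * (x - 2 * 2 ^ S.card) := by nlinarith
  have := mul_lt_mul_of_pos_left h3 h2
  linarith

end

section

variable {k F Ω : Type*} [Field k] [Fintype k] [Field F] [Fintype F] [Algebra k F]
  [Field Ω] [Algebra F Ω]

theorem exists_isGoodElement_five_of_large (hdim : Module.finrank k F = 5) {ζ : Ω}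
    (hζ : IsPrimitiveRoot ζ 5) {q : ℕ} (hqk : Fintype.card k = q) (hq : 2904 ≤ q) :
    ∃ α : F, IsGoodElement k Ω α := by
  classical
  have hB := card_frobResolvent_eq_zero_le_five (Ω := Ω) hdim hqk
  have hp : ∀ x ∈ Nat.primeFactors (1 + q + q ^ 2 + q ^ 3 + q ^ 4), IsFiveCandidate x := by
    intro x hx
    have hx' := Nat.prime_of_mem_primeFactors hx
    exact isFiveCandidate_of_prime hx'
      ((prime_dvd_one_add_pow_four hx' (Nat.dvd_of_mem_primeFactors hx)).imp_left And.left)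
  by_cases h₁ : 2 ^ 1450 ≤ q
  · exact exists_isGoodElement_five_of_two_pow_le hdim hζ hqk h₁
  by_cases h₂ : 8000000 ≤ q
  · have hqR : (8000000 : ℝ) ≤ q := by exact_mod_cast h₂
    exact exists_isGoodElement_five_of_tier hdim hζ hqk hB IsFiveCandidate hp (by decide)
      8792 497 628844093 (2 ^ 1450) 2828 (by norm_num) (by omega) (by decide +kernel)
      (by decide +kernel) (by decide +kernel) (by norm_num) (by norm_num) (by linarith)
      (by norm_num) (by norm_num)
  by_cases h₃ : 6000 ≤ q
  · have hqR : (6000 : ℝ) ≤ q := by exact_mod_cast h₃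
    exact exists_isGoodElement_five_of_tier hdim hζ hqk hB IsFiveCandidate hp (by decide)
      242 14 426366515 10000000 77.459 (by norm_num) (by omega) (by decide +kernel)
      (by decide +kernel) (by decide +kernel) (by norm_num) (by norm_num) (by linarith)
      (by norm_num) (by norm_num)
  by_cases h₄ : 3340 ≤ q
  · have hqR : (3340 : ℝ) ≤ q := by exact_mod_cast h₄
    exact exists_isGoodElement_five_of_tier hdim hζ hqk hB IsFiveCandidate hp (by decide)
      152 9 402192448 6100 57.792 (by norm_num) (by omega) (by decide +kernel)
      (by decide +kernel) (by decide +kernel) (by norm_num) (by norm_num) (by linarith)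
      (by norm_num) (by norm_num)
  have hqR : (2904 : ℝ) ≤ q := by exact_mod_cast hq
  exact exists_isGoodElement_five_of_tier hdim hζ hqk hB IsFiveCandidate hp (by decide)
    144 8 395569931 4900 53.888 (by norm_num) (by omega) (by decide +kernel)
    (by decide +kernel) (by decide +kernel) (by norm_num) (by norm_num) (by linarith)
    (by norm_num) (by norm_num)

theorem exists_isGoodElement_five_of_mod_ne (hdim : Module.finrank k F = 5) {ζ : Ω}
    (hζ : IsPrimitiveRoot ζ 5) {q : ℕ} (hqk : Fintype.card k = q) (hq5 : q % 5 ≠ 1)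
    (hq0 : q % 5 ≠ 0) (hq : 208 ≤ q) (hq' : q ≤ 278 ∨ 286 ≤ q) :
    ∃ α : F, IsGoodElement k Ω α := by
  classical
  have hB := card_frobResolvent_eq_zero_le_five_of_mod_ne (Ω := Ω) hdim hqk hq5 hq0
  have hp : ∀ x ∈ Nat.primeFactors (1 + q + q ^ 2 + q ^ 3 + q ^ 4), IsFiveCandidate x ∧ x ≠ 5 := by
    intro x hx
    have hx' := Nat.prime_of_mem_primeFactors hx
    have h1 := prime_dvd_one_add_pow_four hx' (Nat.dvd_of_mem_primeFactors hx)
    refine ⟨isFiveCandidate_of_prime hx' (h1.imp_left And.left), ?_⟩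
    omega
  by_cases h₁ : 2904 ≤ q
  · exact exists_isGoodElement_five_of_large hdim hζ hqk h₁
  by_cases h₂ : 378 ≤ q
  · have hqR : (378 : ℝ) ≤ q := by exact_mod_cast h₂
    exact exists_isGoodElement_five_of_tier hdim hζ hqk hB _ hp (by decide)
      132 7 195569930 3000 19.442 (by norm_num) (by omega) (by decide +kernel)
      (by decide +kernel) (by decide +kernel) (by norm_num) (by norm_num) (by linarith)
      (by norm_num) (by norm_num)
  by_cases h₃ : 286 ≤ q
  · have hqR : (286 : ℝ) ≤ q := by exact_mod_cast h₃
    exact exists_isGoodElement_five_of_tier hdim hζ hqk hB _ hp (by decide)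
      102 6 187936342 400 16.911 (by norm_num) (by omega) (by decide +kernel)
      (by decide +kernel) (by decide +kernel) (by norm_num) (by norm_num) (by linarith)
      (by norm_num) (by norm_num)
  have hqR : (208 : ℝ) ≤ q := by exact_mod_cast hq
  exact exists_isGoodElement_five_of_tier hdim hζ hqk hB _ hp (by decide)
    99 5 178035351 278 14.422 (by norm_num) (by omega) (by decide +kernel)
    (by decide +kernel) (by decide +kernel) (by norm_num) (by norm_num) (by linarith)
    (by norm_num) (by norm_num)

theorem exists_isGoodElement_six_of_two_pow_le (hdim : Module.finrank k F = 6) {ζ : Ω}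
    (hζ : IsPrimitiveRoot ζ 6) {q : ℕ} (hqk : Fintype.card k = q) (hq : 2 ^ 106 ≤ q) :
    ∃ α : F, IsGoodElement k Ω α := by
  have hq1 : 1 < q := hqk ▸ Fintype.one_lt_card
  set S := Nat.primeFactors (1 + q + q ^ 2 + q ^ 3 + q ^ 4 + q ^ 5) with hS
  have hSq : 2 ^ (S.card + 6) ≤ q := by
    by_contra! hlt
    have hs : 100 ≤ S.card := by
      by_contra! hs
      have := Nat.pow_le_pow_right (n := 2) (by norm_num) (show S.card + 6 ≤ 106 by omega)
      omega
    have h1 := factorial_card_add_one_le_prod (S := S)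
      (fun x hx => (Nat.prime_of_mem_primeFactors hx).two_le)
    have h2 : ∏ x ∈ S, x ≤ 1 + q + q ^ 2 + q ^ 3 + q ^ 4 + q ^ 5 :=
      Nat.le_of_dvd (by positivity) (Nat.prod_primeFactors_dvd _)
    have h3 : 1 + q + q ^ 2 + q ^ 3 + q ^ 4 + q ^ 5 ≤ 2 * q ^ 5 := by
      have h4 : 2 * q ≤ q ^ 2 := by rw [pow_two]; exact Nat.mul_le_mul_right q hq1
      have h5 : 2 * q ^ 2 ≤ q ^ 3 := by rw [pow_succ' q 2]; exact Nat.mul_le_mul_right _ hq1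
      have h6 : 2 * q ^ 3 ≤ q ^ 4 := by rw [pow_succ' q 3]; exact Nat.mul_le_mul_right _ hq1
      have h7 : 2 * q ^ 4 ≤ q ^ 5 := by rw [pow_succ' q 4]; exact Nat.mul_le_mul_right _ hq1
      omega
    have h4 := two_pow_lt_factorial_of_le hs
    have h5 := Nat.pow_le_pow_left hlt.le 5
    rw [← pow_mul] at h5
    have h6 : 2 ^ (5 * S.card + 31) = 2 * 2 ^ ((S.card + 6) * 5) := by
      rw [← pow_succ']; congr 1; ring
    omega
  have hθ : (1 / 2 : ℝ) ^ S.card ≤ ∏ p ∈ S, (1 - 1 / (p : ℝ)) := by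
    rw [← Finset.prod_const]
    refine Finset.prod_le_prod (by norm_num) fun p hp => ?_
    have : (2 : ℝ) ≤ p := by exact_mod_cast (Nat.prime_of_mem_primeFactors hp).two_le
    have := one_div_le_one_div_of_le (by norm_num) this
    linarith
  refine exists_isGoodElement_six_of_le hdim hζ hqk S (fun p hp => Nat.prime_of_mem_primeFactors hp)
    (s := 0) (σ := 0) (r := 2 ^ (S.card + 6)) (θ := (1 / 2) ^ S.card) ?_ ?_ (by norm_num) ?_ ?_
    (by positivity) hθ ?_
  · rw [← hS, Finset.sdiff_self, Finset.card_empty]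
  · rw [← hS, Finset.sdiff_self, Finset.sum_empty]
  · exact pow_le_pow_right₀ (by norm_num) (by omega)
  · exact_mod_cast hSq
  · have : (1 / 2 : ℝ) ^ S.card * 2 ^ S.card = 1 := by rw [← mul_pow]; norm_num
    rw [pow_add, pow_add, pow_add]
    push_cast
    linarith

theorem exists_isGoodElement_six_of_tier (hdim : Module.finrank k F = 6) {ζ : Ω}
    (hζ : IsPrimitiveRoot ζ 6) {q : ℕ} (hqk : Fintype.card k = q) (hq6 : Nat.gcd q 6 = 1)
    (core : Finset ℕ) (hcore : ∀ p ∈ core, p.Prime) (h23 : 2 ∈ core ∧ 3 ∈ core)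
    (c : ℕ) (hc : ∏ p ∈ core, p = c)
    (y s A q₁ : ℕ) (θ r : ℝ) (hy : 0 < y) (hq₁ : q ≤ q₁)
    (hprod : 1 + q₁ + q₁ ^ 2 + q₁ ^ 3 + q₁ ^ 4 + q₁ ^ 5 <
      6 * (y * ∏ x ∈ (Finset.range y).filter (fun x => 1 < x ∧ Nat.gcd x c = 1), x))
    (hs : ((Finset.range y).filter (fun x => 1 < x ∧ Nat.gcd x c = 1)).card ≤ s)
    (hA : ∑ x ∈ (Finset.range y).filter (fun x => 1 < x ∧ Nat.gcd x c = 1), (10 ^ 9 / x + 1) ≤ A)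
    (hA1 : A ≤ 10 ^ 9) (hr4 : 2 ^ (core.card + 2) ≤ r) (hr : r ≤ q)
    (hθ0 : 0 < θ) (hθ : θ ≤ ∏ p ∈ core, (1 - 1 / (p : ℝ)))
    (h : 30 < θ * ((1 - A / 10 ^ 9) * (r - 2 ^ (core.card + 2)) - 2 ^ (core.card + 1) * (s - 1))) :
    ∃ α : F, IsGoodElement k Ω α := by
  set P := (Finset.range y).filter (fun x => 1 < x ∧ Nat.gcd x c = 1) with hPdef
  set S := Nat.primeFactors (1 + q + q ^ 2 + q ^ 3 + q ^ 4 + q ^ 5) with hS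
  have hpos : 0 < 1 + q + q ^ 2 + q ^ 3 + q ^ 4 + q ^ 5 := by positivity
  have hP : ∀ x ∈ P, 0 < x ∧ x < y := by
    intro x hx
    rw [hPdef, Finset.mem_filter, Finset.mem_range] at hx
    exact ⟨by omega, hx.1⟩
  have hS2 : ∀ x ∈ S \ core, 0 < x ∧ (x < y → x ∈ P) := by
    intro x hx
    rw [Finset.mem_sdiff] at hx
    have hxp := Nat.prime_of_mem_primeFactors hx.1
    refine ⟨hxp.pos, fun hlt => ?_⟩
    rw [hPdef, Finset.mem_filter, Finset.mem_range]
    refine ⟨hlt, hxp.one_lt, ?_⟩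
    rw [← hc]
    refine Nat.Coprime.prod_right fun p hp => (Nat.coprime_primes hxp (hcore p hp)).mpr ?_
    rintro rfl
    exact hx.2 hp
  have hfac : 1 + q + q ^ 2 + q ^ 3 + q ^ 4 + q ^ 5 = (1 + q) * (1 + q + q ^ 2) *
    (1 + q ^ 2 - q) := by
    have : q ≤ q ^ 2 := by nlinarith [Nat.zero_le q]
    zify [show q ≤ 1 + q ^ 2 by omega]
    ring
  have h2 : 2 ∈ S := by
    refine Nat.mem_primeFactors.mpr ⟨Nat.prime_two, ?_, hpos.ne'⟩
    have : q % 2 = 1 := by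
      by_contra hne
      have : 2 ∣ Nat.gcd q 6 := Nat.dvd_gcd (by omega) (by norm_num)
      rw [hq6] at this
      omega
    rw [hfac]
    exact Dvd.dvd.mul_right (Dvd.dvd.mul_right (by omega) _) _
  have h3 : 3 ∈ S := by
    refine Nat.mem_primeFactors.mpr ⟨Nat.prime_three, ?_, hpos.ne'⟩
    have : q % 3 ≠ 0 := by
      intro h0
      have : 3 ∣ Nat.gcd q 6 := Nat.dvd_gcd (by omega) (by norm_num)
      rw [hq6] at this
      omega
    rw [hfac]
    rcases (by omega : q % 3 = 1 ∨ q % 3 = 2) with h | h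
    · refine Dvd.dvd.mul_right (Dvd.dvd.mul_left ?_ _) _
      have h1 : q ^ 2 % 3 = 1 := by rw [Nat.pow_mod, h]
      omega
    · exact Dvd.dvd.mul_right (Dvd.dvd.mul_right (by omega) _) _
  have h6 : 6 * ∏ x ∈ S \ core, x ≤ 1 + q + q ^ 2 + q ^ 3 + q ^ 4 + q ^ 5 := by
    have hsub : ({2, 3} : Finset ℕ) ⊆ S ∩ core := by
      intro x hx
      rw [Finset.mem_insert, Finset.mem_singleton] at hx
      rcases hx with rfl | rfl
      · exact Finset.mem_inter.mpr ⟨h2, h23.1⟩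
      · exact Finset.mem_inter.mpr ⟨h3, h23.2⟩
    have h7 : ∏ x ∈ ({2, 3} : Finset ℕ), x ≤ ∏ x ∈ S ∩ core, x :=
      Finset.prod_le_prod_of_subset_of_one_le' hsub fun x hx _ =>
        (Nat.prime_of_mem_primeFactors (Finset.mem_inter.mp hx).1).one_lt.le
    calc 6 * ∏ x ∈ S \ core, x ≤ (∏ x ∈ S ∩ core, x) * ∏ x ∈ S \ core, x :=
          Nat.mul_le_mul_right _ (by simpa using h7)
      _ = ∏ x ∈ S, x := Finset.prod_inter_mul_prod_sdiff _ _ _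
      _ ≤ _ := Nat.le_of_dvd hpos (Nat.prod_primeFactors_dvd _)
  have hm : 1 + q + q ^ 2 + q ^ 3 + q ^ 4 + q ^ 5 ≤ 1 + q₁ + q₁ ^ 2 + q₁ ^ 3 + q₁ ^ 4 + q₁ ^ 5 := by
    gcongr
  obtain ⟨h7, h8⟩ := card_le_and_sum_inv_le_of_prod_lt (y := y) (S := S \ core) hP hS2 hy (by omega)
  have h9 := sum_one_div_le_of_sum_div_add_one_le (N := 10 ^ 9) (by norm_num)
    (fun x hx => (hP x hx).1) hA
  have hA1' : (A : ℝ) ≤ 10 ^ 9 := by exact_mod_cast hA1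
  exact exists_isGoodElement_six_of_le hdim hζ hqk core hcore (h7.trans hs)
    (h8.trans (h9.trans_eq (by norm_num))) (by
        rw [div_le_one (by norm_num)]; exact hA1') hr4 hr hθ0 hθ h

theorem exists_isGoodElement_six_of_large (hdim : Module.finrank k F = 6) {ζ : Ω}
    (hζ : IsPrimitiveRoot ζ 6) {q : ℕ} (hqk : Fintype.card k = q) (hq6 : Nat.gcd q 6 = 1)
    (hq : 650 ≤ q) : ∃ α : F, IsGoodElement k Ω α := by
  have hc1 : ∀ p ∈ ({2, 3, 5} : Finset ℕ), p.Prime := by simp; norm_num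
  have hc2 : ∀ p ∈ ({2, 3, 5, 7} : Finset ℕ), p.Prime := by simp; norm_num
  by_cases h₁ : 2 ^ 106 ≤ q
  · exact exists_isGoodElement_six_of_two_pow_le hdim hζ hqk h₁
  by_cases h₂ : 27700 ≤ q
  · exact exists_isGoodElement_six_of_tier hdim hζ hqk hq6 {2, 3, 5, 7} hc2 (by simp) 210
      (by norm_num)
      332 75 909376752 (2 ^ 106) (8 / 35) 27700 (by norm_num) (by omega) (by decide +kernel)
      (by decide +kernel) (by decide +kernel) (by norm_num) (by norm_num)
      (by exact_mod_cast h₂) (by norm_num) (by norm_num) (by norm_num)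
  by_cases h₃ : 1100 ≤ q
  · exact exists_isGoodElement_six_of_tier hdim hζ hqk hq6 {2, 3, 5} hc1 (by simp) 30 (by norm_num)
      60 15 684538429 50000 (4 / 15) 1100 (by norm_num) (by omega) (by decide +kernel)
      (by decide +kernel) (by decide +kernel) (by norm_num) (by norm_num)
      (by exact_mod_cast h₃) (by norm_num) (by norm_num) (by norm_num)
  by_cases h₄ : 730 ≤ q
  · exact exists_isGoodElement_six_of_tier hdim hζ hqk hq6 {2, 3, 5} hc1 (by simp) 30 (by norm_num)
      44 11 607036591 2000 (4 / 15) 730 (by norm_num) (by omega) (by decide +kernel)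
      (by decide +kernel) (by decide +kernel) (by norm_num) (by norm_num)
      (by exact_mod_cast h₄) (by norm_num) (by norm_num) (by norm_num)
  exact exists_isGoodElement_six_of_tier hdim hζ hqk hq6 {2, 3, 5} hc1 (by simp) 30 (by norm_num)
    42 10 583780777 1000 (4 / 15) 650 (by norm_num) (by omega) (by decide +kernel)
    (by decide +kernel) (by decide +kernel) (by norm_num) (by norm_num)
    (by exact_mod_cast hq) (by norm_num) (by norm_num) (by norm_num)

end

/-! ### Arithmetic in finite fields by kernel reduction

Elements of `F_p[x] / (g)` are represented by natural numbers: a polynomial with small natural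
coefficients is packed as its value at a large radix `r`. -/

/-- The value `f v`; the case distinction makes kernel reduction evaluate `v` first. -/
def natForce {β : Type} (v : ℕ) (f : ℕ → β) : β :=
  Nat.rec (f 0) (fun m _ => f (Nat.succ m)) v

/-- Replace each coefficient `c` of `x ^ i` in the packed polynomial `v` by `c % p` times the `i`-th
entry of the table. -/
def laneReduce (r p : ℕ) (ts : List ℕ) : ℕ → ℕ :=
  List.rec (fun _ => 0) (fun t _ ih v => natForce v fun v =>
    Nat.add (Nat.mul (Nat.mod (Nat.mod v r) p) t) (ih (Nat.div v r))) ts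

/-- Exponentiation by repeated squaring. -/
def binPow (mul : ℕ → ℕ → ℕ) (u e : ℕ) : ℕ :=
  Nat.rec (fun _ => 1) (fun _ ih e => cond (Nat.beq e 0) 1
    (natForce (ih (Nat.div e 2)) fun h =>
      cond (Nat.beq (Nat.mod e 2) 0) (mul h h) (mul (mul h h) u))) e e

/-- Pass `[t, step t, step (step t), …]`, of length `len` and followed by `tail`, to `f`. -/
def withIterates {β : Type} (step : ℕ → ℕ) (tail : List ℕ) (len : ℕ) : ℕ → (List ℕ → β) → β :=
  Nat.rec (fun _ f => f tail)
    (fun _ ih t f => natForce t fun t => ih (step t) fun l => f (t :: l)) len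

/-- The packed polynomial with the given coefficients modulo `p`. -/
def packList (r p : ℕ) : List ℕ → ℕ :=
  List.rec 0 (fun c _ ih => c % p + r * ih)

/-- The product of a list of representatives. -/
def prodList (mul : ℕ → ℕ → ℕ) : List ℕ → ℕ :=
  List.rec 1 (fun c _ ih => mul c ih)

/-- The sum of a list of representatives. -/
def sumList (add : ℕ → ℕ → ℕ) : List ℕ → ℕ :=
  List.rec 0 (fun c _ ih => add c ih)

/-- The natural number with the given digits in base `q`. -/
def evalDigits (q : ℕ) : List ℕ → ℕ :=
  List.rec 0 (fun c _ ih => c + q * ih)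

/-- The power of `a` whose exponent has the given digits in base `q`, where `frob` raises to the
power `q`. -/
def digitsPow (mul : ℕ → ℕ → ℕ) (frob : ℕ → ℕ) (es : List ℕ) : ℕ → ℕ :=
  List.rec (fun _ => 1)
    (fun e _ ih a => natForce a fun a => mul (binPow mul a e) (ih (frob a))) es

/-- The product of the four nontrivial resolvents of five conjugates. -/
def resolventFive (mul add sub : ℕ → ℕ → ℕ) (as : List ℕ) : ℕ :=
  match as with
  | [a, b, c, d, e] =>
    natForce (add (mul a a) (add (mul b b) (add (mul c c) (add (mul d d) (mul e e))))) fun s =>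
    natForce (add (mul a b) (add (mul b c) (add (mul c d) (add (mul d e) (mul e a))))) fun t =>
    natForce (add (mul a c) (add (mul b d) (add (mul c e) (add (mul d a) (mul e b))))) fun u =>
    natForce (mul t u) fun w =>
    sub (add (mul s s) (add w (add w w))) (add (mul s (add t u)) (add (mul t t) (mul u u)))
  | _ => 0

/-- The product of the five nontrivial resolvents of six conjugates. -/
def resolventSix (mul add sub : ℕ → ℕ → ℕ) (as : List ℕ) : ℕ :=
  match as with
  | [a, b, c, d, e, f] =>
    natForce (add (mul a a) (add (mul b b) (add (mul c c) (add (mul d d) (add (mul e e)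
      (mul f f)))))) fun s =>
    natForce (add (mul a b) (add (mul b c) (add (mul c d) (add (mul d e) (add (mul e f)
      (mul f a)))))) fun t =>
    natForce (add (mul a c) (add (mul b d) (add (mul c e) (add (mul d f) (add (mul e a)
      (mul f b)))))) fun u =>
    natForce (add (mul a d) (add (mul b e) (mul c f))) fun v =>
    mul (sub (add a (add c e)) (add b (add d f)))
      (mul (sub (add s t) (add u (add v v))) (sub (add s (add v v)) (add t u)))
  | _ => 0

/-- The inverse of `y`, computed from its conjugates. -/
def conjInv (mul : ℕ → ℕ → ℕ) (frob : ℕ → ℕ) (q n y : ℕ) : ℕ :=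
  withIterates frob [] (n - 1) (frob y) fun l =>
    natForce (prodList mul l) fun c => mul c (binPow mul (mul c y) (q - 2))

/-- The product of `u ^ q - u` over the powers `u = x ^ (m / l)`, where `m / l` is split into a part
with given digits in base `q` and a rest. -/
def orderProd (mul sub : ℕ → ℕ → ℕ) (frob : ℕ → ℕ) (q m x : ℕ)
    (gs : List (List ℕ × List ℕ)) : ℕ :=
  prodList mul (gs.map fun gr =>
    natForce (digitsPow mul frob gr.1 x) fun z =>
    natForce (m / evalDigits q gr.1) fun m' =>
    prodList mul (gr.2.map fun l =>
      natForce (binPow mul z (m' / l)) fun u => sub (frob u) u))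

/-- The arithmetic conditions on a good element `x`, phrased with representatives. -/
def conjCheck (res : (ℕ → ℕ → ℕ) → (ℕ → ℕ → ℕ) → (ℕ → ℕ → ℕ) → List ℕ → ℕ)
    (mul add sub : ℕ → ℕ → ℕ) (frob norm : ℕ → ℕ) (q n x : ℕ)
    (gs : List (List ℕ × List ℕ)) : Bool :=
  withIterates frob [] n x fun as =>
  natForce (conjInv mul frob q n x) fun b =>
  withIterates frob [] n b fun bs =>
  natForce (mul (orderProd mul sub frob q ((q ^ n - 1) / (q - 1)) x gs)
    (mul (res mul add sub as) (res mul add sub bs))) fun y =>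
  (Nat.beq (norm (Nat.rec x (fun _ ih => natForce ih frob) n)) x).and <|
  (Nat.beq (norm (sumList add as)) 0).and <|
  (Nat.beq (norm (sumList add bs)) 0).and <|
  (Nat.beq (norm (mul x b)) 1).and <|
  Nat.beq (norm (mul y (conjInv mul frob q n y))) 1

/-- A bound for the coefficients of packed polynomials. -/
def laneBound (p D : ℕ) : ℕ := 2 * D * (p * ((D + 1) * (p * p)))

/-- A radix that leaves room for one multiplication or addition without carries. -/
def laneRadix (p D : ℕ) : ℕ := 2 * D * p * (laneBound p D * laneBound p D) + 1

/-- `conjCheck` for the class of `x` in `F_p[x] / (x ^ D - c)`. -/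
def fieldCheck (res : (ℕ → ℕ → ℕ) → (ℕ → ℕ → ℕ) → (ℕ → ℕ → ℕ) → List ℕ → ℕ)
    (p q n r D c : ℕ) (gs : List (List ℕ × List ℕ)) : Bool :=
  withIterates (fun v => r * v) [c] D 1 fun base =>
  withIterates (fun v => laneReduce r p base (r * v)) [] (2 * D) 1 fun T =>
  natForce (binPow (fun u v => laneReduce r p T (u * v)) r q) fun φ =>
  withIterates (fun v => laneReduce r p base (laneReduce r p T (v * φ))) [] D 1 fun Φ =>
  conjCheck res (fun u v => laneReduce r p T (u * v)) (fun u v => laneReduce r p base (u + v))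
    (fun u v => laneReduce r p base (u + (p - 1) * v)) (laneReduce r p Φ) (laneReduce r p base)
    q n r gs

/-- Whether the class of `x` in `F_p[x] / (x ^ D - c)` has `m`-th power `1`. -/
def lanePowCheck (p r D c m : ℕ) : Bool :=
  withIterates (fun v => r * v) [c] D 1 fun base =>
  withIterates (fun v => laneReduce r p base (r * v)) [] (2 * D) 1 fun T =>
  natForce (binPow (fun u v => laneReduce r p T (u * v)) r m) fun v =>
  Nat.beq (laneReduce r p base v) 1

/-- Trial division for numbers below `54 ^ 2`. -/
def smallPrime (p : ℕ) : Bool :=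
  (Nat.ble 2 p).and <| (Nat.blt p 2916).and <|
    [2, 3, 5, 7, 11, 13, 17, 19, 23, 29, 31, 37, 41, 43, 47, 53].all fun d =>
      (Nat.beq p d).or (Nat.blt 0 (p % d))

/-- Primality of the goals, using a list of entries `(l, a, fs)` where `fs` are the prime factors of
`l - 1` and `a` is a primitive root modulo `l`. -/
def prattCheck (goals : List ℕ) (certs : List (ℕ × ℕ × List ℕ)) : List ℕ → Bool :=
  List.rec (fun known => goals.all fun l => (smallPrime l).or (known.elem l))
    (fun c _ ih known =>
      (c.2.2.all fun l => (smallPrime l).or (known.elem l)).and <|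
      (Nat.ble 2 c.1).and <|
      (Nat.beq (c.2.2.prod ^ 64 % (c.1 - 1)) 0).and <|
      (Nat.beq (binPow (fun u v => u * v % c.1) c.2.1 (c.1 - 1)) 1).and <|
      (c.2.2.all fun l =>
        (Nat.beq (binPow (fun u v => u * v % c.1) c.2.1 ((c.1 - 1) / l) % c.1) 1).not).and <|
      ih (c.1 :: known)) certs

/-- The prime factors of `(q ^ n - 1) / (q - 1)` are the listed ones. -/
def factorCheck (q n : ℕ) (gs : List (List ℕ × List ℕ)) (certs : List (ℕ × ℕ × List ℕ)) : Bool :=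
  natForce ((q ^ n - 1) / (q - 1)) fun m =>
  (Nat.beq ((gs.flatMap fun gr => gr.2).prod ^ 64 % m) 0).and <|
  (gs.all fun gr => gr.2.all fun l =>
    Nat.beq (evalDigits q gr.1 * (m / evalDigits q gr.1 / l) * l) m).and <|
  prattCheck (gs.flatMap fun gr => gr.2) certs []

/-- Data defining a good element of `F_{q^n}` over `F_q`, `q = p ^ k`: the coefficients of
`x ^ D` modulo its minimal polynomial over `F_p`, and the factorization of `(q ^ n - 1) / (q - 1)`
with certificates. -/
structure FieldWitness where
  p : ℕ
  k : ℕ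
  coeffs : List ℕ
  factors : List (List ℕ)
  certs : List (ℕ × ℕ × List ℕ)

/-- The conditions on a witness. -/
def witnessCheck (res : (ℕ → ℕ → ℕ) → (ℕ → ℕ → ℕ) → (ℕ → ℕ → ℕ) → List ℕ → ℕ) (n : ℕ)
    (digits : List (List ℕ)) (w : FieldWitness) : Bool :=
  natForce (w.p ^ w.k) fun q =>
  natForce w.coeffs.length fun D =>
  natForce (laneRadix w.p D) fun r =>
  natForce (packList r w.p w.coeffs) fun c =>
  (smallPrime w.p).and <| (Nat.blt 1 D).and <|
  (factorCheck q n (digits.zip w.factors) w.certs).and <|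
  fieldCheck res w.p q n r D c (digits.zip w.factors)

@[simp] theorem natForce_eq {β : Type} (v : ℕ) (f : ℕ → β) : natForce v f = f v := by
  cases v <;> rfl

@[simp] theorem withIterates_eq {β : Type} (step : ℕ → ℕ) (tail : List ℕ) (len t : ℕ)
    (f : List ℕ → β) :
    withIterates step tail len t f = f (List.iterate step t len ++ tail) := by
  induction len generalizing t f with
  | zero => rfl
  | succ m ih =>
    have : withIterates step tail (m + 1) t f =
        natForce t fun t => withIterates step tail m (step t) fun l => f (t :: l) := rfl
    rw [this, natForce_eq, ih]
    rfl

theorem binPow_rel {M : Type*} [Monoid M] {S : ℕ → M → Prop} {mul : ℕ → ℕ → ℕ} (h1 : S 1 1)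
    (hmul : ∀ {u v a b}, S u a → S v b → S (mul u v) (a * b)) {u : ℕ} {a : M} (hu : S u a)
    (e : ℕ) : S (binPow mul u e) (a ^ e) := by
  have key : ∀ fuel e : ℕ, e ≤ fuel → S (Nat.rec (motive := fun _ => ℕ → ℕ) (fun _ => 1)
      (fun _ ih e => cond (Nat.beq e 0) 1 (natForce (ih (Nat.div e 2)) fun h =>
        cond (Nat.beq (Nat.mod e 2) 0) (mul h h) (mul (mul h h) u))) fuel e) (a ^ e) := by
    intro fuel
    induction fuel with
    | zero =>
      intro e he
      obtain rfl : e = 0 := by omega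
      simpa using h1
    | succ m ih =>
      intro e he
      rcases Nat.eq_zero_or_pos e with rfl | hpos
      · simpa using h1
      have hb : Nat.beq e 0 = false := by
        cases e with
        | zero => omega
        | succ j => rfl
      have hrec := ih (e / 2) (by omega)
      simp only [natForce_eq] at hrec ⊢
      simp only [hb, cond_false]
      rcases Nat.mod_two_eq_zero_or_one e with h | h
      · have h2 : Nat.beq (Nat.mod e 2) 0 = true := by
          rw [show Nat.mod e 2 = 0 from h]; rfl
        rw [h2, cond_true]
        have he2 : e = e / 2 + e / 2 := by omega
        rw [show a ^ e = a ^ (e / 2) * a ^ (e / 2) by rw [← pow_add, ← he2]]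
        exact hmul hrec hrec
      · have h2 : Nat.beq (Nat.mod e 2) 0 = false := by
          rw [show Nat.mod e 2 = 1 from h]; rfl
        rw [h2, cond_false]
        have he2 : e = e / 2 + e / 2 + 1 := by omega
        rw [show a ^ e = a ^ (e / 2) * a ^ (e / 2) * a by rw [← pow_add, ← pow_succ, ← he2]]
        exact hmul (hmul hrec hrec) hu
  exact key e e le_rfl

/-! ### Primality certificates -/

theorem prime_of_smallPrime {p : ℕ} (h : smallPrime p = true) : p.Prime := by
  simp only [smallPrime, Bool.and_eq_true, Nat.ble_eq, Nat.blt_eq, List.all_eq_true,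
    Bool.or_eq_true, Nat.beq_eq] at h
  obtain ⟨h2, hlt, hall⟩ := h
  by_contra hp
  have hmin : p.minFac.Prime := Nat.minFac_prime (by omega)
  have hsq : p.minFac ^ 2 ≤ p := Nat.minFac_sq_le_self (by omega) hp
  have hlt' : p.minFac < 54 := by nlinarith
  have hmem : ∀ d < 54, d.Prime →
      d ∈ [2, 3, 5, 7, 11, 13, 17, 19, 23, 29, 31, 37, 41, 43, 47, 53] := by decide
  rcases hall _ (hmem _ hlt' hmin) with h | h
  · exact hp (h ▸ hmin)
  · exact h.ne' (Nat.mod_eq_zero_of_dvd p.minFac_dvd)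

theorem mem_of_prime_dvd_of_prod_pow_mod {m j l : ℕ} {fs : List ℕ} (hfs : ∀ f ∈ fs, f.Prime)
    (hmod : fs.prod ^ j % m = 0) (hl : l.Prime) (hlm : l ∣ m) : l ∈ fs := by
  have h1 : l ∣ fs.prod := hl.dvd_of_dvd_pow (hlm.trans (Nat.dvd_of_mod_eq_zero hmod))
  obtain ⟨f, hf, hlf⟩ := (Nat.Prime.prime hl).dvd_prod_iff.1 h1
  rwa [(Nat.prime_dvd_prime_iff_eq hl (hfs f hf)).1 hlf]

theorem binPow_mod_cast (p a e : ℕ) :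
    ((binPow (fun u v => u * v % p) a e : ℕ) : ZMod p) = (a : ZMod p) ^ e :=
  binPow_rel (S := fun u (x : ZMod p) => (u : ZMod p) = x) (by simp)
    (by rintro u v a b rfl rfl; simp) rfl e

theorem prime_of_prattCheck {goals : List ℕ} {certs : List (ℕ × ℕ × List ℕ)} {known : List ℕ}
    (hknown : ∀ l ∈ known, l.Prime) (h : prattCheck goals certs known = true) :
    ∀ l ∈ goals, l.Prime := by
  have hok : ∀ {known : List ℕ}, (∀ l ∈ known, l.Prime) → ∀ l : ℕ,
      (smallPrime l = true ∨ known.elem l = true) → l.Prime := by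
    rintro known hknown l (h | h)
    · exact prime_of_smallPrime h
    · exact hknown l (by simpa using h)
  induction certs generalizing known with
  | nil =>
    simp only [prattCheck, List.all_eq_true, Bool.or_eq_true] at h
    exact fun l hl => hok hknown l (h l hl)
  | cons c rest ih =>
    have hstep : prattCheck goals (c :: rest) known =
      (c.2.2.all fun l => (smallPrime l).or (known.elem l)).and
      ((Nat.ble 2 c.1).and
      ((Nat.beq (c.2.2.prod ^ 64 % (c.1 - 1)) 0).and
      ((Nat.beq (binPow (fun u v => u * v % c.1) c.2.1 (c.1 - 1)) 1).and
      ((c.2.2.all fun l =>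
        (Nat.beq (binPow (fun u v => u * v % c.1) c.2.1 ((c.1 - 1) / l) % c.1) 1).not).and
      (prattCheck goals rest (c.1 :: known)))))) := rfl
    simp only [hstep, Bool.and_eq_true, List.all_eq_true, Bool.or_eq_true, Nat.ble_eq,
      Nat.beq_eq, Bool.not_eq_true', ← Bool.not_eq_true] at h
    obtain ⟨hfs, h2, hprod, hpow, hne, hrest⟩ := h
    refine ih (fun l hl => ?_) hrest
    rcases List.mem_cons.1 hl with rfl | hl
    · refine lucas_primality c.1 (c.2.1 : ZMod c.1) ?_ fun l hl hdvd h1 => ?_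
      · rw [← binPow_mod_cast, hpow, Nat.cast_one]
      · refine hne l (mem_of_prime_dvd_of_prod_pow_mod (fun f hf => hok hknown f (hfs f hf))
          hprod hl hdvd) ?_
        rw [← binPow_mod_cast, ← Nat.cast_one (R := ZMod c.1), ZMod.natCast_eq_natCast_iff'] at h1
        rw [h1, Nat.mod_eq_of_lt h2]
    · exact hknown l hl

theorem evalDigits_cons (q c : ℕ) (l : List ℕ) :
    evalDigits q (c :: l) = c + q * evalDigits q l := rfl

theorem factorCheck_spec {q n : ℕ} {gs : List (List ℕ × List ℕ)}
    {certs : List (ℕ × ℕ × List ℕ)} (h : factorCheck q n gs certs = true) {l : ℕ} (hl : l.Prime)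
    (hdvd : l ∣ (q ^ n - 1) / (q - 1)) :
    ∃ gr ∈ gs, l ∈ gr.2 ∧
      evalDigits q gr.1 * ((q ^ n - 1) / (q - 1) / evalDigits q gr.1 / l) * l =
        (q ^ n - 1) / (q - 1) := by
  simp only [factorCheck, natForce_eq, Bool.and_eq_true, List.all_eq_true, Nat.beq_eq] at h
  obtain ⟨hprod, hmul, hpratt⟩ := h
  have hprimes := prime_of_prattCheck (by simp) hpratt
  have := mem_of_prime_dvd_of_prod_pow_mod hprimes hprod hl hdvd
  obtain ⟨gr, hgr, hlg⟩ := List.mem_flatMap.1 this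
  exact ⟨gr, hgr, hlg, hmul gr hgr l hlg⟩

/-- Operations on natural numbers that compute in a commutative ring via the relation `S`, read
"`v` represents `a`"; `frob` represents the `q`-th power. -/
structure RepresentsRing {R : Type*} [CommRing R] (S : ℕ → R → Prop) (mul add sub : ℕ → ℕ → ℕ)
    (frob norm : ℕ → ℕ) (q : ℕ) : Prop where
  zero : S 0 0
  one : S 1 1
  mul : ∀ {u v a b}, S u a → S v b → S (mul u v) (a * b)
  add : ∀ {u v a b}, S u a → S v b → S (add u v) (a + b)
  sub : ∀ {u v a b}, S u a → S v b → S (sub u v) (a - b)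
  frob : ∀ {u a}, S u a → S (frob u) (a ^ q)
  norm : ∀ {u a}, S u a → S (norm u) a
  inj : ∀ {u a b}, S u a → S u b → a = b

theorem forall₂_iterate {R : Type*} {S : ℕ → R → Prop} {f : ℕ → ℕ} {g : R → R}
    (h : ∀ {u a}, S u a → S (f u) (g a)) (n : ℕ) {u : ℕ} {a : R} (hu : S u a) :
    List.Forall₂ S (List.iterate f u n) (List.iterate g a n) := by
  induction n generalizing u a with
  | zero => exact List.Forall₂.nil
  | succ m ih => exact List.Forall₂.cons hu (ih (h hu))

/-- The product of the resolvents attached to the nontrivial fifth roots of unity. -/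
def resolventProdFive {R : Type*} [CommRing R] (f : ℕ → R) : R :=
  let s := f 0 * f 0 + (f 1 * f 1 + (f 2 * f 2 + (f 3 * f 3 + f 4 * f 4)))
  let t := f 0 * f 1 + (f 1 * f 2 + (f 2 * f 3 + (f 3 * f 4 + f 4 * f 0)))
  let u := f 0 * f 2 + (f 1 * f 3 + (f 2 * f 4 + (f 3 * f 0 + f 4 * f 1)))
  s * s + (t * u + (t * u + t * u)) - (s * (t + u) + (t * t + u * u))

/-- The product of the resolvents attached to the nontrivial sixth roots of unity. -/
def resolventProdSix {R : Type*} [CommRing R] (f : ℕ → R) : R :=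
  let s := f 0 * f 0 + (f 1 * f 1 + (f 2 * f 2 + (f 3 * f 3 + (f 4 * f 4 + f 5 * f 5))))
  let t := f 0 * f 1 + (f 1 * f 2 + (f 2 * f 3 + (f 3 * f 4 + (f 4 * f 5 + f 5 * f 0))))
  let u := f 0 * f 2 + (f 1 * f 3 + (f 2 * f 4 + (f 3 * f 5 + (f 4 * f 0 + f 5 * f 1))))
  let v := f 0 * f 3 + (f 1 * f 4 + f 2 * f 5)
  (f 0 + (f 2 + f 4) - (f 1 + (f 3 + f 5))) *
    ((s + t - (u + (v + v))) * (s + (v + v) - (t + u)))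

section

variable {R : Type*} [CommRing R] {S : ℕ → R → Prop} {mul add sub : ℕ → ℕ → ℕ}
  {frob norm : ℕ → ℕ} {q : ℕ}

namespace RepresentsRing

variable (A : RepresentsRing S mul add sub frob norm q)

include A

theorem binPow {u : ℕ} {a : R} (hu : S u a) (e : ℕ) : S (binPow mul u e) (a ^ e) :=
  binPow_rel A.one A.mul hu e

theorem prodList {us : List ℕ} {as : List R} (h : List.Forall₂ S us as) :
    S (prodList mul us) as.prod := by
  induction h with
  | nil => exact A.one
  | cons h1 _ ih => rw [List.prod_cons]; exact A.mul h1 ih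

theorem sumList {us : List ℕ} {as : List R} (h : List.Forall₂ S us as) :
    S (sumList add us) as.sum := by
  induction h with
  | nil => exact A.zero
  | cons h1 _ ih => rw [List.sum_cons]; exact A.add h1 ih

theorem iterate (n : ℕ) {u : ℕ} {a : R} (hu : S u a) :
    List.Forall₂ S (List.iterate frob u n) ((List.range n).map fun i => a ^ q ^ i) := by
  have h : (List.range n).map (fun i => a ^ q ^ i) = List.iterate (fun b => b ^ q) a n := by
    rw [← List.range_map_iterate]
    refine List.map_congr_left fun i _ => ?_
    rw [pow_iterate]
  rw [h]
  exact forall₂_iterate A.frob n hu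

theorem conjInv (n : ℕ) {u : ℕ} {a : R} (hu : S u a) : ∃ b, S (conjInv mul frob q n u) b := by
  have h := A.prodList (A.iterate (n - 1) (A.frob hu))
  simp only [_root_.conjInv, withIterates_eq, natForce_eq, List.append_nil]
  exact ⟨_, A.mul h (A.binPow (A.mul h hu) _)⟩

theorem digitsPow (es : List ℕ) {u : ℕ} {a : R} (hu : S u a) :
    S (digitsPow mul frob es u) (a ^ evalDigits q es) := by
  induction es generalizing u a with
  | nil => exact (pow_zero a).symm ▸ A.one
  | cons e es ih =>
    have h : _root_.digitsPow mul frob (e :: es) u =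
      natForce u fun u => mul (_root_.binPow mul u e) (_root_.digitsPow mul frob es (frob u)) := rfl
    rw [h, natForce_eq, evalDigits_cons, pow_add, pow_mul]
    exact A.mul (A.binPow hu e) (ih (A.frob hu))

theorem orderProd (m : ℕ) (gs : List (List ℕ × List ℕ)) {u : ℕ} {a : R} (hu : S u a) :
    S (orderProd mul sub frob q m u gs) (gs.map fun gr => (gr.2.map fun l =>
      (a ^ (evalDigits q gr.1 * (m / evalDigits q gr.1 / l))) ^ q -
        a ^ (evalDigits q gr.1 * (m / evalDigits q gr.1 / l))).prod).prod := by
  refine A.prodList ?_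
  simp only [List.forall₂_map_left_iff, List.forall₂_map_right_iff, natForce_eq]
  refine List.forall₂_same.2 fun gr _ => A.prodList ?_
  simp only [List.forall₂_map_left_iff, List.forall₂_map_right_iff]
  refine List.forall₂_same.2 fun l _ => ?_
  rw [pow_mul a]
  have h := A.binPow (A.digitsPow gr.1 hu) (m / evalDigits q gr.1 / l)
  exact A.sub (A.frob h) h

theorem frob_iterate (k : ℕ) {u : ℕ} {a : R} (hu : S u a) : S (frob^[k] u) (a ^ q ^ k) := by
  induction k with
  | zero => simpa using hu
  | succ k ih => rw [Function.iterate_succ_apply', pow_succ, pow_mul]; exact A.frob ih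

theorem resolventFive {u : ℕ} {a : R} (hu : S u a) :
    S (resolventFive mul add sub (List.iterate frob u 5))
      (resolventProdFive fun i => a ^ q ^ i) := by
  have h0 := A.frob_iterate 0 hu
  have h1 := A.frob_iterate 1 hu
  have h2 := A.frob_iterate 2 hu
  have h3 := A.frob_iterate 3 hu
  have h4 := A.frob_iterate 4 hu
  simp only [List.iterate, _root_.resolventFive, natForce_eq, resolventProdFive]
  repeat' first | assumption | apply A.sub | apply A.add | apply A.mul

theorem resolventSix {u : ℕ} {a : R} (hu : S u a) :
    S (resolventSix mul add sub (List.iterate frob u 6))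
      (resolventProdSix fun i => a ^ q ^ i) := by
  have h0 := A.frob_iterate 0 hu
  have h1 := A.frob_iterate 1 hu
  have h2 := A.frob_iterate 2 hu
  have h3 := A.frob_iterate 3 hu
  have h4 := A.frob_iterate 4 hu
  have h5 := A.frob_iterate 5 hu
  simp only [List.iterate, _root_.resolventSix, natForce_eq, resolventProdSix]
  repeat' first | assumption | apply A.sub | apply A.add | apply A.mul

end RepresentsRing

/-- Properties of a ring element that is good for the exponent `n` over the field of order `q`. -/
structure IsCheckedElement (resProd : (ℕ → R) → R) (q n : ℕ) (gs : List (List ℕ × List ℕ))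
    (α : R) : Prop where
  pow_eq : α ^ q ^ n = α
  sum_eq : ∑ i ∈ Finset.range n, α ^ q ^ i = 0
  isUnit_sub : ∀ gr ∈ gs, ∀ l ∈ gr.2,
    IsUnit ((α ^ (evalDigits q gr.1 * ((q ^ n - 1) / (q - 1) / evalDigits q gr.1 / l))) ^ q -
      α ^ (evalDigits q gr.1 * ((q ^ n - 1) / (q - 1) / evalDigits q gr.1 / l)))
  isUnit_resProd : IsUnit (resProd fun i => α ^ q ^ i)
  exists_inv : ∃ β, α * β = 1 ∧ ∑ i ∈ Finset.range n, β ^ q ^ i = 0 ∧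
    IsUnit (resProd fun i => β ^ q ^ i)

theorem isCheckedElement_of_conjCheck (A : RepresentsRing S mul add sub frob norm q) {n : ℕ}
    {res : (ℕ → ℕ → ℕ) → (ℕ → ℕ → ℕ) → (ℕ → ℕ → ℕ) → List ℕ → ℕ} {resProd : (ℕ → R) → R}
    (hres : ∀ {u : ℕ} {a : R}, S u a →
      S (res mul add sub (List.iterate frob u n)) (resProd fun i => a ^ q ^ i))
    {gs : List (List ℕ × List ℕ)} {u : ℕ} {α : R} (hu : S u α)
    (h : conjCheck res mul add sub frob norm q n u gs = true) :
    IsCheckedElement resProd q n gs α := by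
  obtain ⟨β, hβ⟩ := A.conjInv n hu
  have hrec : ∀ k, Nat.rec (motive := fun _ => ℕ) u (fun _ ih => frob ih) k =
      frob^[k] u := by
    intro k
    induction k with
    | zero => rfl
    | succ k ih => rw [Function.iterate_succ_apply', ← ih]
  simp only [conjCheck, withIterates_eq, natForce_eq, List.append_nil, Bool.and_eq_true,
    Nat.beq_eq] at h
  obtain ⟨hpow, hsum, hsum', hinv, hunit⟩ := h
  have hsumS : ∀ {v : ℕ} {b : R}, S v b →
      norm (sumList add (List.iterate frob v n)) = 0 → ∑ i ∈ Finset.range n, b ^ q ^ i = 0 := by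
    intro v b hb h0
    have h1 := A.norm (A.sumList (A.iterate n hb))
    rw [h0] at h1
    exact A.inj h1 A.zero
  have hy := A.mul (A.orderProd ((q ^ n - 1) / (q - 1)) gs hu) (A.mul (hres hu) (hres hβ))
  obtain ⟨z, hz⟩ := A.conjInv n hy
  have hyz := A.norm (A.mul hy hz)
  rw [hunit] at hyz
  have hU := IsUnit.of_mul_eq_one _ (A.inj hyz A.one)
  have hord := isUnit_of_mul_isUnit_left hU
  have hU2 := isUnit_of_mul_isUnit_right hU
  have hpow' := A.norm (A.frob_iterate n hu)
  rw [← hrec, hpow] at hpow'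
  have hinv' := A.norm (A.mul hu hβ)
  rw [hinv] at hinv'
  refine ⟨A.inj hpow' hu, hsumS hu hsum, fun gr hgr l hl => ?_, isUnit_of_mul_isUnit_left hU2,
    β, A.inj hinv' A.one, hsumS hβ hsum', isUnit_of_mul_isUnit_right hU2⟩
  have hgrU := isUnit_of_dvd_unit (List.dvd_prod (List.mem_map.2 ⟨gr, hgr, rfl⟩)) hord
  exact isUnit_of_dvd_unit (List.dvd_prod (List.mem_map.2 ⟨l, hl, rfl⟩)) hgrU

end

section

variable {R : Type*} [CommRing R]

/-- `v` is the value at `r` of a polynomial of length `L` with coefficients at most `b` whose value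
at `α` is `a`. -/
def IsPacked (r : ℕ) (α : R) (L b v : ℕ) (a : R) : Prop :=
  ∃ P : ℕ[X], (∀ i, L ≤ i → P.coeff i = 0) ∧ (∀ i, P.coeff i ≤ b) ∧ P.eval r = v ∧
    P.eval₂ (Nat.castRingHom R) α = a

variable {r : ℕ} {α : R} {L L' b b' v v' : ℕ} {a a' : R}

theorem eval_mod_eq_coeff_zero {P : ℕ[X]} (h : ∀ i, P.coeff i < r) :
    P.eval r % r = P.coeff 0 := by
  conv_lhs => rw [← divX_mul_X_add P]
  simp [Nat.mod_eq_of_lt (h 0)]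

theorem eval_div_eq_divX {P : ℕ[X]} (h : ∀ i, P.coeff i < r) : P.eval r / r = P.divX.eval r := by
  have hr : 0 < r := (Nat.zero_le _).trans_lt (h 0)
  conv_lhs => rw [← divX_mul_X_add P]
  simp [Nat.add_div_of_dvd_right, Nat.div_eq_of_lt (h 0), hr]

theorem eval_div_pow_mod {P : ℕ[X]} (h : ∀ i, P.coeff i < r) (i : ℕ) :
    P.eval r / r ^ i % r = P.coeff i := by
  induction i generalizing P with
  | zero => rw [pow_zero, Nat.div_one, eval_mod_eq_coeff_zero h]
  | succ i ih =>
    rw [pow_succ', ← Nat.div_div_eq_div_mul, eval_div_eq_divX h, ih, coeff_divX]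
    exact fun j => by rw [coeff_divX]; exact h _

namespace IsPacked

theorem mono (h : IsPacked r α L b v a) (hL : L ≤ L') (hb : b ≤ b') : IsPacked r α L' b' v a := by
  obtain ⟨P, h1, h2, h3, h4⟩ := h
  exact ⟨P, fun i hi => h1 i (hL.trans hi), fun i => (h2 i).trans hb, h3, h4⟩

theorem natCast {c : ℕ} (hL : 0 < L) (hc : c ≤ b) : IsPacked r α L b c (c : R) := by
  refine ⟨C c, fun i hi => coeff_C_of_ne_zero (by omega), fun i => ?_, by simp, by simp⟩
  rw [coeff_C]
  split_ifs <;> omega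

theorem radix (hL : 1 < L) (hb : 1 ≤ b) : IsPacked r α L b r α := by
  refine ⟨X, fun i hi => ?_, fun i => ?_, by simp, by simp⟩
  · rw [coeff_X_of_ne_one (by omega)]
  · rw [coeff_X]
    split_ifs <;> omega

theorem add (h : IsPacked r α L b v a) (h' : IsPacked r α L b' v' a') :
    IsPacked r α L (b + b') (v + v') (a + a') := by
  obtain ⟨P, h1, h2, h3, h4⟩ := h
  obtain ⟨Q, k1, k2, k3, k4⟩ := h'
  refine ⟨P + Q, fun i hi => ?_, fun i => ?_, by simp [h3, k3], by simp [h4, k4, eval₂_add]⟩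
  · rw [coeff_add, h1 i hi, k1 i hi]
  · rw [coeff_add]; exact add_le_add (h2 i) (k2 i)

theorem nsmul (c : ℕ) (h : IsPacked r α L b v a) :
    IsPacked r α L (c * b) (c * v) ((c : R) * a) := by
  obtain ⟨P, h1, h2, h3, h4⟩ := h
  refine ⟨C c * P, fun i hi => ?_, fun i => ?_, by simp [h3], by simp [h4, eval₂_mul]⟩
  · rw [coeff_C_mul, h1 i hi, mul_zero]
  · rw [coeff_C_mul]; exact Nat.mul_le_mul_left c (h2 i)

theorem radix_mul (h : IsPacked r α L b v a) : IsPacked r α (L + 1) b (r * v) (α * a) := by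
  obtain ⟨P, h1, h2, h3, h4⟩ := h
  refine ⟨X * P, fun i hi => ?_, fun i => ?_, by simp [h3], by simp [h4, eval₂_mul]⟩
  · obtain ⟨j, rfl⟩ : ∃ j, i = j + 1 := ⟨i - 1, by omega⟩
    rw [coeff_X_mul, h1 j (by omega)]
  · cases i with
    | zero => simp
    | succ j => rw [coeff_X_mul]; exact h2 j

theorem mul (h : IsPacked r α L b v a) (h' : IsPacked r α L b' v' a') :
    IsPacked r α (2 * L) (2 * L * (b * b')) (v * v') (a * a') := by
  obtain ⟨P, h1, h2, h3, h4⟩ := h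
  obtain ⟨Q, k1, k2, k3, k4⟩ := h'
  have hz : ∀ i, 2 * L ≤ i → (P * Q).coeff i = 0 := by
    intro i hi
    rw [coeff_mul]
    refine Finset.sum_eq_zero fun x hx => ?_
    have := Finset.HasAntidiagonal.mem_antidiagonal.1 hx
    rcases le_or_gt L x.1 with h | h
    · rw [h1 _ h, zero_mul]
    · rw [k1 _ (by omega), mul_zero]
  refine ⟨P * Q, hz, fun i => ?_, by simp [h3, k3], by rw [eval₂_mul, h4, k4]⟩
  rcases le_or_gt (2 * L) i with hi | hi
  · rw [hz i hi]; exact Nat.zero_le _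
  · rw [coeff_mul]
    refine (Finset.sum_le_card_nsmul _ _ (b * b') fun x _ =>
      Nat.mul_le_mul (h2 _) (k2 _)).trans ?_
    rw [Finset.Nat.card_antidiagonal, smul_eq_mul]
    exact Nat.mul_le_mul_right _ hi

theorem inj (hb : b < r) (hb' : b' < r) (h : IsPacked r α L b v a)
    (h' : IsPacked r α L' b' v a') : a = a' := by
  obtain ⟨P, -, h2, h3, rfl⟩ := h
  obtain ⟨Q, -, k2, k3, rfl⟩ := h'
  suffices P = Q by rw [this]
  ext i
  rw [← eval_div_pow_mod (fun i => (h2 i).trans_lt hb),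
    ← eval_div_pow_mod (fun i => (k2 i).trans_lt hb'), h3, k3]

end IsPacked

/-- The `i`-th entry of the table represents `w * β ^ i`. -/
def IsPackedTable (r : ℕ) (α : R) (L b : ℕ) (β : R) : List ℕ → R → Prop
  | [], _ => True
  | t :: ts, w => IsPacked r α L b t w ∧ IsPackedTable r α L b β ts (w * β)

theorem IsPackedTable.append {β : R} {ts us : List ℕ} {w : R}
    (h : IsPackedTable r α L b β ts w) (h' : IsPackedTable r α L b β us (w * β ^ ts.length)) :
    IsPackedTable r α L b β (ts ++ us) w := by
  induction ts generalizing w with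
  | nil => simpa using h'
  | cons t ts ih =>
    refine ⟨h.1, ih h.2 ?_⟩
    rwa [mul_assoc, ← pow_succ']

theorem isPackedTable_iterate {β : R} {step : ℕ → ℕ}
    (hstep : ∀ {v a}, IsPacked r α L b v a → IsPacked r α L b (step v) (a * β)) (len : ℕ)
    (h : IsPacked r α L b v a) : IsPackedTable r α L b β (List.iterate step v len) a := by
  induction len generalizing v a with
  | zero => trivial
  | succ m ih => exact ⟨h, ih (hstep h)⟩

theorem isPackedTable_powers (hb : 1 ≤ b) (len : ℕ) (j : ℕ) (hj : j + len ≤ L) :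
    IsPackedTable r α L b α (List.iterate (fun v => r * v) (r ^ j) len) (α ^ j) := by
  induction len generalizing j with
  | zero => trivial
  | succ m ih =>
    refine ⟨⟨X ^ j, fun i hi => ?_, fun i => ?_, by simp, by simp⟩, ?_⟩
    · rw [coeff_X_pow, if_neg (by omega)]
    · rw [coeff_X_pow]; split_ifs <;> omega
    · have := ih (j + 1) (by omega)
      rwa [pow_succ', pow_succ] at this

theorem IsPacked.laneReduce {p : ℕ} [CharP R p] (hp : 0 < p) {D bt : ℕ} (Ψ : R →+* R) {ts : List ℕ}
    (hts : IsPackedTable r α D bt (Ψ α) ts 1) (hlen : L ≤ ts.length) (hb : b < r)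
    (h : IsPacked r α L b v a) : IsPacked r α D (ts.length * (p * bt)) (laneReduce r p ts v)
        (Ψ a) := by
  obtain ⟨P, h1, h2, rfl, rfl⟩ := h
  have hΨ : Ψ (P.eval₂ (Nat.castRingHom R) α) = 1 * P.eval₂ (Nat.castRingHom R) (Ψ α) := by
    rw [one_mul, hom_eval₂]
    congr 1
    exact Subsingleton.elim _ _
  rw [hΨ]
  clear hΨ
  generalize (1 : R) = w at hts ⊢
  induction ts generalizing P w L with
  | nil =>
    have hP : P = 0 := by
      ext i
      exact h1 i (by simp only [List.length_nil] at hlen; omega)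
    subst hP
    exact ⟨0, by simp, by simp, eval_zero, by simp⟩
  | cons t ts ih =>
    have hstep : _root_.laneReduce r p (t :: ts) (P.eval r) =
      natForce (P.eval r) fun v => v % r % p * t + _root_.laneReduce r p ts (v / r) := rfl
    have hlt : ∀ i, P.coeff i < r := fun i => (h2 i).trans_lt hb
    rw [hstep, natForce_eq, eval_mod_eq_coeff_zero hlt, eval_div_eq_divX hlt]
    have hrec := ih (L := L - 1) (by simp only [List.length_cons] at hlen; omega) P.divX
      (fun i hi => by rw [coeff_divX]; exact h1 _ (by omega))
      (fun i => by rw [coeff_divX]; exact h2 _) (w * Ψ α) hts.2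
    have hhead := hts.1.nsmul (P.coeff 0 % p)
    have hsum := hhead.add hrec
    have hcast : ((P.coeff 0 % p : ℕ) : R) = (P.coeff 0 : R) := by
      rw [← CharP.cast_eq_mod]
    have hval : w * P.eval₂ (Nat.castRingHom R) (Ψ α) = ((P.coeff 0 % p : ℕ) : R) * w +
        w * Ψ α * P.divX.eval₂ (Nat.castRingHom R) (Ψ α) := by
      conv_lhs => rw [← divX_mul_X_add P]
      rw [eval₂_add, eval₂_mul, eval₂_X, eval₂_C, hcast]
      simp only [eq_natCast]
      ring
    rw [hval]
    refine hsum.mono le_rfl ?_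
    rw [List.length_cons, add_mul, one_mul, add_comm]
    exact Nat.add_le_add_left (Nat.mul_le_mul_right _ (Nat.mod_lt _ hp).le) _

end

theorem lt_laneRadix {p D b : ℕ} (hb : b ≤ 2 * D * p * (laneBound p D * laneBound p D)) :
    b < laneRadix p D := Nat.lt_succ_of_le hb

section

variable {R : Type*} [CommRing R] {p k D : ℕ} [CharP R p] {α : R} {c q n : ℕ}

theorem isPacked_packList {r : ℕ} (hp : 0 < p) {l : List ℕ} :
    IsPacked r α l.length p (packList r p l)
      (∑ i ∈ Finset.range l.length, (l.getD i 0 : R) * α ^ i) := by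
  induction l with
  | nil => exact ⟨0, by simp, by simp, eval_zero, by simp⟩
  | cons c l ih =>
    obtain ⟨P, h1, h2, h3, h4⟩ := ih
    refine ⟨P * X + C (c % p), fun i hi => ?_, fun i => ?_, ?_, ?_⟩
    · obtain ⟨j, rfl⟩ : ∃ j, i = j + 1 := ⟨i - 1, by simp at hi; omega⟩
      simp only [List.length_cons] at hi
      simp [coeff_mul_X, h1 j (by omega)]
    · cases i with
      | zero => simpa using (Nat.mod_lt c hp).le
      | succ j => simpa [coeff_mul_X] using h2 j
    · rw [show packList r p (c :: l) = c % p + r * packList r p l from rfl, ← h3]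
      simp only [eval_add, eval_mul, eval_X, eval_C]
      ring
    · rw [List.length_cons, Finset.sum_range_succ', eval₂_add, eval₂_mul, eval₂_X, eval₂_C, h4,
        Finset.sum_mul]
      simp only [List.getD_cons_succ, List.getD_cons_zero, pow_zero, mul_one, pow_succ, mul_assoc,
        eq_natCast]
      rw [← CharP.cast_eq_mod]

theorem representsRing_isPacked [Fact p.Prime] (hq : q = p ^ k) (hD : 1 < D)
    (hc : IsPacked (laneRadix p D) α D p c (α ^ D)) {base T Φ : List ℕ} {φ : ℕ}
    (hbase : base = List.iterate (fun v => laneRadix p D * v) 1 D ++ [c])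
    (hT : T = List.iterate (fun v => laneReduce (laneRadix p D) p base (laneRadix p D * v)) 1
      (2 * D))
    (hφ : φ = binPow (fun u v => laneReduce (laneRadix p D) p T (u * v)) (laneRadix p D) q)
    (hΦ : Φ = List.iterate (fun v => laneReduce (laneRadix p D) p base
      (laneReduce (laneRadix p D) p T (v * φ))) 1 D) :
    RepresentsRing (fun u x => IsPacked (laneRadix p D) α D (laneBound p D) u x)
      (fun u v => laneReduce (laneRadix p D) p T (u * v))
      (fun u v => laneReduce (laneRadix p D) p base (u + v))
      (fun u v => laneReduce (laneRadix p D) p base (u + (p - 1) * v))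
      (laneReduce (laneRadix p D) p Φ) (laneReduce (laneRadix p D) p base) q := by
  have hp : 2 ≤ p := (Fact.out : p.Prime).two_le
  have hp0 : 0 < p := by omega
  set bn := (D + 1) * (p * p) with hbn
  set b := laneBound p D with hb
  set r := laneRadix p D with hr
  have hbb : b = 2 * D * (p * bn) := rfl
  have hp_bn : p ≤ bn := by nlinarith [Nat.zero_le (D * (p * p))]
  have hbn_b : bn ≤ b := by
    rw [hbb, ← mul_assoc]
    exact Nat.le_mul_of_pos_left _ (by positivity)
  have hb1 : 1 ≤ b := by omega
  have hDp : 1 ≤ 2 * D * p := Nat.mul_pos (by omega) hp0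
  have hb_sq : b ≤ b * b := Nat.le_mul_of_pos_left _ hb1
  have hpb_lt : p * b < r := by
    refine lt_laneRadix ?_
    exact Nat.mul_le_mul (Nat.le_mul_of_pos_left _ (by omega)) hb_sq
  have hb_lt : b < r := (Nat.le_mul_of_pos_left _ hp0).trans_lt hpb_lt
  have hmul_lt : 2 * D * (b * b) < r :=
    lt_laneRadix (Nat.mul_le_mul_right _ (Nat.le_mul_of_pos_right _ hp0))
  have hbase_len : base.length = D + 1 := by simp [hbase]
  have hbaseT : IsPackedTable r α D p α base 1 := by
    rw [hbase]
    refine IsPackedTable.append ?_ ⟨?_, trivial⟩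
    · simpa using isPackedTable_powers (r := r) (α := α) (L := D) (b := p) (by omega) D 0 (by simp)
    · simpa using hc
  have hnorm : ∀ {L b' v : ℕ} {a : R}, L ≤ D + 1 → b' < r → IsPacked r α L b' v a →
      IsPacked r α D bn (laneReduce r p base v) a := by
    intro L b' v a hL hb' hv
    have := hv.laneReduce hp0 (RingHom.id R) hbaseT (by omega) hb'
    rwa [hbase_len] at this
  have hTT : IsPackedTable r α D bn α T 1 := by
    rw [hT]
    refine isPackedTable_iterate (fun hv => ?_) _
      (by simpa using IsPacked.natCast (c := 1) (by omega) (by omega))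
    have := hnorm le_rfl (hbn_b.trans_lt hb_lt) hv.radix_mul
    rwa [mul_comm α] at this
  have hmul : ∀ {b₁ b₂ u v : ℕ} {x y : R}, b₁ ≤ b → b₂ ≤ b → IsPacked r α D b₁ u x →
      IsPacked r α D b₂ v y → IsPacked r α D b (laneReduce r p T (u * v)) (x * y) := by
    intro b₁ b₂ u v x y h₁ h₂ hu hv
    have hT_len : T.length = 2 * D := by simp [hT]
    have := ((hu.mono le_rfl h₁).mul (hv.mono le_rfl h₂)).laneReduce hp0 (RingHom.id R) hTT
      hT_len.ge hmul_lt
    rwa [hT_len] at this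
  have hone : IsPacked r α D b 1 (1 : R) := by
    simpa using IsPacked.natCast (r := r) (α := α) (c := 1) (L := D) (by omega) hb1
  have hφP : IsPacked r α D b φ (α ^ q) :=
    hφ ▸ binPow_rel (S := fun u x => IsPacked r α D b u x) hone (hmul le_rfl le_rfl)
      (IsPacked.radix hD hb1) q
  have : ExpChar R p := ExpChar.prime Fact.out
  have hfrobα : ∀ a : R, iterateFrobenius R p k a = a ^ q := fun a => by
    rw [iterateFrobenius_def, hq]
  have hΦT : IsPackedTable r α D bn (iterateFrobenius R p k α) Φ 1 := by
    rw [hΦ]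
    refine isPackedTable_iterate (fun hv => ?_) _
      (by simpa using IsPacked.natCast (c := 1) (by omega) (by omega))
    rw [hfrobα]
    exact hnorm (by omega) hb_lt (hmul hbn_b le_rfl hv hφP)
  exact
    { zero := by
        simpa using IsPacked.natCast (r := r) (α := α) (c := 0) (L := D) (by omega) (Nat.zero_le b)
      one := hone
      mul := hmul le_rfl le_rfl
      add := fun hu hv => (hnorm (by omega) (by nlinarith) (hu.add hv)).mono le_rfl hbn_b
      sub := fun {u v x y} hu hv => by
        have h1 := hu.add (hv.nsmul (p - 1))
        have h2 : x + ((p - 1 : ℕ) : R) * y = x - y := by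
          rw [Nat.cast_sub (by omega), CharP.cast_eq_zero]
          push_cast
          ring
        rw [h2] at h1
        refine (hnorm (by omega) ?_ h1).mono le_rfl hbn_b
        calc b + (p - 1) * b = p * b := by
              obtain ⟨j, rfl⟩ : ∃ j, p = j + 1 := ⟨p - 1, by omega⟩
              simp only [Nat.add_sub_cancel]; ring
          _ < r := hpb_lt
      frob := fun {u x} hu => by
        have hΦ_len : Φ.length = D := by simp [hΦ]
        have := hu.laneReduce hp0 (iterateFrobenius R p k) hΦT hΦ_len.ge hb_lt
        rw [hfrobα, hΦ_len] at this
        refine this.mono le_rfl ?_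
        rw [hbb]
        exact Nat.mul_le_mul_right _ (by omega)
      norm := fun hu => (hnorm (by omega) hb_lt hu).mono le_rfl hbn_b
      inj := IsPacked.inj hb_lt hb_lt }

omit [CharP R p] in
theorem isPacked_laneRadix (hp : 0 < p) (hD : 1 < D) :
    IsPacked (laneRadix p D) α D (laneBound p D) (laneRadix p D) α :=
  IsPacked.radix hD (Nat.mul_pos (by omega) (by positivity))

theorem isCheckedElement_of_fieldCheck [Fact p.Prime] (hq : q = p ^ k) (hD : 1 < D)
    (hc : IsPacked (laneRadix p D) α D p c (α ^ D))
    {res : (ℕ → ℕ → ℕ) → (ℕ → ℕ → ℕ) → (ℕ → ℕ → ℕ) → List ℕ → ℕ} {resProd : (ℕ → R) → R}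
    (hres : ∀ {S : ℕ → R → Prop} {mul add sub : ℕ → ℕ → ℕ} {frob norm : ℕ → ℕ},
      RepresentsRing S mul add sub frob norm q → ∀ {u : ℕ} {a : R}, S u a →
        S (res mul add sub (List.iterate frob u n)) (resProd fun i => a ^ q ^ i))
    {gs : List (List ℕ × List ℕ)}
    (h : fieldCheck res p q n (laneRadix p D) D c gs = true) :
    IsCheckedElement resProd q n gs α := by
  simp only [fieldCheck, withIterates_eq, natForce_eq, List.append_nil] at h
  have A := representsRing_isPacked hq hD hc rfl rfl rfl rfl
  exact isCheckedElement_of_conjCheck A (hres A)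
    (isPacked_laneRadix (Fact.out : p.Prime).pos hD) h

theorem pow_eq_one_of_lanePowCheck [Fact p.Prime] (hD : 1 < D)
    (hc : IsPacked (laneRadix p D) α D p c (α ^ D)) {m : ℕ}
    (h : lanePowCheck p (laneRadix p D) D c m = true) : α ^ m = 1 := by
  simp only [lanePowCheck, withIterates_eq, natForce_eq, List.append_nil, Nat.beq_eq] at h
  have A := representsRing_isPacked (k := 1) rfl hD hc rfl rfl rfl rfl
  have h1 := A.norm (binPow_rel A.one A.mul (isPacked_laneRadix (Fact.out : p.Prime).pos hD) m)
  rw [h] at h1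
  exact A.inj h1 A.one

end

theorem resolventProdFive_eq_zero {R : Type*} [CommRing R] {ρ : R}
    (hρ : 1 + ρ + ρ ^ 2 + ρ ^ 3 + ρ ^ 4 = 0) {f : ℕ → R}
    (hf : ∑ i ∈ Finset.range 5, ρ ^ i * f i = 0) : resolventProdFive f = 0 := by
  simp only [Finset.sum_range_succ, Finset.sum_range_zero] at hf
  set s := f 0 * f 0 + (f 1 * f 1 + (f 2 * f 2 + (f 3 * f 3 + f 4 * f 4))) with hs
  set t := f 0 * f 1 + (f 1 * f 2 + (f 2 * f 3 + (f 3 * f 4 + f 4 * f 0))) with ht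
  set u := f 0 * f 2 + (f 1 * f 3 + (f 2 * f 4 + (f 3 * f 0 + f 4 * f 1))) with hu
  have hρ5 : ρ ^ 5 = 1 := by linear_combination (ρ - 1) * hρ
  have h1 : s + t * (ρ + ρ ^ 4) + u * (ρ ^ 2 + ρ ^ 3) = 0 := by
    rw [hs, ht, hu]
    linear_combination (f 0 + ρ ^ 4 * f 1 + ρ ^ 3 * f 2 + ρ ^ 2 * f 3 + ρ * f 4) * hf -
      (f 1 * f 1 + f 2 * f 2 + f 3 * f 3 + f 4 * f 4 + (f 1 * f 2 + f 2 * f 3 + f 3 * f 4) * ρ +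
        (f 1 * f 3 + f 2 * f 4) * ρ ^ 2 + f 1 * f 4 * ρ ^ 3) * hρ5
  change s * s + (t * u + (t * u + t * u)) - (s * (t + u) + (t * t + u * u)) = 0
  clear_value s t u
  have hsum : (ρ + ρ ^ 4) + (ρ ^ 2 + ρ ^ 3) = -1 := by linear_combination hρ
  have hprod : (ρ + ρ ^ 4) * (ρ ^ 2 + ρ ^ 3) = -1 := by
    linear_combination hρ + (ρ + ρ ^ 2) * hρ5
  generalize ρ + ρ ^ 4 = x at *
  generalize ρ ^ 2 + ρ ^ 3 = y at *
  linear_combination (s + t * y + u * x) * h1 - s * (t + u) * hsum - (t ^ 2 + u ^ 2) * hprod -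
    t * u * ((x + y - 1) * hsum - 2 * hprod)

theorem resolventProdSix_eq_zero {R : Type*} [CommRing R] [IsDomain R] {ρ : R}
    (hρ : ρ ^ 6 = 1) (hρ1 : ρ ≠ 1) {f : ℕ → R}
    (hf : ∑ i ∈ Finset.range 6, ρ ^ i * f i = 0) : resolventProdSix f = 0 := by
  simp only [Finset.sum_range_succ, Finset.sum_range_zero] at hf
  have h : (ρ + 1) * ((ρ ^ 2 + ρ + 1) * (ρ ^ 2 - ρ + 1)) = 0 := by
    refine (mul_eq_zero.mp ?_).resolve_left (sub_ne_zero.mpr hρ1)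
    linear_combination hρ
  rw [resolventProdSix]
  rcases mul_eq_zero.mp h with h | h
  · obtain rfl : ρ = -1 := by linear_combination h
    refine mul_eq_zero_of_left ?_ _
    linear_combination hf
  refine mul_eq_zero_of_right _ ?_
  rcases mul_eq_zero.mp h with h | h
  · refine mul_eq_zero_of_right _ ?_
    have hAB : f 0 - f 2 + f 3 - f 5 + ρ * (f 1 - f 2 + f 4 - f 5) = 0 := by
      linear_combination hf - (f 2 + (ρ - 1) * f 3 + (ρ ^ 2 - ρ) * f 4 + (ρ ^ 3 - ρ ^ 2 + 1) *
          f 5) * h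
    linear_combination (f 0 - f 2 + f 3 - f 5 - (1 + ρ) * (f 1 - f 2 + f 4 - f 5)) * hAB +
      (f 1 - f 2 + f 4 - f 5) ^ 2 * h
  · refine mul_eq_zero_of_left ?_ _
    have hAB : f 0 - f 2 - f 3 + f 5 + ρ * (f 1 + f 2 - f 4 - f 5) = 0 := by
      linear_combination hf - (f 2 + (ρ + 1) * f 3 + (ρ ^ 2 + ρ) * f 4 + (ρ ^ 3 + ρ ^ 2 - 1) *
          f 5) * h
    linear_combination (f 0 - f 2 - f 3 + f 5 + (1 - ρ) * (f 1 + f 2 - f 4 - f 5)) * hAB +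
      (f 1 + f 2 - f 4 - f 5) ^ 2 * h

section

variable {k F Ω : Type*} [Field k] [Fintype k] [Field F] [Fintype F] [Algebra k F]
  [Field Ω] [Algebra F Ω]

omit [Fintype F] in
theorem frobResolvent_five_ne_zero {q : ℕ} {x : F}
    (h : IsUnit (resolventProdFive fun i => x ^ q ^ i))
    {ρ : Ω} (hρ : ρ ^ 5 = 1) (hρ1 : ρ ≠ 1) : frobResolvent q 5 ρ x ≠ 0 := by
  intro h0
  have h1 : 1 + ρ + ρ ^ 2 + ρ ^ 3 + ρ ^ 4 = 0 := by
    refine (mul_eq_zero.mp ?_).resolve_left (sub_ne_zero.mpr hρ1)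
    linear_combination hρ
  have h2 := resolventProdFive_eq_zero h1 h0
  apply (h.map (algebraMap F Ω)).ne_zero
  rw [← h2]
  simp [resolventProdFive]

omit [Fintype F] in
theorem frobResolvent_six_ne_zero {q : ℕ} {x : F} (h : IsUnit (resolventProdSix fun i => x ^ q ^ i))
    {ρ : Ω} (hρ : ρ ^ 6 = 1) (hρ1 : ρ ≠ 1) : frobResolvent q 6 ρ x ≠ 0 := by
  intro h0
  have h2 := resolventProdSix_eq_zero hρ hρ1 h0
  apply (h.map (algebraMap F Ω)).ne_zero
  rw [← h2]
  simp [resolventProdSix]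

theorem trace_eq_zero_of_sum_eq_zero {n : ℕ} (hdim : Module.finrank k F = n) {x : F}
    (h : ∑ i ∈ Finset.range n, x ^ Fintype.card k ^ i = 0) : Algebra.trace k F x = 0 := by
  apply (algebraMap k F).injective
  rw [FiniteField.algebraMap_trace_eq_sum_pow, Nat.card_eq_fintype_card, hdim, h, map_zero]

theorem IsCheckedElement.isGoodElement {resProd : (ℕ → F) → F} {n : ℕ}
    {gs : List (List ℕ × List ℕ)} {certs : List (ℕ × ℕ × List ℕ)} {α : F}
    (hdim : Module.finrank k F = n) (hα : IsCheckedElement resProd (Fintype.card k) n gs α)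
    (hfac : factorCheck (Fintype.card k) n gs certs = true)
    (hres : ∀ {x : F}, IsUnit (resProd fun i => x ^ Fintype.card k ^ i) → ∀ {ρ : Ω}, ρ ^ n = 1 →
      ρ ≠ 1 → frobResolvent (Fintype.card k) n ρ x ≠ 0) :
    IsGoodElement k Ω α := by
  obtain ⟨β, hαβ, hβs, hβu⟩ := hα.exists_inv
  obtain rfl : β = α⁻¹ := eq_inv_of_mul_eq_one_right hαβ
  have hα0 : α ≠ 0 := left_ne_zero_of_mul_eq_one hαβ
  refine ⟨hα0, trace_eq_zero_of_sum_eq_zero hdim hα.sum_eq,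
    trace_eq_zero_of_sum_eq_zero hdim hβs, ?_, ?_, ?_⟩
  · rw [hdim]
    exact fun ρ => hres hα.isUnit_resProd
  · rw [hdim]
    exact fun ρ => hres hβu
  · intro l hl hdvd hpow
    have hq : 1 < Fintype.card k := Fintype.one_lt_card
    have hN := Nat.div_mul_cancel (card_sub_one_dvd_card_sub_one k F)
    rw [card_eq_pow_of_finrank_eq hdim] at hdvd hpow hN
    obtain ⟨gr, hgr, hlgr, hE⟩ := factorCheck_spec hfac hl hdvd
    set E := evalDigits (Fintype.card k) gr.1 *
      ((Fintype.card k ^ n - 1) / (Fintype.card k - 1) / evalDigits (Fintype.card k) gr.1 / l)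
    have h1 : (Fintype.card k ^ n - 1) / l = E * (Fintype.card k - 1) := by
      rw [← hN, ← hE]
      exact Nat.div_eq_of_eq_mul_left hl.pos (by ring)
    refine (hα.isUnit_sub gr hgr l hlgr).ne_zero ?_
    rw [sub_eq_zero, ← pow_mul]
    change α ^ (E * Fintype.card k) = α ^ E
    rw [show E * Fintype.card k = E * (Fintype.card k - 1) + E by
      rw [← Nat.mul_succ, Nat.succ_eq_add_one, Nat.sub_add_cancel hq.le], pow_add, ← h1, hpow,
        one_mul]

end

section

universe u

theorem FieldWitness.isCheckedElement {R : Type*} [CommRing R] {w : FieldWitness} [Fact w.p.Prime]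
    [CharP R w.p] {res : (ℕ → ℕ → ℕ) → (ℕ → ℕ → ℕ) → (ℕ → ℕ → ℕ) → List ℕ → ℕ}
    {resProd : (ℕ → R) → R} {n : ℕ} {digits : List (List ℕ)}
    (hres : ∀ {S : ℕ → R → Prop} {mul add sub : ℕ → ℕ → ℕ} {frob norm : ℕ → ℕ},
      RepresentsRing S mul add sub frob norm (w.p ^ w.k) → ∀ {u : ℕ} {a : R}, S u a →
        S (res mul add sub (List.iterate frob u n)) (resProd fun i => a ^ (w.p ^ w.k) ^ i))
    (h : witnessCheck res n digits w = true) {α : R}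
    (hα : ∑ i ∈ Finset.range w.coeffs.length, (w.coeffs.getD i 0 : R) * α ^ i =
      α ^ w.coeffs.length) :
    IsCheckedElement resProd (w.p ^ w.k) n (digits.zip w.factors) α := by
  simp only [witnessCheck, natForce_eq, Bool.and_eq_true] at h
  refine isCheckedElement_of_fieldCheck rfl (Nat.blt_eq.mp h.2.1) ?_ hres h.2.2.2
  rw [← hα]
  exact isPacked_packList (Fact.out : w.p.Prime).pos

theorem FieldWitness.exists_isCheckedElement {F : Type u} [Field F] [Fintype F] {w : FieldWitness}
    {res : (ℕ → ℕ → ℕ) → (ℕ → ℕ → ℕ) → (ℕ → ℕ → ℕ) → List ℕ → ℕ}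
    {resProd : ∀ {R : Type u} [CommRing R], (ℕ → R) → R} {n : ℕ} {digits : List (List ℕ)}
    (hF : Fintype.card F = (w.p ^ w.k) ^ n)
    (hres : ∀ {R : Type u} [CommRing R] {S : ℕ → R → Prop} {mul add sub : ℕ → ℕ → ℕ}
      {frob norm : ℕ → ℕ}, RepresentsRing S mul add sub frob norm (w.p ^ w.k) →
        ∀ {u : ℕ} {a : R}, S u a →
          S (res mul add sub (List.iterate frob u n)) (resProd fun i => a ^ (w.p ^ w.k) ^ i))
    (h : witnessCheck res n digits w = true) :
    ∃ α : F, IsCheckedElement resProd (w.p ^ w.k) n (digits.zip w.factors) α := by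
  have h' := h
  simp only [witnessCheck, natForce_eq, Bool.and_eq_true] at h'
  have : Fact w.p.Prime := ⟨prime_of_smallPrime h'.1⟩
  have : CharP F w.p := charP_of_card_eq_prime_pow (f := w.k * n) (by rw [hF, pow_mul])
  set D := w.coeffs.length with hD
  have hD1 : 1 < D := Nat.blt_eq.mp h'.2.1
  set g : F[X] := X ^ D - ∑ i : Fin D, C (w.coeffs.getD i 0 : F) * X ^ (i : ℕ) with hg
  have hdeg : g.degree = D := by
    rw [hg, degree_sub_eq_left_of_degree_lt] <;> rw [degree_X_pow]
    exact degree_sum_fin_lt _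
  have hdeg0 : g.degree ≠ 0 := by
    rw [hdeg]
    exact_mod_cast (by omega : D ≠ 0)
  have hroot : ∀ {R : Type u} [CommRing R] (φ : F →+* R) (α : R), g.eval₂ φ α = 0 →
      ∑ i ∈ Finset.range D, (w.coeffs.getD i 0 : R) * α ^ i = α ^ D := by
    intro R _ φ α hα
    rw [hg, eval₂_sub, eval₂_X_pow, eval₂_finsetSum, sub_eq_zero] at hα
    rw [hα, Finset.sum_range]
    refine Finset.sum_congr rfl fun i _ => ?_
    rw [eval₂_mul, eval₂_C, eval₂_X_pow, map_natCast]
  have : CharP (AdjoinRoot g) w.p :=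
    charP_of_injective_ringHom (AdjoinRoot.coe_injective hdeg0) w.p
  have h1 := (FieldWitness.isCheckedElement hres h
    (hroot _ _ (AdjoinRoot.eval₂_root g))).pow_eq
  have h2 : g ∣ X ^ Fintype.card F - X := by
    rw [← AdjoinRoot.mk_eq_zero, map_sub, map_pow, AdjoinRoot.mk_X, hF, h1, sub_self]
  have h3 : (X ^ Fintype.card F - X : F[X]).Splits := by
    rw [splits_iff_card_roots, FiniteField.roots_X_pow_card_sub_X,
      FiniteField.X_pow_card_sub_X_natDegree_eq F Fintype.one_lt_card]
    rfl
  obtain ⟨α, hα⟩ := (h3.of_dvd (FiniteField.X_pow_card_sub_X_ne_zero F Fintype.one_lt_card)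
    h2).exists_eval_eq_zero hdeg0
  exact ⟨α, FieldWitness.isCheckedElement hres h (hroot (RingHom.id F) α hα)⟩

section

variable {k F Ω : Type*} [Field k] [Fintype k] [Field F] [Fintype F] [Algebra k F]
  [Field Ω] [Algebra F Ω] {w : FieldWitness}

theorem FieldWitness.exists_isGoodElement_five (hdim : Module.finrank k F = 5)
    (hk : Fintype.card k = w.p ^ w.k) {digits : List (List ℕ)}
    (h : witnessCheck resolventFive 5 digits w = true) : ∃ α : F, IsGoodElement k Ω α := by
  obtain ⟨α, hα⟩ := FieldWitness.exists_isCheckedElement (F := F) (resProd := resolventProdFive)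
    (by rw [card_eq_pow_of_finrank_eq hdim, hk]) RepresentsRing.resolventFive h
  simp only [witnessCheck, natForce_eq, Bool.and_eq_true] at h
  rw [← hk] at hα h
  exact ⟨α, hα.isGoodElement hdim h.2.2.1 frobResolvent_five_ne_zero⟩

theorem FieldWitness.exists_isGoodElement_six (hdim : Module.finrank k F = 6)
    (hk : Fintype.card k = w.p ^ w.k) {digits : List (List ℕ)}
    (h : witnessCheck resolventSix 6 digits w = true) : ∃ α : F, IsGoodElement k Ω α := by
  obtain ⟨α, hα⟩ := FieldWitness.exists_isCheckedElement (F := F) (resProd := resolventProdSix)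
    (by rw [card_eq_pow_of_finrank_eq hdim, hk]) RepresentsRing.resolventSix h
  simp only [witnessCheck, natForce_eq, Bool.and_eq_true] at h
  rw [← hk] at hα h
  exact ⟨α, hα.isGoodElement hdim h.2.2.1 frobResolvent_six_ne_zero⟩

end

end

section

set_option maxRecDepth 100000

/-- Good elements of `F_{q^5}` for small `q`. -/
def witnessesFive : List FieldWitness :=
  [⟨2, 1, [1, 0, 0, 1, 0], [[31]], []⟩,
   ⟨3, 1, [2, 0, 2, 1, 0], [[11]], []⟩,
   ⟨7, 1, [6, 0, 0, 4, 0], [[2801]], []⟩,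
   ⟨2, 3, [1, 0, 0, 1, 1, 1, 1, 0, 0, 0, 1, 1, 1, 0, 0], [[31, 151]], []⟩,
   ⟨3, 2, [2, 0, 0, 1, 2, 1, 1, 1, 1, 0], [[11, 61]], []⟩,
   ⟨11, 1, [9, 0, 10, 0, 0], [[5, 3221]], [(3221, 10, [2, 5, 7, 23])]⟩,
   ⟨13, 1, [12, 0, 0, 11, 0], [[30941]], [(30941, 2, [2, 5, 7, 13, 17])]⟩,
   ⟨2, 4, [1, 0, 1, 0, 0, 0, 0, 1, 0, 1, 1, 0, 0, 1, 1, 1, 0, 1, 1, 0], [[5, 11, 31, 41]], []⟩,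
   ⟨17, 1, [16, 0, 0, 15, 0], [[88741]], [(88741, 2, [2, 3, 5, 17, 29])]⟩,
   ⟨19, 1, [18, 0, 0, 17, 0], [[151, 911]], []⟩,
   ⟨23, 1, [22, 0, 22, 21, 0], [[292561]], [(292561, 7, [2, 3, 5, 23, 53])]⟩,
   ⟨3, 3, [2, 0, 2, 2, 0, 1, 1, 2, 2, 1, 2, 2, 2, 2, 0], [[11, 4561]], [(4561, 11, [2, 3, 5,
     19])]⟩,
   ⟨29, 1, [27, 0, 0, 27, 0], [[732541]], [(732541, 10, [2, 3, 5, 29, 421])]⟩,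
   ⟨31, 1, [29, 0, 28, 0, 0], [[5, 11, 17351]], [(17351, 11, [2, 5, 347])]⟩,
   ⟨2, 5, [1, 0, 0, 1, 0, 1, 0, 1, 1, 1, 0, 0, 0, 1, 0, 0, 1, 1, 0, 0, 0, 0, 0, 1, 0], [[601,
     1801]], []⟩,
   ⟨37, 1, [35, 0, 36, 0, 0], [[11, 41, 4271]], [(4271, 7, [2, 5, 7, 61])]⟩,
   ⟨41, 1, [39, 0, 40, 0, 0], [[5, 579281]], [(579281, 11, [2, 5, 13, 557])]⟩,
   ⟨43, 1, [41, 0, 42, 0, 0], [[3500201]], [(3500201, 3, [2, 5, 11, 37, 43])]⟩,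
   ⟨47, 1, [46, 0, 0, 46, 0], [[11, 31, 14621]], [(14621, 2, [2, 5, 17, 43])]⟩,
   ⟨7, 2, [3, 0, 0, 6, 0, 6, 2, 0, 2, 0], [[11, 191, 2801]], []⟩,
   ⟨53, 1, [52, 0, 0, 50, 0], [[11, 131, 5581]], [(5581, 6, [2, 3, 5, 31])]⟩,
   ⟨59, 1, [58, 0, 0, 56, 0], [[11, 41, 151, 181]], []⟩,
   ⟨61, 1, [59, 0, 59, 0, 0], [[5, 131, 21491]], [(21491, 2, [2, 5, 7, 307])]⟩,
   ⟨2, 6, [1, 0, 0, 0, 0, 1, 0, 0, 1, 0, 0, 1, 1, 1, 0, 0, 1, 1, 1, 1, 0, 1, 1, 1, 1, 0, 0, 0,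
     0, 0], [[11, 31, 151, 331]], []⟩,
   ⟨67, 1, [66, 0, 0, 66, 0], [[761, 26881]], [(26881, 11, [2, 3, 5, 7])]⟩,
   ⟨71, 1, [69, 0, 70, 68, 0], [[5, 11, 211, 2221]], []⟩,
   ⟨73, 1, [72, 0, 0, 70, 0], [[28792661]], [(28792661, 2, [2, 5, 13, 37, 41, 73])]⟩,
   ⟨79, 1, [78, 0, 0, 78, 0], [[39449441]], [(3121, 7, [2, 3, 5, 13]), (39449441, 7, [2, 5, 79,
     3121])]⟩,
   ⟨3, 4, [1, 0, 1, 1, 1, 1, 2, 2, 0, 1, 0, 1, 0, 0, 1, 2, 2, 0, 2, 0], [[5, 11, 61, 1181]], []⟩,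
   ⟨83, 1, [82, 0, 82, 81, 0], [[48037081]], [(48037081, 17, [2, 3, 5, 7, 13, 53, 83])]⟩,
   ⟨89, 1, [87, 0, 88, 0, 0], [[131, 691, 701]], []⟩,
   ⟨97, 1, [94, 0, 0, 96, 0], [[11, 31, 262321]], [(262321, 13, [2, 3, 5, 1093])]⟩,
   ⟨101, 1, [99, 0, 100, 0, 0], [[5, 31, 491, 1381]], []⟩,
   ⟨103, 1, [102, 0, 0, 101, 0], [[11, 10332211]], [(49201, 7, [2, 3, 5, 41]), (10332211, 2, [2,
     3, 5, 7, 49201])]⟩,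
   ⟨107, 1, [106, 0, 0, 106, 0], [[211, 627091]], [(20903, 5, [2, 7, 1493]), (627091, 2, [2, 3,
     5, 20903])]⟩,
   ⟨109, 1, [107, 0, 106, 0, 0], [[31, 191, 24061]], [(24061, 10, [2, 3, 5, 401])]⟩,
   ⟨113, 1, [111, 0, 112, 0, 0], [[11, 251, 59581]], [(59581, 6, [2, 3, 5, 331])]⟩,
   ⟨11, 2, [3, 0, 9, 2, 4, 6, 5, 10, 10, 0], [[5, 3221, 13421]], [(3221, 10, [2, 5, 7, 23]),
     (13421, 10, [2, 5, 11, 61])]⟩,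
   ⟨127, 1, [125, 0, 0, 125, 0], [[262209281]], [(262209281, 3, [2, 5, 127, 1613])]⟩,
   ⟨2, 7, [1, 0, 0, 0, 0, 0, 1, 0, 1, 1, 1, 1, 1, 0, 0, 0, 0, 1, 1, 0, 0, 1, 0, 0, 0, 0, 0, 1,
     1, 1, 0, 0, 0, 1, 0], [[31, 71, 122921]], [(122921, 3, [2, 5, 7, 439])]⟩,
   ⟨131, 1, [129, 0, 130, 0, 0], [[5, 61, 973001]], [(973001, 3, [2, 5, 7, 139])]⟩,
   ⟨137, 1, [135, 0, 136, 134, 0], [[11, 101, 319411]], [(319411, 2, [2, 3, 5, 7, 13])]⟩,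
   ⟨139, 1, [136, 0, 138, 0, 0], [[41, 9170881]], [(9170881, 19, [2, 3, 5, 41, 233])]⟩,
   ⟨149, 1, [148, 0, 0, 148, 0], [[251, 691, 2861]], []⟩,
   ⟨151, 1, [148, 0, 148, 0, 0], [[5, 104670301]], [(49843, 2, [2, 3, 13, 71]), (104670301, 11,
     [2, 3, 5, 7, 49843])]⟩,
   ⟨157, 1, [156, 0, 0, 156, 0], [[11, 31, 1793161]], [(1793161, 14, [2, 3, 5, 17, 293])]⟩,
   ⟨163, 1, [162, 0, 0, 161, 0], [[11, 31, 1301, 1601]], []⟩,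
   ⟨167, 1, [165, 0, 166, 0, 0], [[71, 571, 19301]], [(19301, 2, [2, 5, 193])]⟩,
   ⟨13, 2, [11, 0, 10, 10, 10, 1, 6, 12, 3, 0], [[11, 2411, 30941]], [(30941, 2, [2, 5, 7, 13,
     17])]⟩,
   ⟨173, 1, [172, 0, 0, 172, 0], [[9431, 95531]], [(9431, 7, [2, 5, 23, 41]), (95531, 2, [2, 5,
     41, 233])]⟩,
   ⟨179, 1, [178, 0, 0, 176, 0], [[11, 93853931]], [(51853, 11, [2, 3, 29, 149]), (93853931, 2,
     [2, 5, 181, 51853])]⟩,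
   ⟨181, 1, [179, 0, 180, 0, 0], [[5, 11, 19622651]], [(19622651, 2, [2, 5, 601, 653])]⟩,
   ⟨191, 1, [189, 0, 0, 189, 0], [[5, 11, 1871, 13001]], [(13001, 3, [2, 5, 13])]⟩,
   ⟨193, 1, [192, 0, 0, 192, 0], [[1394714501]], [(1394714501, 2, [2, 5, 97, 149, 193])]⟩,
   ⟨197, 1, [195, 0, 196, 196, 0], [[661, 991, 2311]], []⟩,
   ⟨199, 1, [198, 0, 0, 198, 0], [[71, 22199431]], [(67271, 14, [2, 5, 7, 31]), (22199431, 7,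
     [2, 3, 5, 11, 67271])]⟩,
   ⟨211, 1, [208, 0, 0, 210, 0], [[5, 1361, 292661]], [(14633, 3, [2, 31, 59]), (292661, 2, [2,
     5, 14633])]⟩,
   ⟨241, 1, [238, 0, 239, 0, 0], [[5, 61, 11106421]], [(11106421, 2, [2, 3, 5, 13, 29, 491])]⟩,
   ⟨251, 1, [248, 0, 0, 250, 0], [[5, 11, 6586781]], [(5399, 7, [2, 2699]), (6586781, 2, [2, 5,
     61, 5399])]⟩,
   ⟨2, 8, [1, 0, 1, 1, 0, 1, 1, 0, 0, 0, 0, 0, 0, 0, 1, 0, 1, 1, 0, 0, 0, 1, 1, 0, 0, 1, 1, 1,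
     1, 1, 0, 1, 0, 1, 0, 1, 0, 1, 1, 0], [[5, 11, 31, 41, 61681]], [(61681, 29, [2, 3, 5,
     257])]⟩,
   ⟨271, 1, [269, 0, 0, 269, 0], [[5, 251, 4313591]], [(4447, 3, [2, 3, 13, 19]), (4313591, 17,
     [2, 5, 97, 4447])]⟩,
   ⟨281, 1, [279, 0, 279, 279, 0], [[5, 31, 271, 148961]], [(148961, 3, [2, 5, 7, 19])]⟩,
   ⟨283, 1, [280, 0, 0, 282, 0], [[31, 41, 5064511]], [(5064511, 11, [2, 3, 5, 11, 103, 149])]⟩,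
   ⟨311, 1, [308, 0, 310, 310, 0], [[5, 11, 170638711]], [(517087, 3, [2, 3, 23, 1249]),
     (170638711, 3, [2, 3, 5, 11, 517087])]⟩,
   ⟨331, 1, [328, 0, 330, 0, 0], [[5, 37861, 63601]], [(37861, 2, [2, 3, 5, 631]), (63601, 7,
     [2, 3, 5, 53])]⟩,
   ⟨19, 2, [13, 0, 10, 6, 14, 11, 4, 16, 5, 0], [[5, 11, 151, 911, 2251]], []⟩,
   ⟨401, 1, [397, 0, 400, 0, 0], [[5, 11, 1231, 382861]], [(382861, 6, [2, 3, 5, 709])]⟩,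
   ⟨421, 1, [419, 0, 420, 420, 0], [[5, 11, 181, 191, 16561]], [(16561, 7, [2, 3, 5, 23])]⟩,
   ⟨431, 1, [426, 0, 430, 429, 0], [[5, 71, 191, 510101]], [(5101, 6, [2, 3, 5, 17]), (510101,
     2, [2, 5, 5101])]⟩,
   ⟨461, 1, [459, 0, 460, 0, 0], [[5, 41, 61, 151, 23971]], [(23971, 10, [2, 3, 5, 17, 47])]⟩,
   ⟨491, 1, [489, 0, 0, 489, 0], [[5, 101, 191, 603791]], [(603791, 11, [2, 5, 11, 499])]⟩,
   ⟨521, 1, [518, 0, 0, 520, 0], [[5, 11, 17761, 75571]], [(17761, 19, [2, 3, 5, 37]), (75571,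
     2, [2, 3, 5, 11, 229])]⟩,
   ⟨541, 1, [538, 0, 0, 540, 0], [[5, 101, 169942181]], [(9623, 5, [2, 17, 283]), (169942181, 2,
     [2, 5, 883, 9623])]⟩,
   ⟨571, 1, [568, 0, 570, 0, 0], [[5, 1831, 11631811]], [(64621, 6, [2, 3, 5, 359]), (387727, 3,
     [2, 3, 64621]), (11631811, 2, [2, 3, 5, 387727])]⟩,
   ⟨601, 1, [599, 0, 600, 0, 0], [[5, 26136721201]], [(18257, 5, [2, 7, 163]), (26136721201, 13,
     [2, 3, 5, 1193, 18257])]⟩,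
   ⟨631, 1, [629, 0, 630, 630, 0], [[5, 11, 41, 1511, 46601]], [(46601, 3, [2, 5, 233])]⟩,
   ⟨641, 1, [635, 0, 0, 640, 0], [[5, 11, 4091, 751481]], [(4091, 2, [2, 5, 409]), (18787, 2,
     [2, 3, 31, 101]), (751481, 3, [2, 5, 18787])]⟩,
   ⟨661, 1, [659, 0, 0, 658, 0], [[5, 165811, 230611]], [(5527, 5, [2, 3, 307]), (165811, 7, [2,
     3, 5, 5527]), (7687, 6, [2, 3, 7, 61]), (230611, 2, [2, 3, 5, 7687])]⟩,
   ⟨691, 1, [688, 0, 689, 689, 0], [[5, 11, 61, 68053211]], [(4549, 6, [2, 3, 379]), (400313, 3,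
     [2, 11, 4549]), (68053211, 6, [2, 5, 17, 400313])]⟩,
   ⟨701, 1, [699, 0, 700, 0, 0], [[5, 101, 478851301]], [(478851301, 17, [2, 3, 5, 19, 41,
     683])]⟩,
   ⟨751, 1, [748, 0, 750, 750, 0], [[5, 11, 46061, 125731]], [(46061, 2, [2, 5, 7, 47]),
     (125731, 11, [2, 3, 5, 11, 127])]⟩,
   ⟨761, 1, [759, 0, 0, 759, 0], [[5, 67164484721]], [(65657, 3, [2, 29, 283]), (67164484721, 7,
     [2, 5, 19, 673, 65657])]⟩,
   ⟨811, 1, [809, 0, 810, 810, 0], [[5, 6781, 12774841]], [(6781, 2, [2, 3, 5, 113]), (12774841,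
     11, [2, 3, 5, 13, 19, 431])]⟩,
   ⟨821, 1, [819, 0, 820, 820, 0], [[5, 211, 241, 1789091]], [(178909, 7, [2, 3, 17, 877]),
     (1789091, 2, [2, 5, 178909])]⟩,
   ⟨29, 2, [9, 0, 18, 10, 24, 7, 8, 20, 9, 0], [[5, 11, 31, 401, 732541]], [(732541, 10, [2, 3,
     5, 29, 421])]⟩,
   ⟨881, 1, [877, 0, 0, 880, 0], [[5, 146521, 823241]], [(146521, 23, [2, 3, 5, 11, 37]),
     (823241, 3, [2, 5, 11, 1871])]⟩,
   ⟨911, 1, [908, 0, 910, 910, 0], [[5, 11, 701, 17884211]], [(17884211, 2, [2, 5, 31, 1861])]⟩,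
   ⟨941, 1, [939, 0, 940, 940, 0], [[5, 156982145081]], [(156982145081, 7, [2, 5, 43, 47, 907,
     2141])]⟩,
   ⟨31, 2, [2, 0, 8, 20, 17, 7, 16, 10, 30, 0], [[5, 11, 41, 17351, 21821]], [(17351, 11, [2, 5,
     347]), (21821, 2, [2, 5, 1091])]⟩,
   ⟨971, 1, [968, 0, 969, 0, 0], [[5, 11, 2371, 620351]], [(620351, 7, [2, 5, 19, 653])]⟩,
   ⟨991, 1, [989, 0, 0, 989, 0], [[5, 193091463181]], [(15377, 3, [2, 31]), (13931563, 2, [2, 3,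
     151, 15377]), (193091463181, 10, [2, 3, 5, 7, 11, 13931563])]⟩,
   ⟨1021, 1, [1019, 0, 1020, 0, 0], [[5, 11, 41, 1451, 332441]], [(8311, 3, [2, 3, 5, 277]),
     (332441, 3, [2, 5, 8311])]⟩,
   ⟨1031, 1, [1028, 0, 0, 1030, 0], [[5, 31, 7296664931]], [(93523, 2, [2, 3, 11, 13, 109]),
     (15524819, 2, [2, 83, 93523]), (7296664931, 2, [2, 5, 47, 15524819])]⟩,
   ⟨1051, 1, [1049, 0, 1050, 0, 0], [[5, 71, 241, 14275091]], [(1427509, 2, [2, 3, 19, 2087]),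
     (14275091, 2, [2, 5, 1427509])]⟩,
   ⟨1061, 1, [1058, 0, 1060, 0, 0], [[5, 11, 57901, 398311]], [(57901, 2, [2, 3, 5, 193]),
     (398311, 3, [2, 3, 5, 11, 17, 71])]⟩,
   ⟨1091, 1, [1089, 0, 1090, 1090, 0], [[5, 51431, 5514451]], [(51431, 7, [2, 5, 37, 139]),
     (5514451, 2, [2, 3, 5, 97, 379])]⟩,
   ⟨1151, 1, [1149, 0, 1150, 0, 0], [[5, 31, 991, 11435981]], [(3863, 5, [2, 1931]), (7727, 5,
     [2, 3863]), (571799, 7, [2, 37, 7727]), (11435981, 2, [2, 5, 571799])]⟩,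
   ⟨1171, 1, [1169, 0, 1170, 0, 0], [[5, 11, 34216526831]], [(110375893, 2, [2, 3, 11, 53,
     1753]), (34216526831, 7, [2, 5, 31, 110375893])]⟩,
   ⟨1181, 1, [1178, 0, 1179, 0, 0], [[5, 11, 140761, 251491]], [(140761, 7, [2, 3, 5, 17, 23]),
     (251491, 2, [2, 3, 5, 83, 101])]⟩,
   ⟨1201, 1, [1198, 0, 0, 1200, 0], [[5, 416450882401]], [(3541249, 7, [2, 3, 29, 53]),
     (416450882401, 41, [2, 3, 5, 7, 3541249])]⟩,
   ⟨1231, 1, [1229, 0, 0, 1229, 0], [[5, 3491, 131663471]], [(3491, 2, [2, 5, 349]), (774491, 2,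
     [2, 5, 41, 1889]), (131663471, 7, [2, 5, 17, 774491])]⟩,
   ⟨1291, 1, [1289, 0, 1290, 1290, 0], [[5, 11, 821, 5596841]], [(139921, 7, [2, 3, 5, 11, 53]),
     (5596841, 3, [2, 5, 139921])]⟩,
   ⟨1301, 1, [1299, 0, 1300, 0, 0], [[5, 11, 61, 854575831]], [(88741, 2, [2, 3, 5, 17, 29]),
     (854575831, 6, [2, 3, 5, 107, 88741])]⟩,
   ⟨1321, 1, [1319, 0, 1320, 0, 0], [[5, 211, 6091, 474241]], [(6091, 7, [2, 3, 5, 7, 29]),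
     (474241, 7, [2, 3, 5, 13, 19])]⟩,
   ⟨11, 3, [6, 0, 5, 6, 0, 6, 6, 4, 8, 10, 5, 4, 7, 5, 0], [[5, 3221, 195019441]], [(3221, 10,
     [2, 5, 7, 23]), (195019441, 13, [2, 3, 5, 7, 11, 61, 173])]⟩,
   ⟨1361, 1, [1359, 0, 1360, 1360, 0], [[5, 11831, 58044391]], [(11831, 7, [2, 5, 7, 13]),
     (23311, 3, [2, 3, 5, 7, 37]), (58044391, 3, [2, 3, 5, 83, 23311])]⟩,
   ⟨1381, 1, [1379, 0, 0, 1379, 0], [[5, 811, 1091, 822761]], [(822761, 3, [2, 5, 67, 307])]⟩,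
   ⟨1451, 1, [1449, 0, 1449, 0, 0], [[5, 41, 21637904461]], [(3717853, 2, [2, 3, 491, 631]),
     (21637904461, 2, [2, 3, 5, 97, 3717853])]⟩,
   ⟨1471, 1, [1469, 0, 1470, 1468, 0], [[5, 461, 691, 2941691]], [(294169, 11, [2, 3, 7, 17,
     103]), (2941691, 10, [2, 5, 294169])]⟩,
   ⟨1481, 1, [1479, 0, 0, 1478, 0], [[5, 962816607761]], [(21503, 5, [2, 13, 827]),
     (962816607761, 11, [2, 5, 7, 37, 2161, 21503])]⟩,
   ⟨1511, 1, [1509, 0, 0, 1508, 0], [[5, 11, 94838065111]], [(107713, 10, [2, 3, 11, 17]),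
     (94838065111, 3, [2, 3, 5, 1087, 107713])]⟩,
   ⟨1531, 1, [1529, 0, 0, 1529, 0], [[5, 691, 1591242871]], [(19993, 10, [2, 3, 7, 17]),
     (1591242871, 3, [2, 3, 5, 7, 379, 19993])]⟩,
   ⟨1571, 1, [1569, 0, 1570, 0, 0], [[5, 11, 31231, 3548401]], [(31231, 6, [2, 3, 5, 347]),
     (2957, 2, [2, 739]), (3548401, 7, [2, 3, 5, 2957])]⟩,
   ⟨1601, 1, [1599, 0, 0, 1598, 0], [[5, 80701, 16292501]], [(80701, 2, [2, 3, 5, 269]),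
     (16292501, 2, [2, 5, 7, 19])]⟩,
   ⟨1621, 1, [1619, 0, 1620, 0, 0], [[5, 11, 125613804731]], [(32833, 5, [2, 3, 19]),
     (12561380473, 5, [2, 3, 19, 839, 32833]), (125613804731, 2, [2, 5, 12561380473])]⟩,
   ⟨41, 2, [35, 0, 38, 34, 17, 35, 26, 19, 5, 0], [[5, 11, 61, 4111, 579281]], [(4111, 12, [2,
     3, 5, 137]), (579281, 11, [2, 5, 13, 557])]⟩,
   ⟨1721, 1, [1718, 0, 0, 1720, 0], [[5, 11, 31, 10781, 43411]], [(10781, 10, [2, 5, 7, 11]),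
     (43411, 3, [2, 3, 5, 1447])]⟩,
   ⟨1741, 1, [1739, 0, 1740, 1740, 0], [[5, 11, 167140584971]], [(3313, 10, [2, 3, 23]), (6569,
     3, [2, 821]), (16714058497, 5, [2, 3, 3313, 6569]), (167140584971, 2, [2, 5,
     16714058497])]⟩,
   ⟨1801, 1, [1799, 0, 0, 1799, 0], [[5, 101, 20845133501]], [(4813, 2, [2, 3, 401]), (683447,
     5, [2, 71, 4813]), (20845133501, 2, [2, 5, 61, 683447])]⟩,
   ⟨1811, 1, [1808, 0, 1810, 1810, 0], [[5, 5531, 389170591]], [(5531, 10, [2, 5, 7, 79]),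
     (5297, 3, [2, 331]), (389170591, 12, [2, 3, 5, 31, 79, 5297])]⟩,
   ⟨1831, 1, [1828, 0, 1829, 0, 0], [[5, 11, 31, 151, 43680671]], [(13693, 6, [2, 3, 7, 163]),
     (43680671, 13, [2, 5, 11, 29, 13693])]⟩,
   ⟨1861, 1, [1859, 0, 1859, 1859, 0], [[5, 41, 58541663681]], [(490463, 14, [2, 7, 53, 661]),
     (58541663681, 6, [2, 5, 373, 490463])]⟩,
   ⟨1871, 1, [1869, 0, 1870, 1870, 0], [[5, 71, 151, 228729421]], [(228729421, 2, [2, 3, 5, 271,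
     521])]⟩,
   ⟨1901, 1, [1899, 0, 1899, 0, 0], [[5, 11, 26951, 8814941]], [(26951, 7, [2, 5, 7, 11]),
     (8814941, 2, [2, 5, 613, 719])]⟩,
   ⟨1931, 1, [1929, 0, 1929, 0, 0], [[5, 55411, 50209751]], [(55411, 2, [2, 3, 5, 1847]),
     (50209751, 13, [2, 5, 107, 1877])]⟩,
   ⟨1951, 1, [1949, 0, 1949, 0, 0], [[5, 11, 263565793991]], [(62591, 7, [2, 5, 11, 569]),
     (2628823, 3, [2, 3, 7, 62591]), (26356579399, 3, [2, 3, 557, 2628823]), (263565793991, 11,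
     [2, 5, 26356579399])]⟩,
   ⟨2011, 1, [2008, 0, 2010, 2010, 0], [[5, 11, 297510026111]], [(6971, 2, [2, 5, 17, 41]),
     (19741873, 5, [2, 3, 59, 6971]), (297510026111, 7, [2, 5, 11, 137, 19741873])]⟩,
   ⟨2081, 1, [2078, 0, 0, 2080, 0], [[5, 31, 275251, 439781]], [(275251, 3, [2, 3, 5, 367]),
     (439781, 2, [2, 5, 11, 1999])]⟩,
   ⟨2111, 1, [2109, 0, 2109, 0, 0], [[5, 3973641721421]], [(134517323, 2, [2, 61, 571, 1931]),
     (3973641721421, 10, [2, 5, 7, 211, 134517323])]⟩,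
   ⟨2131, 1, [2127, 0, 2130, 0, 0], [[5, 4126364997061]], [(4943, 7, [2, 7, 353]), (968630281,
     7, [2, 3, 5, 23, 71, 4943]), (4126364997061, 7, [2, 3, 5, 71, 968630281])]⟩,
   ⟨2141, 1, [2139, 0, 0, 2139, 0], [[5, 31, 271, 6121, 81761]], [(6121, 7, [2, 3, 5, 17]),
     (81761, 12, [2, 5, 7, 73])]⟩,
   ⟨2161, 1, [2157, 0, 2160, 0, 0], [[5, 11, 396695609411]], [(5387, 2, [2, 2693]), (26021, 2,
     [2, 5, 1301]), (396695609411, 2, [2, 5, 283, 5387, 26021])]⟩,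
   ⟨2221, 1, [2219, 0, 0, 2217, 0], [[5, 271241, 17950001]], [(6781, 2, [2, 3, 5, 113]),
     (271241, 3, [2, 5, 6781]), (17950001, 3, [2, 5, 359])]⟩,
   ⟨2251, 1, [2249, 0, 0, 2248, 0], [[5, 41, 125297122061]], [(3691, 2, [2, 3, 5, 41]), (25717,
     2, [2, 3, 2143]), (154303, 5, [2, 3, 25717]), (125297122061, 2, [2, 5, 11, 3691, 154303])]⟩,
   ⟨2281, 1, [2279, 0, 0, 2278, 0], [[5, 11, 145031, 3395221]], [(14503, 3, [2, 3, 2417]),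
     (145031, 19, [2, 5, 14503]), (3395221, 2, [2, 3, 5, 71, 797])]⟩,
   ⟨2311, 1, [2309, 0, 2310, 0, 0], [[5, 2591, 4001, 550531]], [(4001, 3, [2, 5]), (550531, 2,
     [2, 3, 5, 2039])]⟩,
   ⟨2341, 1, [2339, 0, 2339, 0, 0], [[5, 11, 31, 191, 92264251]], [(9463, 3, [2, 3, 19, 83]),
     (92264251, 2, [2, 3, 5, 13, 9463])]⟩,
   ⟨2351, 1, [2348, 0, 0, 2347, 0], [[5, 1871, 3267017731]], [(3001, 14, [2, 3, 5]), (378127, 5,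
     [2, 3, 7, 3001]), (9075049, 17, [2, 3, 378127]), (36300197, 2, [2, 9075049]), (3267017731,
     2, [2, 3, 5, 36300197])]⟩,
   ⟨2371, 1, [2369, 0, 0, 2368, 0], [[5, 77551, 81536491]], [(77551, 6, [2, 3, 5, 11, 47]),
     (6163, 3, [2, 3, 13, 79]), (81536491, 3, [2, 3, 5, 7, 6163])]⟩,
   ⟨2381, 1, [2378, 0, 2379, 0, 0], [[5, 11, 331, 1766157121]], [(1766157121, 19, [2, 3, 5, 7,
     13, 23, 293])]⟩,
   ⟨7, 4, [2, 0, 1, 5, 1, 1, 1, 2, 3, 5, 5, 5, 6, 3, 1, 5, 3, 2, 3, 0], [[5, 11, 191, 281, 2801,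
     4021]], [(4021, 2, [2, 3, 5, 67])]⟩,
   ⟨2411, 1, [2408, 0, 2409, 0, 0], [[5, 131, 2531, 20390861]], [(20807, 5, [2, 101, 103]),
     (20390861, 11, [2, 5, 7, 20807])]⟩,
   ⟨2441, 1, [2437, 0, 0, 2439, 0], [[5, 331, 21461055251]], [(125687, 5, [2, 11, 29, 197]),
     (21461055251, 2, [2, 5, 683, 125687])]⟩,
   ⟨2521, 1, [2519, 0, 2520, 2520, 0], [[5, 61, 132484126981]], [(52543, 3, [2, 3, 7, 139]),
     (1261033, 5, [2, 3, 52543]), (132484126981, 6, [2, 3, 5, 17, 103, 1261033])]⟩,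
   ⟨2531, 1, [2529, 0, 2529, 0, 0], [[5, 1721, 17971, 265471]], [(17971, 3, [2, 3, 5, 599]),
     (8849, 3, [2, 7, 79]), (265471, 3, [2, 3, 5, 8849])]⟩,
   ⟨2551, 1, [2549, 0, 0, 2547, 0], [[5, 2221, 3814991281]], [(4861, 11, [2, 3, 5]), (48611, 2,
     [2, 5, 4861]), (3814991281, 11, [2, 3, 5, 109, 48611])]⟩,
   ⟨2591, 1, [2589, 0, 0, 2589, 0], [[5, 9017108522381]], [(1350469, 6, [2, 3, 7, 23, 233]),
     (9017108522381, 10, [2, 5, 7, 37, 1289, 1350469])]⟩,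
   ⟨2621, 1, [2619, 0, 2620, 0, 0], [[5, 11, 102451, 8378281]], [(102451, 3, [2, 3, 5, 683]),
     (8378281, 26, [2, 3, 5, 17, 37])]⟩,
   ⟨2671, 1, [2669, 0, 0, 2669, 0], [[5, 11, 571, 147389551]], [(147389551, 3, [2, 3, 5, 7, 11,
     1823])]⟩,
   ⟨2711, 1, [2709, 0, 0, 2709, 0], [[5, 11, 982461651511]], [(48073, 5, [2, 3, 2003]), (681229,
     7, [2, 3, 127, 149]), (982461651511, 6, [2, 3, 5, 48073, 681229])]⟩,
   ⟨2731, 1, [2728, 0, 0, 2730, 0], [[5, 11, 1011773182751]], [(4567, 3, [2, 3, 761]),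
     (367917521, 3, [2, 5, 19, 53, 4567]), (1011773182751, 7, [2, 5, 11, 367917521])]⟩,
   ⟨2741, 1, [2739, 0, 2739, 2739, 0], [[5, 701, 16110409981]], [(38358119, 7, [2, 83, 311,
     743]), (16110409981, 11, [2, 3, 5, 7, 38358119])]⟩,
   ⟨2791, 1, [2789, 0, 2790, 2790, 0], [[5, 12140175774781]], [(11043953, 3, [2, 743, 929]),
     (12140175774781, 10, [2, 3, 5, 31, 197, 11043953])]⟩,
   ⟨2801, 1, [2799, 0, 0, 2798, 0], [[5, 1956611, 6294091]], [(1956611, 6, [2, 5, 23, 47, 181]),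
     (19073, 3, [2, 149]), (6294091, 10, [2, 3, 5, 11, 19073])]⟩,
   ⟨2851, 1, [2849, 0, 0, 2849, 0], [[5, 311, 1811, 23468881]], [(3761, 3, [2, 5, 47]), (97787,
     2, [2, 13, 3761]), (23468881, 11, [2, 3, 5, 97787])]⟩,
   ⟨2861, 1, [2859, 0, 2860, 2860, 0], [[5, 92941, 144226781]], [(92941, 2, [2, 3, 5, 1549]),
     (144226781, 2, [2, 5, 53, 103, 1321])]⟩]

/-- Good elements of `F_{q^6}` for small `q`. -/
def witnessesSix : List FieldWitness :=
  [⟨5, 1, [3, 0, 0, 3, 4, 0], [[2, 3], [31], [7]], []⟩,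
   ⟨7, 1, [2, 0, 6, 6, 5, 0], [[2], [3, 19], [43]], []⟩,
   ⟨11, 1, [9, 0, 10, 9, 9, 0], [[2, 3], [7, 19], [37]], []⟩,
   ⟨13, 1, [11, 0, 12, 10, 12, 0], [[2, 7], [3, 61], [157]], []⟩,
   ⟨17, 1, [14, 0, 15, 15, 0, 0], [[2, 3], [307], [7, 13]], []⟩,
   ⟨19, 1, [17, 0, 18, 17, 17, 0], [[2, 5], [3, 127], [7]], []⟩,
   ⟨23, 1, [18, 0, 22, 21, 0, 0], [[2, 3], [7, 79], [13]], []⟩,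
   ⟨5, 2, [2, 0, 3, 4, 4, 2, 3, 0, 2, 3, 0, 0], [[2, 13], [3, 7, 31], [601]], []⟩,
   ⟨29, 1, [26, 0, 0, 27, 28, 0], [[2, 3, 5], [13, 67], [271]], []⟩,
   ⟨31, 1, [28, 0, 29, 29, 0, 0], [[2], [3, 331], [7, 19]], []⟩,
   ⟨37, 1, [35, 0, 36, 36, 0, 0], [[2, 19], [3, 7, 67], [31, 43]], []⟩,
   ⟨41, 1, [38, 0, 40, 40, 39, 0], [[2, 3, 7], [1723], [547]], []⟩,
   ⟨43, 1, [40, 0, 42, 42, 42, 0], [[2, 11], [3, 631], [13, 139]], []⟩,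
   ⟨47, 1, [42, 0, 0, 46, 45, 0], [[2, 3], [37, 61], [7, 103]], []⟩,
   ⟨7, 2, [2, 0, 1, 1, 6, 1, 3, 1, 0, 3, 1, 0], [[2, 5], [3, 19, 43], [13, 181]], []⟩,
   ⟨53, 1, [50, 0, 0, 52, 50, 0], [[2, 3], [7, 409], [919]], []⟩,
   ⟨59, 1, [57, 0, 0, 58, 57, 0], [[2, 3, 5], [3541], [7, 163]], [(3541, 7, [2, 3, 5, 59])]⟩,
   ⟨61, 1, [59, 0, 59, 60, 60, 0], [[2, 31], [3, 13, 97], [7, 523]], []⟩,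
   ⟨67, 1, [65, 0, 0, 66, 66, 0], [[2, 17], [3, 7, 31], [4423]], [(4423, 3, [2, 3, 11, 67])]⟩,
   ⟨71, 1, [64, 0, 0, 70, 69, 0], [[2, 3], [5113], [1657]], [(5113, 19, [2, 3, 71])]⟩,
   ⟨73, 1, [68, 0, 0, 72, 72, 0], [[2, 37], [3, 1801], [7, 751]], []⟩,
   ⟨79, 1, [76, 0, 78, 77, 0, 0], [[2, 5], [3, 7, 43], [6163]], [(6163, 3, [2, 3, 13, 79])]⟩,
   ⟨83, 1, [81, 0, 82, 82, 0, 0], [[2, 3, 7], [19, 367], [2269]], []⟩,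
   ⟨89, 1, [86, 0, 87, 88, 88, 0], [[2, 3, 5], [8011], [7, 373]], [(8011, 14, [2, 3, 5, 89])]⟩,
   ⟨97, 1, [92, 0, 96, 95, 0, 0], [[2, 7], [3, 3169], [67, 139]], [(3169, 7, [2, 3, 11])]⟩,
   ⟨101, 1, [99, 0, 0, 99, 98, 0], [[2, 3, 17], [10303], [7, 13, 37]], [(10303, 3, [2, 3, 17,
     101])]⟩,
   ⟨103, 1, [98, 0, 100, 102, 0, 0], [[2, 13], [3, 3571], [7, 19, 79]], [(3571, 2, [2, 3, 5, 7,
     17])]⟩,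
   ⟨107, 1, [105, 0, 106, 106, 0, 0], [[2, 3], [7, 13, 127], [19, 199]], []⟩,
   ⟨109, 1, [103, 0, 108, 107, 108, 0], [[2, 5, 11], [3, 7, 571], [61, 193]], []⟩,
   ⟨113, 1, [110, 0, 0, 110, 112, 0], [[2, 3, 19], [13, 991], [4219]], [(4219, 2, [2, 3, 19,
     37])]⟩,
   ⟨11, 2, [4, 0, 0, 0, 8, 10, 4, 9, 2, 6, 9, 0], [[2, 61], [3, 7, 19, 37], [13, 1117]], []⟩,
   ⟨5, 3, [2, 0, 3, 4, 2, 3, 3, 3, 0, 3, 4, 4, 2, 1, 1, 0, 0, 0], [[2, 3, 7], [19, 829],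
     [5167]], [(5167, 6, [2, 3, 7, 41])]⟩,
   ⟨127, 1, [124, 0, 126, 125, 126, 0], [[2], [3, 5419], [13, 1231]], [(5419, 3, [2, 3, 7,
     43])]⟩,
   ⟨131, 1, [129, 0, 0, 129, 130, 0], [[2, 3, 11], [17293], [7, 811]], [(17293, 7, [2, 3, 11,
     131])]⟩,
   ⟨137, 1, [134, 0, 135, 135, 0, 0], [[2, 3, 23], [7, 37, 73], [6211]], [(6211, 2, [2, 3, 5,
     23])]⟩,
   ⟨139, 1, [137, 0, 0, 137, 138, 0], [[2, 5, 7], [3, 13, 499], [19183]], [(19183, 3, [2, 3, 23,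
     139])]⟩,
   ⟨149, 1, [147, 0, 0, 148, 147, 0], [[2, 3, 5], [7, 31, 103], [7351]], [(7351, 6, [2, 3, 5,
     7])]⟩,
   ⟨151, 1, [145, 0, 150, 149, 0, 0], [[2, 19], [3, 7, 1093], [22651]], [(22651, 3, [2, 3, 5,
     151])]⟩,
   ⟨157, 1, [152, 0, 0, 156, 156, 0], [[2, 79], [3, 8269], [7, 3499]], [(8269, 2, [2, 3, 13,
     53]), (3499, 2, [2, 3, 11, 53])]⟩,
   ⟨163, 1, [161, 0, 0, 160, 162, 0], [[2, 41], [3, 7, 19, 67], [26407]], [(26407, 5, [2, 3,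
     163])]⟩,
   ⟨167, 1, [162, 0, 166, 166, 0, 0], [[2, 3, 7], [28057], [9241]], [(28057, 5, [2, 3, 7, 167]),
     (9241, 13, [2, 3, 5, 7, 11])]⟩,
   ⟨13, 2, [11, 0, 11, 4, 3, 7, 1, 4, 8, 5, 7, 0], [[2, 5, 17], [3, 61, 157], [28393]], [(28393,
     15, [2, 3, 7, 13])]⟩,
   ⟨173, 1, [171, 0, 0, 172, 170, 0], [[2, 3, 29], [30103], [7, 13, 109]], [(30103, 3, [2, 3,
     29, 173])]⟩,
   ⟨179, 1, [177, 0, 177, 177, 0, 0], [[2, 3, 5], [7, 4603], [13, 19, 43]], [(4603, 2, [2, 3,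
     13, 59])]⟩,
   ⟨181, 1, [179, 0, 0, 180, 179, 0], [[2, 7, 13], [3, 79, 139], [31, 1051]], []⟩,
   ⟨191, 1, [184, 0, 0, 190, 190, 0], [[2, 3], [7, 13, 31], [12097]], [(12097, 5, [2, 3, 7])]⟩,
   ⟨193, 1, [188, 0, 0, 191, 191, 0], [[2, 97], [3, 7, 1783], [37057]], [(37057, 5, [2, 3,
     193])]⟩,
   ⟨197, 1, [195, 0, 0, 196, 195, 0], [[2, 3, 11], [19, 2053], [61, 211]], []⟩,
   ⟨199, 1, [196, 0, 198, 196, 0, 0], [[2, 5], [3, 13267], [7, 13, 433]], [(13267, 3, [2, 3, 11,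
     67])]⟩,
   ⟨211, 1, [209, 0, 209, 209, 0, 0], [[2, 53], [3, 13, 31, 37], [73, 607]], []⟩,
   ⟨223, 1, [220, 0, 0, 222, 221, 0], [[2, 7], [3, 16651], [31, 1597]], [(16651, 2, [2, 3, 5,
     37])]⟩,
   ⟨227, 1, [225, 0, 226, 226, 0, 0], [[2, 3, 19], [73, 709], [7, 349]], []⟩,
   ⟨229, 1, [222, 0, 227, 228, 0, 0], [[2, 5, 23], [3, 97, 181], [7, 7459]], [(7459, 2, [2, 3,
     11, 113])]⟩,
   ⟨233, 1, [230, 0, 0, 231, 232, 0], [[2, 3, 13], [7, 7789], [37, 487]], [(7789, 2, [2, 3, 11,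
     59])]⟩,
   ⟨239, 1, [232, 0, 0, 238, 238, 0], [[2, 3, 5], [19, 3019], [67, 283]], [(3019, 2, [2, 3,
     503])]⟩,
   ⟨241, 1, [234, 0, 240, 239, 0, 0], [[2, 11], [3, 19441], [7, 8263]], [(19441, 13, [2, 3, 5]),
     (8263, 3, [2, 3, 17])]⟩,
   ⟨251, 1, [249, 0, 0, 250, 249, 0], [[2, 3, 7], [43, 1471], [13, 1609]], []⟩,
   ⟨257, 1, [254, 0, 256, 255, 255, 0], [[2, 3, 43], [61, 1087], [7, 13, 241]], []⟩,
   ⟨263, 1, [258, 0, 261, 261, 0, 0], [[2, 3, 11], [7, 13, 109], [103, 223]], []⟩,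
   ⟨269, 1, [267, 0, 0, 268, 265, 0], [[2, 3, 5], [13, 37, 151], [7, 3433]], [(3433, 5, [2, 3,
     11, 13])]⟩,
   ⟨271, 1, [265, 0, 270, 270, 268, 0], [[2, 17], [3, 24571], [7, 10453]], [(24571, 7, [2, 3, 5,
     7, 13]), (10453, 5, [2, 3, 13, 67])]⟩,
   ⟨277, 1, [272, 0, 276, 276, 275, 0], [[2, 139], [3, 7, 19, 193], [13, 5881]], [(5881, 31, [2,
     3, 5, 7])]⟩,
   ⟨281, 1, [278, 0, 280, 279, 280, 0], [[2, 3, 47], [109, 727], [26227]], [(26227, 3, [2, 3,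
     31, 47])]⟩,
   ⟨283, 1, [280, 0, 0, 282, 282, 0], [[2, 71], [3, 73, 367], [7, 13, 877]], []⟩,
   ⟨17, 2, [6, 0, 10, 0, 12, 9, 14, 14, 2, 10, 14, 0], [[2, 5, 29], [3, 7, 13, 307], [83233]],
     [(83233, 7, [2, 3, 17])]⟩,
   ⟨293, 1, [291, 0, 0, 291, 292, 0], [[2, 3, 7], [86143], [19, 79]], [(86143, 3, [2, 3, 7,
     293])]⟩,
   ⟨307, 1, [302, 0, 305, 306, 0, 0], [[2, 7, 11], [3, 43, 733], [37, 2539]], []⟩,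
   ⟨311, 1, [300, 0, 309, 308, 0, 0], [[2, 3, 13], [19, 5107], [7, 4591]], [(5107, 2, [2, 3, 23,
     37]), (4591, 11, [2, 3, 5, 17])]⟩,
   ⟨313, 1, [303, 0, 0, 311, 312, 0], [[2, 157], [3, 181], [7, 1993]], []⟩,
   ⟨317, 1, [315, 0, 0, 316, 316, 0], [[2, 3, 53], [7, 14401], [33391]], [(14401, 11, [2, 3,
     5]), (33391, 6, [2, 3, 5, 7, 53])]⟩,
   ⟨331, 1, [329, 0, 0, 330, 328, 0], [[2, 83], [3, 7, 5233], [19, 5749]], [(5233, 10, [2, 3,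
     109]), (5749, 2, [2, 3, 479])]⟩,
   ⟨337, 1, [327, 0, 0, 334, 336, 0], [[2, 13], [3, 43, 883], [113233]], [(113233, 5, [2, 3, 7,
     337])]⟩,
   ⟨7, 3, [2, 0, 0, 2, 1, 5, 3, 5, 3, 2, 4, 2, 3, 6, 6, 1, 3, 0], [[2, 43], [3, 37, 1063],
     [117307]], [(117307, 5, [2, 3, 7, 19])]⟩,
   ⟨347, 1, [342, 0, 0, 346, 346, 0], [[2, 3, 29], [7, 13, 1327], [31, 1291]], []⟩,
   ⟨349, 1, [347, 0, 348, 348, 348, 0], [[2, 5, 7], [3, 19, 2143], [121453]], [(121453, 6, [2,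
     3, 29, 349])]⟩,
   ⟨353, 1, [350, 0, 352, 352, 352, 0], [[2, 3, 59], [19, 6577], [7, 61, 97]], [(6577, 5, [2, 3,
     137])]⟩,
   ⟨359, 1, [352, 0, 0, 358, 357, 0], [[2, 3, 5], [7, 37, 499], [42841]], [(42841, 23, [2, 3, 5,
     7, 17])]⟩,
   ⟨19, 2, [16, 0, 11, 12, 7, 10, 4, 13, 11, 5, 17, 0], [[2, 181], [3, 7, 127], [13, 769]], []⟩,
   ⟨367, 1, [361, 0, 365, 365, 0, 0], [[2, 23], [3, 13, 3463], [7, 31, 619]], [(3463, 3, [2, 3,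
     577])]⟩,
   ⟨373, 1, [371, 0, 372, 372, 0, 0], [[2, 11, 17], [3, 7, 13, 73], [19, 67, 109]], []⟩,
   ⟨379, 1, [376, 0, 378, 378, 0, 0], [[2, 5, 19], [3, 61, 787], [143263]], [(143263, 29, [2, 3,
     7, 379])]⟩,
   ⟨383, 1, [378, 0, 382, 380, 0, 0], [[2, 3], [147073], [7, 6967]], [(147073, 5, [2, 3, 383]),
     (6967, 5, [2, 3, 43])]⟩,
   ⟨389, 1, [386, 0, 0, 388, 388, 0], [[2, 3, 5, 13], [7, 21673], [50311]], [(21673, 10, [2, 3,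
     7, 43]), (50311, 3, [2, 3, 5, 13, 43])]⟩,
   ⟨397, 1, [392, 0, 395, 396, 0, 0], [[2, 199], [3, 31, 1699], [7, 37, 607]], []⟩,
   ⟨401, 1, [398, 0, 400, 400, 0, 0], [[2, 3, 67], [7, 23029], [127, 421]], [(23029, 2, [2, 3,
     19, 101])]⟩,
   ⟨409, 1, [402, 0, 408, 408, 0, 0], [[2, 5, 41], [3, 55897], [7, 31, 769]], [(55897, 5, [2, 3,
     17, 137])]⟩,
   ⟨419, 1, [417, 0, 0, 417, 418, 0], [[2, 3, 5, 7], [13, 13537], [79, 739]], [(13537, 7, [2, 3,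
     47])]⟩,
   ⟨421, 1, [419, 0, 0, 420, 419, 0], [[2, 211], [3, 59221], [151, 1171]], [(59221, 2, [2, 3, 5,
     7, 47])]⟩,
   ⟨431, 1, [424, 0, 0, 429, 429, 0], [[2, 3], [7, 67, 397], [163, 379]], []⟩,
   ⟨433, 1, [428, 0, 0, 431, 432, 0], [[2, 7, 31], [3, 37, 1693], [13, 14389]], [(14389, 2, [2,
     3, 11, 109])]⟩,
   ⟨439, 1, [422, 0, 438, 438, 0, 0], [[2, 5, 11], [3, 31, 67], [7, 13, 2113]], []⟩,
   ⟨443, 1, [441, 0, 442, 442, 442, 0], [[2, 3, 37], [7, 28099], [65269]], [(28099, 2, [2, 3, 7,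
     223]), (65269, 2, [2, 3, 7, 37])]⟩,
   ⟨449, 1, [446, 0, 0, 448, 445, 0], [[2, 3, 5], [97, 2083], [19, 3529]], [(3529, 17, [2, 3,
     7])]⟩,
   ⟨457, 1, [444, 0, 456, 455, 0, 0], [[2, 229], [3, 7, 9967], [208393]], [(9967, 3, [2, 3, 11,
     151]), (208393, 5, [2, 3, 19, 457])]⟩,
   ⟨461, 1, [459, 0, 0, 458, 460, 0], [[2, 3, 7, 11], [373, 571], [70687]], [(70687, 5, [2, 3,
     7, 11, 17])]⟩,
   ⟨463, 1, [460, 0, 462, 461, 0, 0], [[2, 29], [3, 19, 3769], [409, 523]], [(3769, 7, [2, 3,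
     157])]⟩,
   ⟨467, 1, [465, 0, 464, 466, 466, 0], [[2, 3, 13], [19, 11503], [7, 43, 241]], [(11503, 3, [2,
     3, 71])]⟩,
   ⟨479, 1, [466, 0, 477, 477, 0, 0], [[2, 3, 5], [43, 5347], [7, 10903]], [(5347, 3, [2, 3,
     11]), (10903, 3, [2, 3, 23, 79])]⟩,
   ⟨487, 1, [484, 0, 486, 485, 0, 0], [[2, 61], [3, 7, 11317], [19, 12457]], [(11317, 2, [2, 3,
     23, 41]), (12457, 10, [2, 3, 173])]⟩,
   ⟨491, 1, [489, 0, 490, 490, 490, 0], [[2, 3, 41], [37, 6529], [13, 31, 199]], [(6529, 7, [2,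
     3, 17])]⟩,
   ⟨499, 1, [492, 0, 0, 497, 498, 0], [[2, 5], [3, 7, 109], [67, 3709]], [(3709, 2, [2, 3,
     103])]⟩,
   ⟨503, 1, [498, 0, 500, 502, 502, 0], [[2, 3, 7], [13, 19501], [73, 1153]], [(19501, 2, [2, 3,
     5, 13])]⟩,
   ⟨509, 1, [507, 0, 504, 508, 0, 0], [[2, 3, 5, 17], [43, 6037], [7, 1759]], [(6037, 5, [2, 3,
     503])]⟩,
   ⟨521, 1, [518, 0, 0, 518, 520, 0], [[2, 3, 29], [31, 283], [7, 19, 97]], []⟩,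
   ⟨523, 1, [521, 0, 0, 522, 521, 0], [[2, 131], [3, 13, 7027], [7, 43, 907]], [(7027, 2, [2, 3,
     1171])]⟩,
   ⟨23, 2, [12, 0, 4, 10, 10, 3, 15, 18, 4, 4, 12, 0], [[2, 5, 53], [3, 7, 13, 79], [37, 7549]],
     [(7549, 2, [2, 3, 17, 37])]⟩,
   ⟨541, 1, [539, 0, 0, 540, 538, 0], [[2, 271], [3, 7, 13963], [292141]], [(13963, 3, [2, 3,
     13, 179]), (292141, 7, [2, 3, 5, 541])]⟩,
   ⟨547, 1, [545, 0, 546, 546, 0, 0], [[2, 137], [3, 163, 613], [97, 3079]], [(3079, 6, [2, 3,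
     19])]⟩,
   ⟨557, 1, [554, 0, 0, 556, 556, 0], [[2, 3, 31], [7, 6343], [103231]], [(6343, 3, [2, 3, 7,
     151]), (103231, 3, [2, 3, 5, 31, 37])]⟩,
   ⟨563, 1, [561, 0, 562, 562, 560, 0], [[2, 3, 47], [31, 10243], [7, 13, 19, 61]], [(10243, 7,
     [2, 3, 569])]⟩,
   ⟨569, 1, [566, 0, 0, 567, 566, 0], [[2, 3, 5, 19], [7, 6619], [13, 8287]], [(6619, 2, [2, 3,
     1103]), (8287, 3, [2, 3, 1381])]⟩,
   ⟨571, 1, [568, 0, 0, 570, 570, 0], [[2, 11, 13], [3, 7, 103, 151], [271, 1201]], []⟩,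
   ⟨577, 1, [572, 0, 0, 575, 575, 0], [[2, 17], [3, 19, 5851], [7, 79, 601]], [(5851, 2, [2, 3,
     5, 13])]⟩,
   ⟨587, 1, [585, 0, 0, 585, 584, 0], [[2, 3, 7], [547, 631], [114661]], [(114661, 2, [2, 3, 5,
     7, 13])]⟩,
   ⟨593, 1, [590, 0, 0, 591, 591, 0], [[2, 3, 11], [163, 2161], [7, 73, 229]], []⟩,
   ⟨599, 1, [592, 0, 598, 598, 0, 0], [[2, 3, 5], [7, 51343], [139, 859]], [(51343, 5, [2, 3,
     43, 199])]⟩,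
   ⟨601, 1, [594, 0, 0, 600, 600, 0], [[2, 7, 43], [3, 13, 9277], [19, 18979]], [(9277, 5, [2,
     3, 773]), (3163, 3, [2, 3, 17, 31]), (18979, 2, [2, 3, 3163])]⟩,
   ⟨607, 1, [604, 0, 606, 606, 605, 0], [[2, 19], [3, 13, 9463], [7, 7507]], [(9463, 3, [2, 3,
     19, 83]), (7507, 2, [2, 3, 139])]⟩,
   ⟨613, 1, [611, 0, 0, 612, 611, 0], [[2, 307], [3, 7, 17923], [375157]], [(17923, 2, [2, 3,
     29, 103]), (375157, 5, [2, 3, 17, 613])]⟩,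
   ⟨617, 1, [614, 0, 615, 616, 0, 0], [[2, 3, 103], [97, 3931], [126691]], [(3931, 2, [2, 3, 5,
     131]), (126691, 2, [2, 3, 5, 41, 103])]⟩,
   ⟨619, 1, [617, 0, 0, 618, 618, 0], [[2, 5, 31], [3, 19, 6733], [7, 37, 211]], [(6733, 2, [2,
     3, 11, 17])]⟩,
   ⟨5, 4, [3, 0, 2, 0, 1, 2, 2, 2, 3, 1, 4, 0, 1, 2, 3, 2, 1, 4, 2, 1, 1, 2, 1, 0], [[2, 313],
     [3, 7, 31, 601], [390001]], [(390001, 7, [2, 3, 5, 13])]⟩,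
   ⟨631, 1, [628, 0, 630, 630, 0, 0], [[2, 79], [3, 307, 433], [331, 1201]], []⟩,
   ⟨641, 1, [638, 0, 639, 637, 0, 0], [[2, 3, 107], [7, 58789], [13, 67, 157]], [(58789, 2, [2,
     3, 23, 71])]⟩,
   ⟨643, 1, [632, 0, 0, 642, 642, 0], [[2, 7, 23], [3, 97, 1423], [412807]], [(412807, 3, [2, 3,
     107, 643])]⟩,
   ⟨647, 1, [642, 0, 646, 646, 0, 0], [[2, 3], [211, 1987], [7, 13, 1531]], []⟩]

theorem witnessesFive_check : witnessesFive.all (witnessCheck resolventFive 5 [[1]]) = true := by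
  decide +kernel

theorem witnessesSix_check : witnessesSix.all
    (witnessCheck resolventSix 6 [[1, 0, 1, 0, 1], [1, 0, 0, 1], [1, 2, 2, 1]]) = true := by
  decide +kernel

/-- `q` is the product of two coprime factors, the smaller one below `54`. -/
def hasCoprimeFactor (q : ℕ) : Bool :=
  (List.range 54).any fun a =>
    (Nat.blt 1 a).and <| (Nat.blt 1 (q / a)).and <| (Nat.beq (a * (q / a)) q).and <|
      Nat.beq (Nat.gcd a (q / a)) 1

theorem not_isPrimePow_of_hasCoprimeFactor {q : ℕ} (h : hasCoprimeFactor q = true) :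
    ¬IsPrimePow q := by
  intro hq
  simp only [hasCoprimeFactor, List.any_eq_true, Bool.and_eq_true, Nat.blt_eq, Nat.beq_eq] at h
  obtain ⟨a, -, ha, hb, hab, hgcd⟩ := h
  have h1 := (Nat.Coprime.isPrimePow_dvd_mul hgcd hq).mp hab.symm.dvd
  generalize q / a = b at *
  subst hab
  rcases h1 with h1 | h1
  · have := Nat.le_of_dvd (by omega) h1
    nlinarith
  · have := Nat.le_of_dvd (by omega) h1
    nlinarith

/-- Every prime power below `bound` satisfying `cond` is the order of the base field of one of the
witnesses. -/
def coverageCheck (cond : ℕ → Bool) (bound : ℕ) (ws : List FieldWitness) : Bool :=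
  (List.range bound).all fun q => (cond q).not.or <| (Nat.ble q 1).or <|
    (hasCoprimeFactor q).or <| ws.any fun w => Nat.beq (w.p ^ w.k) q

theorem exists_witness_of_coverageCheck {cond : ℕ → Bool} {bound : ℕ} {ws : List FieldWitness}
    (h : coverageCheck cond bound ws = true) {q : ℕ} (hq : IsPrimePow q) (hcond : cond q = true)
    (hlt : q < bound) : ∃ w ∈ ws, q = w.p ^ w.k := by
  have h1 := List.all_eq_true.mp h q (List.mem_range.mpr hlt)
  simp only [hcond, Bool.not_true, Bool.false_or, Bool.or_eq_true, List.any_eq_true,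
    Nat.beq_eq, Nat.ble_eq] at h1
  rcases h1 with h1 | h1 | ⟨w, hw, h1⟩
  · exact absurd hq.one_lt (by omega)
  · exact absurd hq (not_isPrimePow_of_hasCoprimeFactor h1)
  · exact ⟨w, hw, h1.symm⟩

/-- The field orders, prime to five, that are left to the witnesses. -/
def isExceptionalFive (q : ℕ) : Bool :=
  (Nat.beq (q % 5) 1).or <| (Nat.blt 0 (q % 5)).and <|
    (Nat.beq q 4).not.and <| (Nat.blt q 208).or <| (Nat.blt 278 q).and (Nat.blt q 286)

theorem witnessesFive_coverage : coverageCheck isExceptionalFive 2904 witnessesFive = true := by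
  decide +kernel

theorem witnessesSix_coverage :
    coverageCheck (fun q => Nat.beq (Nat.gcd q 6) 1) 650 witnessesSix = true := by
  decide +kernel

section

variable {k F Ω : Type*} [Field k] [Fintype k] [Field F] [Fintype F] [Algebra k F]
  [Field Ω] [Algebra F Ω]

theorem exists_isGoodElement_five (hdim : Module.finrank k F = 5) {ζ : Ω}
    (hζ : IsPrimitiveRoot ζ 5) {q : ℕ} (hqk : Fintype.card k = q) (hpp : IsPrimePow q)
    (hq5 : Nat.gcd q 5 = 1) (hq4 : q ≠ 4) : ∃ α : F, IsGoodElement k Ω α := by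
  have hq0 : q % 5 ≠ 0 := fun h => by
    rw [Nat.gcd_eq_right (Nat.dvd_of_mod_eq_zero h)] at hq5
    omega
  by_cases hlarge : 2904 ≤ q
  · exact exists_isGoodElement_five_of_large hdim hζ hqk hlarge
  by_cases hex : isExceptionalFive q = true
  · obtain ⟨w, hw, hqw⟩ := exists_witness_of_coverageCheck witnessesFive_coverage hpp hex (by omega)
    exact FieldWitness.exists_isGoodElement_five hdim (hqk.trans hqw)
      (List.all_eq_true.mp witnessesFive_check w hw)
  · simp only [isExceptionalFive, Bool.or_eq_true, Bool.and_eq_true, Nat.beq_eq, Nat.blt_eq,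
      Bool.not_eq_true', ← Bool.not_eq_true] at hex
    exact exists_isGoodElement_five_of_mod_ne hdim hζ hqk (by omega) hq0 (by omega) (by omega)

theorem exists_isGoodElement_six (hdim : Module.finrank k F = 6) {ζ : Ω}
    (hζ : IsPrimitiveRoot ζ 6) {q : ℕ} (hqk : Fintype.card k = q) (hpp : IsPrimePow q)
    (hq6 : Nat.gcd q 6 = 1) : ∃ α : F, IsGoodElement k Ω α := by
  by_cases hlarge : 650 ≤ q
  · exact exists_isGoodElement_six_of_large hdim hζ hqk hq6 hlarge
  · obtain ⟨w, hw, hqw⟩ := exists_witness_of_coverageCheck witnessesSix_coverage hpp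
      (Nat.beq_eq.mpr hq6) (by omega)
    exact FieldWitness.exists_isGoodElement_six hdim (hqk.trans hqw)
      (List.all_eq_true.mp witnessesSix_check w hw)

end

end

theorem pow_eq_one_of_sum_eq_pow {R : Type*} [CommRing R] {p : ℕ} [Fact p.Prime] [CharP R p]
    {l : List ℕ} (hl : 1 < l.length) {m : ℕ}
    (h : lanePowCheck p (laneRadix p l.length) l.length (packList (laneRadix p l.length) p l) m =
      true) {α : R} (hα : α ^ l.length = ∑ i ∈ Finset.range l.length, (l.getD i 0 : R) * α ^ i) :
    α ^ m = 1 :=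
  pow_eq_one_of_lanePowCheck hl (hα ▸ isPacked_packList (Fact.out : p.Prime).pos) h

/-- The coefficients below `x ^ 10` of the product of `x ^ 5 + b x ^ 3 + c x ^ 2 + 1` with its
conjugate over `F_2`, in terms of the traces and norms of `b` and `c` and the trace of `b c ^ 2`. -/
def conjQuinticCoeffs (tb tc nb nc m : ℕ) : List ℕ := [1, 0, tc, tb, nc, m, nb, tc, tb, 0]

section

variable {F : Type*} [Field F] [CharP F 2]

theorem pow_ten_eq_of_pow_five_eq {x b c : F} (h : x ^ 5 = b * x ^ 3 + c * x ^ 2 + 1)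
    {tb tc nb nc m : ℕ} (htb : b + b ^ 2 = tb) (htc : c + c ^ 2 = tc) (hnb : b ^ 3 = nb)
    (hnc : c ^ 3 = nc) (hm : b * c ^ 2 + b ^ 2 * c = m) :
    x ^ 10 = ∑ i ∈ Finset.range 10, ((conjQuinticCoeffs tb tc nb nc m).getD i 0 : F) * x ^ i := by
  have h2 : (2 : F) = 0 := CharTwo.two_eq_zero
  simp only [conjQuinticCoeffs, Finset.sum_range_succ, Finset.sum_range_zero, List.getD_cons_succ,
    List.getD_cons_zero, Nat.cast_zero, Nat.cast_one, ← htb, ← htc, ← hnb, ← hnc, ← hm]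
  linear_combination (x ^ 5 + b ^ 2 * x ^ 3 + c ^ 2 * x ^ 2 + 1) * h -
    (b ^ 2 * x ^ 8 + c ^ 2 * x ^ 7) * h2

/-- The only elements of norm one whose trace and inverse trace to `F_4` vanish have order
dividing `31`. -/
theorem pow_thirtyOne_eq_one_of_pow_five_eq {x b c : F} (h : x ^ 5 = b * x ^ 3 + c * x ^ 2 + 1)
    (hb : b ^ 4 = b) (hc : c ^ 4 = c) (hx : x ^ 341 = 1) : x ^ 31 = 1 := by
  have h2 : (2 : F) = 0 := CharTwo.two_eq_zero
  have : Fact (Nat.Prime 2) := ⟨Nat.prime_two⟩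
  suffices x ^ 1328040 = 1 by
    have h3 := pow_gcd_eq_one.mpr ⟨this, hx⟩
    norm_num at h3
    exact h3
  have hcases : ∀ {y : F}, y ^ 4 = y → y = 0 ∨ y = 1 ∨ y ^ 2 = y + 1 := by
    intro y hy
    have h1 : y * ((y - 1) * (y ^ 2 - (y + 1))) = 0 := by linear_combination hy - (y ^ 3 - y) * h2
    simpa [sub_eq_zero] using h1
  have key : ∀ tb tc nb nc m : ℕ, b + b ^ 2 = tb → c + c ^ 2 = tc → b ^ 3 = nb → c ^ 3 = nc →
      b * c ^ 2 + b ^ 2 * c = m →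
      lanePowCheck 2 (laneRadix 2 10) 10 (packList (laneRadix 2 10) 2
        (conjQuinticCoeffs tb tc nb nc m)) 1328040 = true → x ^ 1328040 = 1 :=
    fun tb tc nb nc m htb htc hnb hnc hm hk =>
      pow_eq_one_of_sum_eq_pow (p := 2) (l := conjQuinticCoeffs tb tc nb nc m)
          (by simp [conjQuinticCoeffs]) hk
        (pow_ten_eq_of_pow_five_eq h htb htc hnb hnc hm)
  rcases hcases hb with rfl | rfl | hb <;> rcases hcases hc with rfl | rfl | hc
  · refine key 0 0 0 0 0 ?_ ?_ ?_ ?_ ?_ (by decide +kernel) <;> grind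
  · refine key 0 0 0 1 0 ?_ ?_ ?_ ?_ ?_ (by decide +kernel) <;> grind
  · refine key 0 1 0 1 0 ?_ ?_ ?_ ?_ ?_ (by decide +kernel) <;> grind
  · refine key 0 0 1 0 0 ?_ ?_ ?_ ?_ ?_ (by decide +kernel) <;> grind
  · refine key 0 0 1 1 0 ?_ ?_ ?_ ?_ ?_ (by decide +kernel) <;> grind
  · refine key 0 1 1 1 1 ?_ ?_ ?_ ?_ ?_ (by decide +kernel) <;> grind
  · refine key 1 0 1 0 0 ?_ ?_ ?_ ?_ ?_ (by decide +kernel) <;> grind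
  · refine key 1 0 1 1 1 ?_ ?_ ?_ ?_ ?_ (by decide +kernel) <;> grind
  · have hbc : (c - b) * (c - (b + 1)) = 0 := by grind
    rcases mul_eq_zero.mp hbc with hbc | hbc <;> obtain rfl := sub_eq_zero.mp hbc
    · refine key 1 1 1 1 0 ?_ ?_ ?_ ?_ ?_ (by decide +kernel) <;> grind
    · refine key 1 1 1 1 1 ?_ ?_ ?_ ?_ ?_ (by decide +kernel) <;> grind

theorem pow_thirtyOne_eq_one_of_sum_eq_zero {x : F} (hx : x ^ 341 = 1)
    (hs : ∑ i ∈ Finset.range 5, x ^ 4 ^ i = 0) (hs' : ∑ i ∈ Finset.range 5, x⁻¹ ^ 4 ^ i = 0) :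
    x ^ 31 = 1 := by
  have h2 : (2 : F) = 0 := CharTwo.two_eq_zero
  have hx0 : x ≠ 0 := by
    rintro rfl
    simp at hx
  have hfrob : ∀ y : F, iterateFrobenius F 2 2 y = y ^ 4 := fun y => iterateFrobenius_def 2 2 y
  obtain ⟨a₁, h₁⟩ : ∃ y, y = x ^ 4 := ⟨_, rfl⟩
  obtain ⟨a₂, h₂⟩ : ∃ y, y = a₁ ^ 4 := ⟨_, rfl⟩
  obtain ⟨a₃, h₃⟩ : ∃ y, y = a₂ ^ 4 := ⟨_, rfl⟩
  obtain ⟨a₄, h₄⟩ : ∃ y, y = a₃ ^ 4 := ⟨_, rfl⟩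
  have h₅ : a₄ ^ 4 = x := by
    rw [h₄, h₃, h₂, h₁]
    simp only [← pow_mul]
    rw [show 4 * 4 * 4 * 4 * 4 = 341 * 3 + 1 by norm_num, pow_succ, pow_mul, hx, one_pow, one_mul]
  have hprod : x * a₁ * a₂ * a₃ * a₄ = 1 := by
    rw [← hx, h₄, h₃, h₂, h₁]
    ring
  have he1 : x + a₁ + a₂ + a₃ + a₄ = 0 := by
    rw [← hs, h₄, h₃, h₂, h₁]
    simp only [Finset.sum_range_succ, Finset.sum_range_zero, ← pow_mul]
    norm_num
  have he4 : a₁ * a₂ * a₃ * a₄ + x * a₂ * a₃ * a₄ + x * a₁ * a₃ * a₄ + x * a₁ * a₂ * a₄ +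
      x * a₁ * a₂ * a₃ = 0 := by
    have h0 : x * a₁ * a₂ * a₃ * a₄ ≠ 0 := by simp [hprod]
    simp only [mul_ne_zero_iff] at h0
    obtain ⟨⟨⟨⟨-, h01⟩, h02⟩, h03⟩, h04⟩ := h0
    have he : x⁻¹ + a₁⁻¹ + a₂⁻¹ + a₃⁻¹ + a₄⁻¹ = 0 := by
      rw [← hs', h₄, h₃, h₂, h₁]
      simp only [Finset.sum_range_succ, Finset.sum_range_zero, ← pow_mul, inv_pow]
      norm_num
    field_simp at he
    linear_combination he
  refine pow_thirtyOne_eq_one_of_pow_five_eq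
    (b := x * a₁ + x * a₂ + x * a₃ + x * a₄ + a₁ * a₂ + a₁ * a₃ + a₁ * a₄ + a₂ * a₃ + a₂ * a₄ +
      a₃ * a₄)
    (c := x * a₁ * a₂ + x * a₁ * a₃ + x * a₁ * a₄ + x * a₂ * a₃ + x * a₂ * a₄ + x * a₃ * a₄ +
      a₁ * a₂ * a₃ + a₁ * a₂ * a₄ + a₁ * a₃ * a₄ + a₂ * a₃ * a₄) ?_ ?_ ?_ hx
  · linear_combination x ^ 4 * he1 - x * he4 + hprod - x ^ 3 * (x * a₁ + x * a₂ + x * a₃ + x * a₄ +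
      a₁ * a₂ + a₁ * a₃ + a₁ * a₄ + a₂ * a₃ + a₂ * a₄ + a₃ * a₄) * h2
  · simp only [← hfrob, map_add, map_mul]
    simp only [hfrob, ← h₁, ← h₂, ← h₃, ← h₄, h₅]
    ring
  · simp only [← hfrob, map_add, map_mul]
    simp only [hfrob, ← h₁, ← h₂, ← h₃, ← h₄, h₅]
    ring

/-- A primitive element of `F_{4^5}` and its inverse do not both have trace zero over `F_4`. -/
theorem not_sum_eq_zero_of_orderOf_eq {α : F} (hα : orderOf α = 1023)
    (hs : ∑ i ∈ Finset.range 5, α ^ 4 ^ i = 0) :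
    ∑ i ∈ Finset.range 5, α⁻¹ ^ 4 ^ i ≠ 0 := by
  intro hs'
  have h1 : α ^ 1023 = 1 := hα ▸ pow_orderOf_eq_one α
  have hα0 : α ≠ 0 := by
    rintro rfl
    simp at h1
  have hN : ∀ i, (α ^ 341) ^ 4 ^ i = α ^ 341 := by
    intro i
    induction i with
    | zero => simp
    | succ i ih =>
      rw [pow_succ (4 : ℕ) i, pow_mul, ih, ← pow_mul, show 341 * 4 = 1023 + 341 by norm_num,
        pow_add, h1, one_mul]
  have hNinv : ∀ i, (α ^ 341)⁻¹ ^ 4 ^ i = (α ^ 341)⁻¹ := fun i => by rw [inv_pow, hN]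
  have h2 := pow_thirtyOne_eq_one_of_sum_eq_zero (x := α ^ 341 * α) ?_ ?_ ?_
  · rw [← pow_succ, ← pow_mul] at h2
    have h3 := orderOf_dvd_of_pow_eq_one h2
    rw [hα] at h3
    norm_num at h3
  · rw [← pow_succ, ← pow_mul, show (341 + 1) * 341 = 1023 * 114 by norm_num, pow_mul, h1, one_pow]
  · simp_rw [mul_pow, hN, ← Finset.mul_sum, hs, mul_zero]
  · simp_rw [mul_inv, mul_pow, hNinv, ← Finset.mul_sum, hs', mul_zero]

end

section

variable {k F : Type*} [Field k] [Fintype k] [Field F] [Algebra k F]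

theorem sum_eq_zero_of_isKNormal_one (hk : Fintype.card k = 4) {α : F}
    (hα : IsKNormal k 4 5 1 α) : ∑ i ∈ Finset.range 5, α ^ 4 ^ i = 0 := by
  obtain ⟨h, ⟨hmonic, ⟨g, hg⟩, hact, -⟩, hdeg⟩ := hα
  have hX : (X ^ 5 - 1 : k[X]).Monic := by
    simpa using monic_X_pow_sub_C (1 : k) (by norm_num : 5 ≠ 0)
  have hXdeg : (X ^ 5 - 1 : k[X]).natDegree = 5 := by
    simpa using natDegree_X_pow_sub_C (n := 5) (r := (1 : k))
  have hgm : g.Monic := hmonic.of_mul_monic_left (hg ▸ hX)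
  have hgdeg : g.natDegree = 1 := by
    rw [hg, hmonic.natDegree_mul hgm, hdeg] at hXdeg
    omega
  obtain ⟨c, rfl⟩ : ∃ c : k, g = X - C c :=
    ⟨-g.coeff 0, by rw [map_neg, sub_neg_eq_add]; exact hgm.eq_X_add_C hgdeg⟩
  have hc5 : c ^ 5 = 1 := by
    have := congrArg (eval c) hg
    simpa [sub_eq_zero] using this
  have hc0 : c ≠ 0 := by
    rintro rfl
    simp at hc5
  have hc3 : c ^ 3 = 1 := by
    have := FiniteField.pow_card_sub_one_eq_one c hc0
    rwa [hk] at this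
  obtain rfl : c = 1 := by linear_combination (c ^ 3 + 1) * hc3 - c * hc5
  have hh : h = ∑ i ∈ Finset.range 5, X ^ i := by
    refine mul_right_cancel₀ (X_sub_C_ne_zero (1 : k)) ?_
    rw [← hg, map_one, geom_sum_mul]
  rw [← hact, polyAct, sum_over_range' _ (by simp) 5 (by omega)]
  refine Finset.sum_congr rfl fun i hi => ?_
  rw [hh]
  simp [coeff_X_pow, Finset.mem_range.mp hi]

end

/-- For `n ∈ {5, 6}` and any prime power `q` with `gcd(q, n) = 1`, there is
`α ∈ F_{q^n}^*` such that both `α` and `α⁻¹` are simultaneously primitive and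
`1`-normal over `F_q`, with the sole genuine exception `(q, n) = (4, 5)`,
for which no such `α` exists. -/
theorem exists_primitive_one_normal_pair_of_n_five_or_six'
    (q n : ℕ) (hq : IsPrimePow q) (hn : n = 5 ∨ n = 6) (hgcd : Nat.gcd q n = 1)
    (Fq F : Type*) [Field Fq] [Field F] [Fintype Fq] [Fintype F] [Algebra Fq F]
    (hcard : Fintype.card Fq = q) (hdim : Module.finrank Fq F = n) :
    (¬(q = 4 ∧ n = 5) →
      ∃ α : F, α ≠ 0 ∧ orderOf α = q ^ n - 1 ∧ orderOf α⁻¹ = q ^ n - 1 ∧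
        IsKNormal Fq q n 1 α ∧ IsKNormal Fq q n 1 α⁻¹) ∧
    ((q = 4 ∧ n = 5) →
      ¬ ∃ α : F, α ≠ 0 ∧ orderOf α = q ^ n - 1 ∧ orderOf α⁻¹ = q ^ n - 1 ∧
        IsKNormal Fq q n 1 α ∧ IsKNormal Fq q n 1 α⁻¹) := by
  have hcardF : Fintype.card F = q ^ n := hcard ▸ card_eq_pow_of_finrank_eq hdim
  have hn0 : n ≠ 0 := by omega
  constructor
  · intro hne
    have hnF : (n : F) ≠ 0 := fun h0 => by
      have hqF : (q : F) = 0 := by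
        have h := Nat.cast_card_eq_zero F
        rw [hcardF, Nat.cast_pow] at h
        exact eq_zero_of_pow_eq_zero h
      have h1 := congrArg (Int.cast : ℤ → F) (Nat.gcd_eq_gcd_ab q n)
      simp [hgcd, h0, hqF] at h1
    have : NeZero (n : AlgebraicClosure F) :=
      ⟨fun h => hnF ((algebraMap F (AlgebraicClosure F)).injective (by simpa using h))⟩
    have : NeZero n := ⟨hn0⟩
    obtain ⟨ζ, hζ⟩ := HasEnoughRootsOfUnity.exists_primitiveRoot (AlgebraicClosure F) n
    obtain ⟨α, hα⟩ : ∃ α : F, IsGoodElement Fq (AlgebraicClosure F) α := by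
      rcases hn with rfl | rfl
      · exact exists_isGoodElement_five hdim hζ hcard hq hgcd fun h => hne ⟨h, rfl⟩
      · exact exists_isGoodElement_six hdim hζ hcard hq hgcd
    rw [← hdim] at hζ
    simpa only [hcardF, hcard, hdim] using hα.exists_primitive_isKNormal hζ
  · rintro ⟨rfl, rfl⟩ ⟨α, -, hord, -, hα, hα'⟩
    have : Fact (Nat.Prime 2) := ⟨Nat.prime_two⟩
    have : CharP F 2 :=
      charP_of_card_eq_prime_pow (f := 10) (by simpa using hcardF)
    exact not_sum_eq_zero_of_orderOf_eq hord (sum_eq_zero_of_isKNormal_one hcard hα)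
      (sum_eq_zero_of_isKNormal_one hcard hα')

end
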